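/- arXiv:2501.14187 — 6 statements merged into one kernel-verified Lean document; each statement's English description precedes it below -/
import Mathlib

section
/- Fix a nonzero integer k, ν > 0 and B ≠ 0. For any positive continuous functions a₁(r), a₂(r) on [1,∞) and any strictly decreasing continuous function φ(r) on [1,∞), there exists a sequence of pairs (wₙ, fₙ) of smooth functions on [0,∞)×[1,∞) such that for every n: (i) ∂_t wₙ + 𝒯_k wₙ = fₙ on (0,∞)×(1,∞), wₙ(0,·) = 0, wₙ(t,1) = 0, and wₙ(t,·) has compact support in [1,∞) for each t; (ii) the weighted norms ‖e^{tφ(r)} a₁(r) wₙ‖_{L²((0,∞); L²_r)} and ‖e^{tφ(r)} a₂(r) fₙ‖_{L²((0,∞); L²_r)} are finite, with ‖e^{tφ(r)} a₂(r) fₙ‖_{L²((0,∞); L²_r)} > 0; and (iii) limsup_{n→∞} ‖e^{tφ(r)} a₁(r) wₙ‖_{L²((0,∞); L²_r)} / ‖e^{tφ(r)} a₂(r) fₙ‖_{L²((0,∞); L²_r)} = +∞. -/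
open MeasureTheory Set

/-- The linearized Taylor–Couette operator. -/
noncomputable def TaylorCouetteOp (ν B : ℝ) (k : ℤ) (w : ℝ → ℂ) (r : ℝ) : ℂ :=
  -(ν : ℂ) * (deriv (deriv w) r - (((k : ℂ) ^ 2 - 1 / 4) / (r : ℂ) ^ 2) * w r)
    + Complex.I * (k : ℂ) * (B : ℂ) / (r : ℂ) ^ 2 * w r

open Filter Topology

theorem contDiff_mul_of_eventuallyEq_zero {u v : ℝ → ℂ}
    (hu : ContDiff ℝ (⊤ : ℕ∞) u) (hu0 : u =ᶠ[𝓝 0] 0)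
    (hv : ∀ r : ℝ, r ≠ 0 → ContDiffAt ℝ (⊤ : ℕ∞) v r) :
    ContDiff ℝ (⊤ : ℕ∞) (fun r => v r * u r) := by
  rw [contDiff_iff_contDiffAt]
  intro r
  rcases eq_or_ne r 0 with rfl | hr
  · refine (contDiffAt_const (c := (0 : ℂ))).congr_of_eventuallyEq ?_
    filter_upwards [hu0] with x hx
    simp [hx]
  · exact (hv r hr).mul hu.contDiffAt

theorem contDiff_taylorCouetteOp {ν B : ℝ} {k : ℤ} {g : ℝ → ℂ}
    (hg : ContDiff ℝ (⊤ : ℕ∞) g) (hg0 : g =ᶠ[𝓝 0] 0) :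
    ContDiff ℝ (⊤ : ℕ∞) (TaylorCouetteOp ν B k g) := by
  have h1 : ContDiff ℝ (⊤ : ℕ∞) (deriv g) := (contDiff_infty_iff_deriv.1 hg).2
  have h2 : ContDiff ℝ (⊤ : ℕ∞) (deriv (deriv g)) := (contDiff_infty_iff_deriv.1 h1).2
  have key : ∀ κ : ℂ, ContDiff ℝ (⊤ : ℕ∞) (fun r : ℝ => κ / (r : ℂ) ^ 2 * g r) := by
    intro κ
    refine contDiff_mul_of_eventuallyEq_zero hg hg0 fun r hr => ?_
    have hc : ContDiffAt ℝ (⊤ : ℕ∞) (fun r : ℝ => (r : ℂ)) r :=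
      Complex.ofRealCLM.contDiff.contDiffAt
    simp only [div_eq_mul_inv]
    exact contDiffAt_const.mul ((hc.pow 2).inv (pow_ne_zero 2 (Complex.ofReal_ne_zero.2 hr)))
  unfold TaylorCouetteOp
  exact (contDiff_const.mul (h2.sub (key _))).add (key _)

theorem taylorCouetteOp_congr {ν B : ℝ} {k : ℤ} {u v : ℝ → ℂ} {r : ℝ} (h : u =ᶠ[𝓝 r] v) :
    TaylorCouetteOp ν B k u r = TaylorCouetteOp ν B k v r := by
  simp only [TaylorCouetteOp, h.eq_of_nhds, h.deriv.deriv_eq]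

theorem taylorCouetteOp_const_mul (ν B : ℝ) (k : ℤ) (c : ℂ) (u : ℝ → ℂ) (r : ℝ) :
    TaylorCouetteOp ν B k (fun x => c * u x) r = c * TaylorCouetteOp ν B k u r := by
  have h : deriv (fun x => c * u x) = fun x => c * deriv u x :=
    funext fun x => deriv_const_mul_field c
  simp only [TaylorCouetteOp, h, deriv_const_mul_field]
  ring

theorem taylorCouetteOp_cubic {ν B : ℝ} {k : ℤ} (hν : ν ≠ 0) (l : ℝ) {κ c : ℂ}
    (hκ : κ = ν * ((k : ℂ) ^ 2 - 1 / 4) + Complex.I * k * B) (hc : c = (κ - l) / (6 * ν))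
    {r : ℝ} (hr : r ≠ 0) :
    TaylorCouetteOp ν B k (fun x : ℝ => ((x : ℂ) - 1) + c * ((x : ℂ) - 1) ^ 3) r
        - l * (((r : ℂ) - 1) + c * ((r : ℂ) - 1) ^ 3)
      = ((r : ℂ) - 1) ^ 2 * (-2 * κ + ((r : ℂ) - 1) *
          (κ * c - l - 6 * ν * c - l * c * (r : ℂ) ^ 2)) / (r : ℂ) ^ 2 := by
  have hx : ∀ x : ℝ, HasDerivAt (fun x : ℝ => (x : ℂ) - 1) 1 x := fun x =>
    (Complex.ofRealCLM.hasDerivAt (x := x)).sub_const 1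
  have h1 : deriv (fun x : ℝ => ((x : ℂ) - 1) + c * ((x : ℂ) - 1) ^ 3)
      = fun x : ℝ => 1 + c * (3 * ((x : ℂ) - 1) ^ 2) := by
    ext x
    refine (((hx x).add (((hx x).pow 3).const_mul c)).deriv).trans ?_
    simp
  have h2 : deriv (fun x : ℝ => 1 + c * (3 * ((x : ℂ) - 1) ^ 2)) r
      = 6 * c * ((r : ℂ) - 1) := by
    refine ((((((hx r).pow 2).const_mul (3 : ℂ)).const_mul c).const_add 1).deriv).trans ?_
    simp
    ring
  have hr' : (r : ℂ) ≠ 0 := Complex.ofReal_ne_zero.2 hr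
  have hν' : (ν : ℂ) ≠ 0 := Complex.ofReal_ne_zero.2 hν
  have hcν : 6 * (ν : ℂ) * c = κ - l := by rw [hc]; field_simp
  have e : TaylorCouetteOp ν B k (fun x : ℝ => ((x : ℂ) - 1) + c * ((x : ℂ) - 1) ^ 3) r
      = -(6 * (ν : ℂ) * c) * ((r : ℂ) - 1)
        + κ / (r : ℂ) ^ 2 * (((r : ℂ) - 1) + c * ((r : ℂ) - 1) ^ 3) := by
    simp only [TaylorCouetteOp, h1, h2, hκ]
    ring
  rw [e, hcν]
  field_simp
  ring

/-- A smooth compactly supported profile that vanishes at `r = 1` and is, to leading order at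
`r = 1`, an eigenfunction of the Taylor–Couette operator with a prescribed real eigenvalue. -/
theorem exists_boundary_quasimode {k : ℤ} (hk : k ≠ 0) {ν B : ℝ} (hν : ν ≠ 0) (hB : B ≠ 0)
    (l : ℝ) :
    ∃ g : ℝ → ℂ, ContDiff ℝ (⊤ : ℕ∞) g ∧ ContDiff ℝ (⊤ : ℕ∞) (TaylorCouetteOp ν B k g) ∧
      g 1 = 0 ∧ (∀ r, 2 ≤ r → g r = 0 ∧ TaylorCouetteOp ν B k g r = 0) ∧
      ∃ C, ∃ d > 0, ∀ r ∈ Ioo 1 (1 + d), g r ≠ 0 ∧ TaylorCouetteOp ν B k g r - l * g r ≠ 0 ∧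
        ‖TaylorCouetteOp ν B k g r - l * g r‖ ≤ C * (r - 1) * ‖g r‖ := by
  obtain ⟨κ, hκ⟩ : ∃ κ : ℂ, κ = ν * ((k : ℂ) ^ 2 - 1 / 4) + Complex.I * k * B := ⟨_, rfl⟩
  obtain ⟨c, hc⟩ : ∃ c : ℂ, c = (κ - l) / (6 * ν) := ⟨_, rfl⟩
  have hκ0 : κ ≠ 0 := by
    intro h
    have := congrArg Complex.im (hκ.symm.trans h)
    have e : (ν : ℂ) * ((k : ℂ) ^ 2 - 1 / 4) + Complex.I * k * B
        = ((ν * ((k : ℝ) ^ 2 - 1 / 4) : ℝ) : ℂ) + Complex.I * ((k * B : ℝ) : ℂ) := by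
      push_cast; ring
    rw [e, Complex.add_im, Complex.ofReal_im, Complex.I_mul_im, Complex.ofReal_re, zero_add,
      Complex.zero_im] at this
    exact mul_ne_zero (Int.cast_ne_zero.2 hk) hB this
  let χ : ContDiffBump (1 : ℝ) := ⟨1 / 4, 1 / 2, by norm_num, by norm_num⟩
  let h : ℝ → ℂ := fun x => ((x : ℂ) - 1) + c * ((x : ℂ) - 1) ^ 3
  let g : ℝ → ℂ := fun x => (χ x : ℂ) * h x
  have hh : ContDiff ℝ (⊤ : ℕ∞) h := by
    have : ContDiff ℝ (⊤ : ℕ∞) (fun x : ℝ => (x : ℂ) - 1) :=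
      Complex.ofRealCLM.contDiff.sub contDiff_const
    exact this.add (contDiff_const.mul (this.pow 3))
  have hg : ContDiff ℝ (⊤ : ℕ∞) g := (Complex.ofRealCLM.contDiff.comp χ.contDiff).mul hh
  have hzero : ∀ r : ℝ, 1 / 2 < |r - 1| → g =ᶠ[𝓝 r] 0 := by
    intro r hr
    have : ∀ᶠ x in 𝓝 r, 1 / 2 < |x - 1| :=
      (continuous_abs.comp (continuous_sub_right (1 : ℝ))).continuousAt.eventually_const_lt hr
    filter_upwards [this] with x hx
    have : χ x = 0 := χ.zero_of_le_dist (by rw [Real.dist_eq]; exact hx.le)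
    simp [g, this]
  have hnear : ∀ r ∈ Ioo (1 : ℝ) (1 + 1 / 4), g =ᶠ[𝓝 r] h := by
    intro r hr
    filter_upwards [Ioo_mem_nhds hr.1 hr.2] with x hx
    have : χ x = 1 := by
      refine χ.one_of_mem_closedBall ?_
      rw [Metric.mem_closedBall, Real.dist_eq, abs_of_pos (by linarith [hx.1])]
      change x - 1 ≤ 1 / 4
      linarith [hx.2]
    simp [g, this]
  let Q : ℝ → ℂ := fun r => κ * c - l - 6 * ν * c - l * c * (r : ℂ) ^ 2
  let P : ℝ → ℂ := fun r => -2 * κ + ((r : ℂ) - 1) * Q r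
  have hP : Continuous P := by fun_prop
  have hP1 : P 1 = -2 * κ := by simp [P]
  have ev1 : ∀ᶠ r in 𝓝 (1 : ℝ), P r ≠ 0 :=
    hP.continuousAt.eventually_ne (by rw [hP1]; simpa using hκ0)
  have ev2 : ∀ᶠ r in 𝓝 (1 : ℝ), ‖P r‖ < 2 * ‖κ‖ + 1 := by
    refine hP.norm.continuousAt.eventually_lt_const ?_
    simp [hP1]
  have ev3 : ∀ᶠ r : ℝ in 𝓝 1, 1 / 2 < ‖1 + c * ((r : ℂ) - 1) ^ 2‖ := by
    have : Continuous fun r : ℝ => ‖1 + c * ((r : ℂ) - 1) ^ 2‖ := by fun_prop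
    refine this.continuousAt.eventually_const_lt ?_
    norm_num
  obtain ⟨d, hd, hball⟩ := Metric.eventually_nhds_iff.1 (ev1.and (ev2.and ev3))
  refine ⟨g, hg, contDiff_taylorCouetteOp hg (hzero 0 (by norm_num)), by simp [g, h], ?_,
    2 * (2 * ‖κ‖ + 1), min d (1 / 4), by positivity, ?_⟩
  · intro r hr
    have := hzero r (by rw [abs_of_pos] <;> linarith)
    refine ⟨this.eq_of_nhds, ?_⟩
    rw [taylorCouetteOp_congr this]
    simp [TaylorCouetteOp]
  · intro r hr
    have hr0 : 0 < r - 1 := by linarith [hr.1]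
    have hrd : r - 1 < d := by linarith [hr.2, min_le_left d (1 / 4)]
    obtain ⟨p1, p2, p3⟩ := hball (y := r) (by rwa [Real.dist_eq, abs_of_pos hr0])
    have hn := hnear r ⟨hr.1, by linarith [hr.2, min_le_right d (1 / 4)]⟩
    have hgr : g r = ((r : ℂ) - 1) * (1 + c * ((r : ℂ) - 1) ^ 2) := by
      rw [hn.eq_of_nhds]; simp only [h]; ring
    have hs : ‖(r : ℂ) - 1‖ = r - 1 := by
      rw [← Complex.ofReal_one, ← Complex.ofReal_sub, Complex.norm_real, Real.norm_eq_abs,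
        abs_of_pos hr0]
    have hs0 : (r : ℂ) - 1 ≠ 0 := by rw [← norm_pos_iff, hs]; exact hr0
    have hr1 : (r : ℂ) ≠ 0 := Complex.ofReal_ne_zero.2 (by linarith)
    have hG : TaylorCouetteOp ν B k g r - l * g r = ((r : ℂ) - 1) ^ 2 * P r / (r : ℂ) ^ 2 := by
      rw [taylorCouetteOp_congr hn, hn.eq_of_nhds]
      exact taylorCouetteOp_cubic hν l hκ hc (by linarith)
    refine ⟨?_, ?_, ?_⟩
    · rw [hgr]
      exact mul_ne_zero hs0 (by rw [← norm_pos_iff]; linarith)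
    · rw [hG]
      exact div_ne_zero (mul_ne_zero (pow_ne_zero 2 hs0) p1) (pow_ne_zero 2 hr1)
    · rw [hG, hgr, norm_div, norm_mul, norm_mul, norm_pow, norm_pow, hs, Complex.norm_real,
        Real.norm_eq_abs, sq_abs]
      rw [div_le_iff₀ (by nlinarith)]
      have hr2 : 1 ≤ r ^ 2 := by nlinarith
      have a : (r - 1) ^ 2 * ‖P r‖ ≤ (r - 1) ^ 2 * (2 * ‖κ‖ + 1) := by gcongr
      have b : (r - 1) ^ 2 * (2 * ‖κ‖ + 1)
          ≤ 2 * (2 * ‖κ‖ + 1) * (r - 1) * ((r - 1) * ‖1 + c * ((r : ℂ) - 1) ^ 2‖) := by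
        have : 0 ≤ (r - 1) ^ 2 * (2 * ‖κ‖ + 1) := by positivity
        nlinarith
      exact (a.trans b).trans (le_mul_of_one_le_right (by positivity) hr2)

theorem integrableOn_exp_neg_mul {ψ p : ℝ → ℝ} (hψc : ContinuousOn ψ (Ici 1))
    (hψ0 : ∀ r ∈ Ici (1 : ℝ), 0 ≤ ψ r) (hp : IntegrableOn p (Ioi 1)) {t : ℝ} (ht : 0 ≤ t) :
    IntegrableOn (fun r => Real.exp (-(t * ψ r)) * p r) (Ioi 1) := by
  refine Integrable.bdd_mul (c := 1) hp ?_ ?_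
  · refine ContinuousOn.aestronglyMeasurable ?_ measurableSet_Ioi
    exact ((continuousOn_const.mul (hψc.mono Ioi_subset_Ici_self)).neg).rexp
  · filter_upwards [ae_restrict_mem measurableSet_Ioi] with r hr
    rw [Real.norm_eq_abs, Real.abs_exp, Real.exp_le_one_iff]
    have := mul_nonneg ht (hψ0 r (Ioi_subset_Ici_self hr))
    linarith

theorem setIntegral_Ioi_pos_of_pos_near {p : ℝ → ℝ} (hp : IntegrableOn p (Ioi 1))
    (hp0 : ∀ r ∈ Ioi (1 : ℝ), 0 ≤ p r) {d : ℝ} (hd : 0 < d)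
    (hpos : ∀ r ∈ Ioo (1 : ℝ) (1 + d), 0 < p r) :
    0 < ∫ r in Ioi 1, p r := by
  rw [setIntegral_pos_iff_support_of_nonneg_ae
    ((ae_restrict_mem measurableSet_Ioi).mono hp0) hp]
  refine lt_of_lt_of_le ?_ (measure_mono (s := Ioo (1 : ℝ) (1 + d))
    fun r hr => ⟨(hpos r hr).ne', hr.1⟩)
  simp [hd]

/-- Laplace's principle: if `q = o(p)` at the point `r = 1` where the increasing function `ψ` is
minimal, then `∫ e^{-tψ} q = o(∫ e^{-tψ} p)` as `t → ∞`. -/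
theorem eventually_laplace_integral_le {ψ p q : ℝ → ℝ} (hψc : ContinuousOn ψ (Ici 1))
    (hψm : StrictMonoOn ψ (Ici 1)) (hψ1 : ψ 1 = 0)
    (hp : IntegrableOn p (Ioi 1)) (hq : IntegrableOn q (Ioi 1))
    (hp0 : ∀ r ∈ Ioi (1 : ℝ), 0 ≤ p r) (hq0 : ∀ r ∈ Ioi (1 : ℝ), 0 ≤ q r)
    {d : ℝ} (hd : 0 < d) (hpos : ∀ r ∈ Ioo (1 : ℝ) (1 + d), 0 < p r)
    (hqp : ∀ ε > 0, ∃ δ > 0, ∀ r ∈ Ioo (1 : ℝ) (1 + δ), q r ≤ ε * p r) {ε : ℝ} (hε : 0 < ε) :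
    ∀ᶠ t in atTop, ∫ r in Ioi 1, Real.exp (-(t * ψ r)) * q r
      ≤ ε * ∫ r in Ioi 1, Real.exp (-(t * ψ r)) * p r := by
  have hψ0 : ∀ r ∈ Ici (1 : ℝ), 0 ≤ ψ r := fun r hr => by
    rw [← hψ1]; exact hψm.monotoneOn self_mem_Ici hr hr
  obtain ⟨δ, hδ, hqδ⟩ := hqp (ε / 2) (half_pos hε)
  set K := ∫ r in Ioi 1, q r
  have hgap : ψ (1 + δ / 2) < ψ (1 + δ) :=
    hψm (by simp; linarith) (by simp; linarith) (by linarith)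
  set c := ∫ r in Ioc 1 (1 + δ / 2), p r with hcdef
  have hsub : Ioc (1 : ℝ) (1 + δ / 2) ⊆ Ioi 1 := fun r hr => hr.1
  have hc : 0 < c := by
    rw [hcdef, setIntegral_pos_iff_support_of_nonneg_ae
      ((ae_restrict_mem measurableSet_Ioc).mono fun r hr => hp0 r hr.1) (hp.mono_set hsub)]
    refine lt_of_lt_of_le ?_ (measure_mono (s := Ioo (1 : ℝ) (1 + min d (δ / 2))) fun r hr =>
      ⟨(hpos r ⟨hr.1, by linarith [hr.2, min_le_left d (δ / 2)]⟩).ne', hr.1,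
        by linarith [hr.2, min_le_right d (δ / 2)]⟩)
    simp [hd, hδ]
  have hlim : Tendsto (fun t : ℝ => K * Real.exp (-(t * (ψ (1 + δ) - ψ (1 + δ / 2)))))
      atTop (𝓝 0) := by
    have : Tendsto (fun t : ℝ => t * (ψ (1 + δ) - ψ (1 + δ / 2))) atTop atTop :=
      tendsto_id.atTop_mul_const (sub_pos.2 hgap)
    simpa using (Real.tendsto_exp_neg_atTop_nhds_zero.comp this).const_mul K
  filter_upwards [eventually_ge_atTop 0, hlim.eventually_le_const (u := ε / 2 * c) (by positivity)]
    with t ht htK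
  have ip := integrableOn_exp_neg_mul hψc hψ0 hp ht
  have iq := integrableOn_exp_neg_mul hψc hψ0 hq ht
  have hm : Real.exp (-(t * ψ (1 + δ / 2))) * c ≤ ∫ r in Ioi 1, Real.exp (-(t * ψ r)) * p r := by
    rw [hcdef, ← integral_const_mul]
    refine (setIntegral_mono_on ((hp.mono_set hsub).const_mul _) (ip.mono_set hsub)
      measurableSet_Ioc fun r hr => ?_).trans (setIntegral_mono_set ip
      ((ae_restrict_mem measurableSet_Ioi).mono fun r hr =>
        mul_nonneg (Real.exp_nonneg _) (hp0 r hr)) hsub.eventuallyLE)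
    have := hψm.monotoneOn (a := r) (b := 1 + δ / 2) (le_of_lt hr.1) (by simp; linarith) hr.2
    have := hp0 r hr.1
    gcongr
  have hn : ∫ r in Ioi 1, Real.exp (-(t * ψ r)) * q r
      ≤ ∫ r in Ioi 1, (ε / 2 * (Real.exp (-(t * ψ r)) * p r)
        + Real.exp (-(t * ψ (1 + δ))) * q r) := by
    refine setIntegral_mono_on iq ((ip.const_mul _).add (hq.const_mul _)) measurableSet_Ioi
      fun r hr => ?_
    have h1 := hp0 r hr
    have h2 := hq0 r hr
    rcases lt_or_ge r (1 + δ) with h | h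
    · have := mul_le_mul_of_nonneg_left (hqδ r ⟨hr, h⟩) (Real.exp_nonneg (-(t * ψ r)))
      have : 0 ≤ Real.exp (-(t * ψ (1 + δ))) * q r := by positivity
      linarith
    · have := hψm.monotoneOn (a := 1 + δ) (b := r) (by simp; linarith) (Ioi_subset_Ici_self hr) h
      have h3 : Real.exp (-(t * ψ r)) * q r ≤ Real.exp (-(t * ψ (1 + δ))) * q r := by gcongr
      have : 0 ≤ ε / 2 * (Real.exp (-(t * ψ r)) * p r) := by positivity
      linarith
  rw [integral_add (ip.const_mul _) (hq.const_mul _), integral_const_mul, integral_const_mul] at hn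
  have e : Real.exp (-(t * ψ (1 + δ)))
      = Real.exp (-(t * (ψ (1 + δ) - ψ (1 + δ / 2)))) * Real.exp (-(t * ψ (1 + δ / 2))) := by
    rw [← Real.exp_add]; ring_nf
  have h4 := mul_le_mul_of_nonneg_right htK (Real.exp_nonneg (-(t * ψ (1 + δ / 2))))
  have h5 := mul_le_mul_of_nonneg_left hm (half_pos hε).le
  rw [e] at hn
  linarith

/-- `∫ e^{-tψ} p` decays subexponentially. -/
theorem eventually_half_laplace_integral_le {ψ p : ℝ → ℝ} (hψc : ContinuousOn ψ (Ici 1))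
    (hψm : StrictMonoOn ψ (Ici 1)) (hψ1 : ψ 1 = 0)
    (hp : IntegrableOn p (Ioi 1)) (hp0 : ∀ r ∈ Ioi (1 : ℝ), 0 ≤ p r)
    {d : ℝ} (hd : 0 < d) (hpos : ∀ r ∈ Ioo (1 : ℝ) (1 + d), 0 < p r) {N : ℝ} (hN : 0 ≤ N) :
    ∀ᶠ t in atTop, (∫ r in Ioi 1, Real.exp (-(t * ψ r)) * p r) / 2
      ≤ ∫ r in Ioi 1, Real.exp (-((t + N) * ψ r)) * p r := by
  have hψ0 : ∀ r ∈ Ici (1 : ℝ), 0 ≤ ψ r := fun r hr => by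
    rw [← hψ1]; exact hψm.monotoneOn self_mem_Ici hr hr
  have iN := integrableOn_exp_neg_mul hψc hψ0 hp hN
  have key := eventually_laplace_integral_le (q := fun r => p r - Real.exp (-(N * ψ r)) * p r)
    hψc hψm hψ1 hp (hp.sub iN) hp0 (fun r hr => ?_) hd hpos (fun ε hε => ?_) (half_pos one_pos)
  · filter_upwards [key, eventually_ge_atTop 0] with t h ht
    have ip := integrableOn_exp_neg_mul hψc hψ0 hp ht
    have ipN := integrableOn_exp_neg_mul hψc hψ0 hp (add_nonneg ht hN)
    have e : ∀ r, Real.exp (-(t * ψ r)) * (p r - Real.exp (-(N * ψ r)) * p r)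
        = Real.exp (-(t * ψ r)) * p r - Real.exp (-((t + N) * ψ r)) * p r := fun r => by
      have : Real.exp (-((t + N) * ψ r)) = Real.exp (-(t * ψ r)) * Real.exp (-(N * ψ r)) := by
        rw [← Real.exp_add]; ring_nf
      rw [this]; ring
    simp only [e] at h
    rw [integral_sub ip ipN] at h
    linarith
  · have h1 : Real.exp (-(N * ψ r)) ≤ 1 := by
      rw [Real.exp_le_one_iff]
      have := mul_nonneg hN (hψ0 r (Ioi_subset_Ici_self hr))
      linarith
    have := mul_le_mul_of_nonneg_right h1 (hp0 r hr)
    linarith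
  · have hc : ContinuousWithinAt (fun r => 1 - Real.exp (-(N * ψ r))) (Ici 1) 1 :=
      continuousWithinAt_const.sub
        ((continuousWithinAt_const.mul (hψc 1 self_mem_Ici)).neg.rexp)
    have ev := hc.eventually_le_const (u := ε) (by simpa [hψ1] using hε)
    rw [eventually_nhdsWithin_iff, Metric.eventually_nhds_iff] at ev
    obtain ⟨δ, hδ, hb⟩ := ev
    refine ⟨δ, hδ, fun r hr => ?_⟩
    have := hb (y := r) (by rw [Real.dist_eq, abs_of_pos] <;> linarith [hr.1, hr.2])
      (le_of_lt hr.1)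
    have := mul_le_mul_of_nonneg_right this (hp0 r hr.1)
    linarith

theorem laplace_integral_anti {ψ p : ℝ → ℝ} (hψc : ContinuousOn ψ (Ici 1))
    (hψ0 : ∀ r ∈ Ici (1 : ℝ), 0 ≤ ψ r) (hp : IntegrableOn p (Ioi 1))
    (hp0 : ∀ r ∈ Ioi (1 : ℝ), 0 ≤ p r) {s t : ℝ} (hs : 0 ≤ s) (hst : s ≤ t) :
    ∫ r in Ioi 1, Real.exp (-(t * ψ r)) * p r ≤ ∫ r in Ioi 1, Real.exp (-(s * ψ r)) * p r := by
  refine setIntegral_mono_on (integrableOn_exp_neg_mul hψc hψ0 hp (hs.trans hst))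
    (integrableOn_exp_neg_mul hψc hψ0 hp hs) measurableSet_Ioi fun r hr => ?_
  have h1 := hp0 r hr
  have h2 := hψ0 r (Ioi_subset_Ici_self hr)
  gcongr

theorem exists_time_cutoff :
    ∃ D : ℝ, ∀ N > 0, ∀ L : ℝ, ∃ θ : ℝ → ℝ, ContDiff ℝ (⊤ : ℕ∞) θ ∧
      (∀ t, |θ t| ≤ 1) ∧ (∀ t, |deriv θ t| ≤ D / N) ∧
      (∀ t ∉ Ioo L (L + N), θ t = 0 ∧ deriv θ t = 0) ∧
      ∀ t ∈ Ioo (L + N / 4) (L + 3 * N / 4), θ t = 1 ∧ deriv θ t = 0 := by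
  let β : ContDiffBump (1 / 2 : ℝ) := ⟨1 / 4, 1 / 2, by norm_num, by norm_num⟩
  have hβ : ContDiff ℝ (⊤ : ℕ∞) β := β.contDiff
  obtain ⟨D, hD⟩ := (β.hasCompactSupport.deriv).exists_bound_of_continuous
    (hβ.continuous_deriv (by simp))
  refine ⟨D, fun N hN L => ⟨fun t => β ((t - L) / N), ?_, ?_, ?_, ?_, ?_⟩⟩
  · exact hβ.comp ((contDiff_id.sub contDiff_const).div_const N)
  · intro t
    rw [abs_of_nonneg β.nonneg]
    exact β.le_one
  · intro t
    have h1 : HasDerivAt (fun t : ℝ => (t - L) / N) (1 / N) t :=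
      ((hasDerivAt_id t).sub_const L).div_const N
    have h2 : HasDerivAt β (deriv β ((t - L) / N)) ((t - L) / N) :=
      (hβ.differentiable (by simp)).differentiableAt.hasDerivAt
    have h3 := (h2.comp t h1).deriv
    rw [show (fun t => β ((t - L) / N)) = β ∘ fun t : ℝ => (t - L) / N from rfl, h3, abs_mul,
      abs_of_pos (one_div_pos.2 hN), mul_one_div]
    gcongr
    exact hD _
  · intro t ht
    have h0 : β ((t - L) / N) = 0 := by
      refine β.zero_of_le_dist ?_
      change 1 / 2 ≤ _
      rw [Real.dist_eq, le_abs]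
      rw [mem_Ioo, not_and_or, not_lt, not_lt] at ht
      rcases ht with ht | ht
      · right
        have := div_nonpos_of_nonpos_of_nonneg (sub_nonpos.2 ht) hN.le
        linarith
      · left
        have : 1 ≤ (t - L) / N := by rw [le_div_iff₀ hN]; linarith
        linarith
    refine ⟨h0, IsLocalMin.deriv_eq_zero (Eventually.of_forall fun x => ?_)⟩
    simp only [h0]
    exact β.nonneg
  · intro t ht
    have h1 : ∀ x ∈ Ioo (L + N / 4) (L + 3 * N / 4), β ((x - L) / N) = 1 := fun x hx => by
      refine β.one_of_mem_closedBall ?_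
      rw [Metric.mem_closedBall, Real.dist_eq]
      change _ ≤ 1 / 4
      rw [abs_le]
      have h1 : 1 / 4 ≤ (x - L) / N := by rw [le_div_iff₀ hN]; linarith [hx.1]
      have h2 : (x - L) / N ≤ 3 / 4 := by rw [div_le_iff₀ hN]; linarith [hx.2]
      constructor <;> linarith
    refine ⟨h1 t ht, IsLocalMax.deriv_eq_zero (Eventually.of_forall fun x => ?_)⟩
    simp only [h1 t ht]
    exact β.le_one

theorem integrable_prod_of_eq_zero {H : ℝ × ℝ → ℝ} (hH : ContinuousOn H (Ici 0 ×ˢ Ici 1))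
    {T R : ℝ} (hT : ∀ q : ℝ × ℝ, T ≤ q.1 → H q = 0) (hR : ∀ q : ℝ × ℝ, R ≤ q.2 → H q = 0) :
    Integrable H ((volume.restrict (Ioi 0)).prod (volume.restrict (Ioi 1))) := by
  rw [Measure.prod_restrict]
  have hK : IntegrableOn H (Icc 0 T ×ˢ Icc 1 R) (volume.prod volume) :=
    (hH.mono (prod_mono Icc_subset_Ici_self Icc_subset_Ici_self)).integrableOn_compact
      (isCompact_Icc.prod isCompact_Icc)
  refine hK.of_forall_sdiff_eq_zero (measurableSet_Ioi.prod measurableSet_Ioi) ?_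
  rintro q ⟨⟨h1, h2⟩, h3⟩
  by_contra h
  refine h3 ⟨⟨le_of_lt h1, ?_⟩, le_of_lt h2, ?_⟩
  · by_contra h'
    exact h (hT q (le_of_not_ge h'))
  · by_contra h'
    exact h (hR q (le_of_not_ge h'))

theorem integrableOn_Ioi_of_eq_zero {p : ℝ → ℝ} (hp : ContinuousOn p (Ici 1)) {R : ℝ}
    (hR : ∀ r, R ≤ r → p r = 0) : IntegrableOn p (Ioi 1) := by
  have hK : IntegrableOn p (Icc 1 R) :=
    (hp.mono Icc_subset_Ici_self).integrableOn_compact isCompact_Icc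
  refine hK.of_forall_sdiff_eq_zero measurableSet_Ioi ?_
  rintro r ⟨h1, h3⟩
  by_contra h
  refine h3 ⟨le_of_lt h1, ?_⟩
  by_contra h'
  exact h (hR r (le_of_not_ge h'))

theorem mul_sub_le_setIntegral_Ioi {I : ℝ → ℝ} (hI : IntegrableOn I (Ioi 0)) (hI0 : ∀ t, 0 ≤ I t)
    {a b c : ℝ} (ha : 0 ≤ a) (hab : a ≤ b) (hc : ∀ t ∈ Ioo a b, c ≤ I t) :
    (b - a) * c ≤ ∫ t in Ioi 0, I t := by
  have hsub : Ioo a b ⊆ Ioi 0 := fun t ht => ha.trans_lt ht.1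
  calc (b - a) * c = ∫ _ in Ioo a b, c := by simp [hab]
    _ ≤ ∫ t in Ioo a b, I t :=
      setIntegral_mono_on (integrableOn_const (by simp)) (hI.mono_set hsub) measurableSet_Ioo hc
    _ ≤ ∫ t in Ioi 0, I t :=
      setIntegral_mono_set hI (ae_of_all _ hI0) hsub.eventuallyLE

theorem setIntegral_Ioi_le_mul_sub {I : ℝ → ℝ} (hI0 : ∀ t, 0 ≤ I t)
    {a b c : ℝ} (ha : 0 ≤ a) (hab : a ≤ b) (hz : ∀ t ∉ Ioo a b, I t = 0)
    (hc : ∀ t ∈ Ioo a b, I t ≤ c) :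
    ∫ t in Ioi 0, I t ≤ (b - a) * c := by
  have hsub : Ioo a b ⊆ Ioi 0 := fun t ht => ha.trans_lt ht.1
  calc ∫ t in Ioi 0, I t = ∫ t in Ioo a b, I t :=
      (setIntegral_eq_of_subset_of_forall_sdiff_eq_zero measurableSet_Ioi hsub
        fun t ht => hz t ht.2)
    _ ≤ ∫ _ in Ioo a b, c := by
      refine integral_mono_of_nonneg (ae_of_all _ hI0) (integrableOn_const (by simp)) ?_
      exact (ae_restrict_mem measurableSet_Ioo).mono hc
    _ = (b - a) * c := by simp [hab]

theorem sq_exp_mul_norm (φ : ℝ → ℝ) (a t r : ℝ) (z : ℂ) :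
    (Real.exp (t * φ r) * a * ‖(Real.exp (-(φ 1 * t)) : ℂ) * z‖) ^ 2
      = Real.exp (-(t * (2 * (φ 1 - φ r)))) * (a * ‖z‖) ^ 2 := by
  have h : Real.exp (-(t * (2 * (φ 1 - φ r))))
      = (Real.exp (t * φ r) * Real.exp (-(φ 1 * t))) ^ 2 := by
    rw [← Real.exp_add, ← Real.exp_nat_mul]
    congr 1
    push_cast
    ring
  rw [h, norm_mul, Complex.norm_real, Real.norm_eq_abs, Real.abs_exp]
  ring

theorem norm_add_sq_le_two_mul (x y : ℂ) : ‖x + y‖ ^ 2 ≤ 2 * ‖x‖ ^ 2 + 2 * ‖y‖ ^ 2 := by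
  have h1 : ‖x + y‖ ^ 2 ≤ (‖x‖ + ‖y‖) ^ 2 := by
    gcongr
    exact norm_add_le x y
  nlinarith [sq_nonneg (‖x‖ - ‖y‖)]

theorem integrable_weighted_sq {φ a : ℝ → ℝ} (hφ : ContinuousOn φ (Ici 1))
    (ha : ContinuousOn a (Ici 1)) {F : ℝ → ℝ → ℂ}
    (hF : Continuous fun q : ℝ × ℝ => F q.1 q.2) {T R : ℝ} (hT : ∀ t r, T ≤ t → F t r = 0)
    (hR : ∀ t r, R ≤ r → F t r = 0) :
    Integrable (fun q : ℝ × ℝ => (Real.exp (q.1 * φ q.2) * a q.2 * ‖F q.1 q.2‖) ^ 2)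
      ((volume.restrict (Ioi 0)).prod (volume.restrict (Ioi 1))) := by
  refine integrable_prod_of_eq_zero (T := T) (R := R) ?_ (fun q hq => by simp [hT _ _ hq])
    (fun q hq => by simp [hR _ _ hq])
  have hφ' : ContinuousOn (fun q : ℝ × ℝ => φ q.2) (Ici 0 ×ˢ Ici 1) :=
    hφ.comp continuousOn_snd fun q hq => hq.2
  have ha' : ContinuousOn (fun q : ℝ × ℝ => a q.2) (Ici 0 ×ˢ Ici 1) :=
    ha.comp continuousOn_snd fun q hq => hq.2
  exact (((continuousOn_fst.mul hφ').rexp.mul ha').mul hF.norm.continuousOn).pow 2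

theorem deriv_add_taylorCouetteOp_separated (ν B : ℝ) (k : ℤ) (l : ℝ) {θ : ℝ → ℝ}
    (hθ : Differentiable ℝ θ) (g : ℝ → ℂ) (t r : ℝ) :
    deriv (fun s => (Real.exp (-(l * s)) : ℂ) * ((θ s : ℂ) * g r)) t
        + TaylorCouetteOp ν B k (fun x => (Real.exp (-(l * t)) : ℂ) * ((θ t : ℂ) * g x)) r
      = (Real.exp (-(l * t)) : ℂ) * (((deriv θ t : ℝ) : ℂ) * g r
          + θ t * (TaylorCouetteOp ν B k g r - l * g r)) := by
  have h1 : HasDerivAt (fun s : ℝ => (Real.exp (-(l * s)) : ℂ))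
      ((Real.exp (-(l * t)) * (-(l * 1)) : ℝ) : ℂ) t :=
    ((((hasDerivAt_id t).const_mul l).neg).exp).ofReal_comp
  have h2 : HasDerivAt (fun s : ℝ => (θ s : ℂ)) ((deriv θ t : ℝ) : ℂ) t :=
    (hθ t).hasDerivAt.ofReal_comp
  have h3 := (h1.mul (h2.mul_const (g r))).deriv
  rw [taylorCouetteOp_const_mul, taylorCouetteOp_const_mul]
  refine (congrArg (· + _) h3).trans ?_
  push_cast
  ring

/-- Theorem 1.2: failure of space-time exponential weighted estimates
for the inhomogeneous linearized Taylor–Couette equation in the exterior region.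
For any positive continuous weights `a₁, a₂` and strictly decreasing `φ` there is a
sequence of solutions `(wₙ, fₙ)` of `∂_t wₙ + 𝒯_k wₙ = fₙ` with zero initial data whose
weighted-norm ratios are unbounded (i.e. the limsup of the ratios is `+∞`). -/
theorem stmt_1 (k : ℤ) (hk : k ≠ 0) (ν B : ℝ) (hν : 0 < ν) (hB : B ≠ 0)
    (a₁ a₂ φ : ℝ → ℝ)
    (ha₁c : ContinuousOn a₁ (Ici 1)) (ha₁ : ∀ r ∈ Ici (1 : ℝ), 0 < a₁ r)
    (ha₂c : ContinuousOn a₂ (Ici 1)) (ha₂ : ∀ r ∈ Ici (1 : ℝ), 0 < a₂ r)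
    (hφc : ContinuousOn φ (Ici 1)) (hφ : StrictAntiOn φ (Ici 1)) :
    ∃ w f : ℕ → ℝ → ℝ → ℂ,
      (∀ n : ℕ,
        -- smoothness of `wₙ` and `fₙ`
        ContDiff ℝ (⊤ : ℕ∞) (fun q : ℝ × ℝ => w n q.1 q.2) ∧
        ContDiff ℝ (⊤ : ℕ∞) (fun q : ℝ × ℝ => f n q.1 q.2) ∧
        -- the equation `∂_t wₙ + 𝒯_k wₙ = fₙ` on `(0,∞) × (1,∞)`
        (∀ t ∈ Ioi (0 : ℝ), ∀ r ∈ Ioi (1 : ℝ),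
            deriv (fun s => w n s r) t + TaylorCouetteOp ν B k (w n t) r = f n t r) ∧
        -- zero initial data and boundary condition
        (∀ r ∈ Ici (1 : ℝ), w n 0 r = 0) ∧
        (∀ t ∈ Ici (0 : ℝ), w n t 1 = 0) ∧
        -- compact support in the radial variable
        (∃ R : ℝ, ∀ t ∈ Ici (0 : ℝ), ∀ r : ℝ, R ≤ r → w n t r = 0) ∧
        -- finiteness of the weighted norms
        Integrable (fun q : ℝ × ℝ =>
            (Real.exp (q.1 * φ q.2) * a₁ q.2 * ‖w n q.1 q.2‖) ^ 2)
          ((volume.restrict (Ioi 0)).prod (volume.restrict (Ioi 1))) ∧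
        Integrable (fun q : ℝ × ℝ =>
            (Real.exp (q.1 * φ q.2) * a₂ q.2 * ‖f n q.1 q.2‖) ^ 2)
          ((volume.restrict (Ioi 0)).prod (volume.restrict (Ioi 1))) ∧
        0 < Real.sqrt (∫ t in Ioi (0 : ℝ), ∫ r in Ioi (1 : ℝ),
            (Real.exp (t * φ r) * a₂ r * ‖f n t r‖) ^ 2)) ∧
      -- limsup of the ratio of weighted norms is `+∞`
      (∀ M : ℝ, ∃ᶠ n in Filter.atTop,
        M < Real.sqrt (∫ t in Ioi (0 : ℝ), ∫ r in Ioi (1 : ℝ),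
              (Real.exp (t * φ r) * a₁ r * ‖w n t r‖) ^ 2)
            / Real.sqrt (∫ t in Ioi (0 : ℝ), ∫ r in Ioi (1 : ℝ),
              (Real.exp (t * φ r) * a₂ r * ‖f n t r‖) ^ 2)) := by
  obtain ⟨g, hg, hOg, hg1, hg2, C, d, hd, hnear⟩ := exists_boundary_quasimode hk hν.ne' hB (φ 1)
  obtain ⟨D, hD⟩ := exists_time_cutoff
  obtain ⟨G, hGdef⟩ : ∃ G : ℝ → ℂ, ∀ r, G r = TaylorCouetteOp ν B k g r - φ 1 * g r :=
    ⟨_, fun _ => rfl⟩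
  have hG : ContDiff ℝ (⊤ : ℕ∞) G := by
    rw [funext hGdef]
    exact hOg.sub (contDiff_const.mul hg)
  have hg0 : ∀ r, 2 ≤ r → g r = 0 := fun r hr => (hg2 r hr).1
  have hG0 : ∀ r, 2 ≤ r → G r = 0 := fun r hr => by simp [hGdef, hg2 r hr]
  simp only [← hGdef] at hnear
  obtain ⟨A, hA⟩ : ∃ A, ∀ r ∈ Icc (1 : ℝ) 2, ‖a₂ r / a₁ r‖ ≤ A :=
    isCompact_Icc.exists_bound_of_continuousOn
      ((ha₂c.div ha₁c fun r hr => (ha₁ r hr).ne').mono Icc_subset_Ici_self)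
  have hA0 : 0 ≤ A := (norm_nonneg _).trans (hA 1 (by norm_num))
  have haA : ∀ r ∈ Icc (1 : ℝ) 2, a₂ r ≤ A * a₁ r := fun r hr => by
    rw [← div_le_iff₀ (ha₁ r hr.1)]
    exact (le_abs_self _).trans (hA r hr)
  let ψ : ℝ → ℝ := fun r => 2 * (φ 1 - φ r)
  let p : ℝ → ℝ := fun r => (a₁ r * ‖g r‖) ^ 2
  let q : ℝ → ℝ := fun r => (a₂ r * ‖G r‖) ^ 2
  have hψc : ContinuousOn ψ (Ici 1) := continuousOn_const.mul (continuousOn_const.sub hφc)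
  have hψm : StrictMonoOn ψ (Ici 1) := fun x hx y hy hxy => by
    have := hφ hx hy hxy
    simp only [ψ]
    linarith
  have hψ1 : ψ 1 = 0 := by simp [ψ]
  have hψ0 : ∀ r ∈ Ici (1 : ℝ), 0 ≤ ψ r := fun r hr => by
    rw [← hψ1]; exact hψm.monotoneOn self_mem_Ici hr hr
  have hp : IntegrableOn p (Ioi 1) :=
    integrableOn_Ioi_of_eq_zero ((ha₁c.mul hg.continuous.norm.continuousOn).pow 2) (R := 2)
      fun r hr => by simp [p, hg0 r hr]
  have hq : IntegrableOn q (Ioi 1) :=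
    integrableOn_Ioi_of_eq_zero ((ha₂c.mul hG.continuous.norm.continuousOn).pow 2) (R := 2)
      fun r hr => by simp [q, hG0 r hr]
  have hp0 : ∀ r ∈ Ioi (1 : ℝ), 0 ≤ p r := fun r _ => sq_nonneg _
  have hq0 : ∀ r ∈ Ioi (1 : ℝ), 0 ≤ q r := fun r _ => sq_nonneg _
  have hpp : ∀ r ∈ Ioo (1 : ℝ) (1 + d), 0 < p r := fun r hr =>
    pow_pos (mul_pos (ha₁ r hr.1.le) (norm_pos_iff.2 (hnear r hr).1)) 2
  have hqq : ∀ r ∈ Ioo (1 : ℝ) (1 + d), 0 < q r := fun r hr =>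
    pow_pos (mul_pos (ha₂ r hr.1.le) (norm_pos_iff.2 (hnear r hr).2.1)) 2
  have hsp : ∀ r ∈ Ioi (1 : ℝ), (a₂ r * ‖g r‖) ^ 2 ≤ A ^ 2 * p r := fun r hr => by
    rcases le_total 2 r with h | h
    · simp [p, hg0 r h]
    · have h1 := haA r ⟨le_of_lt hr, h⟩
      have h2 := ha₂ r (Ioi_subset_Ici_self hr)
      calc (a₂ r * ‖g r‖) ^ 2 ≤ (A * a₁ r * ‖g r‖) ^ 2 := by gcongr
        _ = A ^ 2 * p r := by simp only [p]; ring
  have hqp : ∀ ε > 0, ∃ δ > 0, ∀ r ∈ Ioo (1 : ℝ) (1 + δ), q r ≤ ε * p r := by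
    intro ε hε
    refine ⟨min d (min 1 (ε / (A ^ 2 * C ^ 2 + 1))), by positivity, fun r hr => ?_⟩
    have hr0 : 0 < r - 1 := sub_pos.2 hr.1
    have hrm : r - 1 < min d (min 1 (ε / (A ^ 2 * C ^ 2 + 1))) := by linarith [hr.2]
    obtain ⟨hrd, hrm'⟩ := lt_min_iff.1 hrm
    obtain ⟨hr1, hrε⟩ := lt_min_iff.1 hrm'
    rw [lt_div_iff₀ (by positivity)] at hrε
    have h1 := haA r ⟨hr.1.le, by linarith⟩
    have h2 := ha₂ r hr.1.le
    have h3 := (hnear r ⟨hr.1, by linarith⟩).2.2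
    have h4 : (r - 1) ^ 2 * (A ^ 2 * C ^ 2) ≤ ε := by
      have : (r - 1) ^ 2 * (A ^ 2 * C ^ 2) ≤ (r - 1) * (A ^ 2 * C ^ 2) := by
        gcongr
        nlinarith
      linarith
    have h5 : 0 ≤ A * a₁ r := h2.le.trans h1
    calc q r ≤ (A * a₁ r * (C * (r - 1) * ‖g r‖)) ^ 2 := by simp only [q]; gcongr
      _ = (r - 1) ^ 2 * (A ^ 2 * C ^ 2) * p r := by simp only [p]; ring
      _ ≤ ε * p r := mul_le_mul_of_nonneg_right h4 (sq_nonneg _)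
  obtain ⟨m, hm⟩ : ∃ m : ℝ → ℝ, ∀ t, m t = ∫ r in Ioi 1, Real.exp (-(t * ψ r)) * p r :=
    ⟨_, fun _ => rfl⟩
  obtain ⟨b, hb⟩ : ∃ b : ℝ → ℝ, ∀ t, b t = ∫ r in Ioi 1, Real.exp (-(t * ψ r)) * q r :=
    ⟨_, fun _ => rfl⟩
  have hexp : ∀ {h : ℝ → ℝ}, (∀ r ∈ Ioo (1 : ℝ) (1 + d), 0 < h r) → IntegrableOn h (Ioi 1) →
      (∀ r ∈ Ioi (1 : ℝ), 0 ≤ h r) → ∀ t, 0 ≤ t →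
      0 < ∫ r in Ioi 1, Real.exp (-(t * ψ r)) * h r := fun hpos hi h0 t ht =>
    setIntegral_Ioi_pos_of_pos_near (integrableOn_exp_neg_mul hψc hψ0 hi ht)
      (fun r hr => mul_nonneg (Real.exp_nonneg _) (h0 r hr)) hd
      fun r hr => mul_pos (Real.exp_pos _) (hpos r hr)
  have hL : ∀ n : ℕ, ∃ L, 0 ≤ L ∧ m L / 2 ≤ m (L + (n + 1)) ∧
      ∀ t, L ≤ t → b t ≤ (1 / ((n : ℝ) + 1)) ^ 2 * m t := by
    intro n
    have h1 := eventually_laplace_integral_le hψc hψm hψ1 hp hq hp0 hq0 hd hpp hqp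
      (ε := (1 / ((n : ℝ) + 1)) ^ 2) (by positivity)
    have h2 := eventually_half_laplace_integral_le hψc hψm hψ1 hp hp0 hd hpp
      (N := (n : ℝ) + 1) (by positivity)
    simp only [← hm, ← hb] at h1 h2
    obtain ⟨L, h3, h4, h5⟩ :=
      ((eventually_ge_atTop 0).and (h2.and (eventually_forall_ge_atTop.2 h1))).exists
    exact ⟨L, h3, h4, h5⟩
  choose L hL0 hLm hLb using hL
  choose θ hθ hθ1 hθD hθ0 hθp using fun n : ℕ => hD ((n : ℝ) + 1) (by positivity) (L n)
  let w : ℕ → ℝ → ℝ → ℂ := fun n t r => (Real.exp (-(φ 1 * t)) : ℂ) * ((θ n t : ℂ) * g r)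
  let f : ℕ → ℝ → ℝ → ℂ := fun n t r =>
    (Real.exp (-(φ 1 * t)) : ℂ) * (((deriv (θ n) t : ℝ) : ℂ) * g r + θ n t * G r)
  have hofReal : ∀ {u : ℝ → ℝ}, ContDiff ℝ (⊤ : ℕ∞) u →
      ContDiff ℝ (⊤ : ℕ∞) fun q : ℝ × ℝ => (u q.1 : ℂ) := fun hu =>
    Complex.ofRealCLM.contDiff.comp (hu.comp contDiff_fst)
  have hexpc : ContDiff ℝ (⊤ : ℕ∞) fun q : ℝ × ℝ => (Real.exp (-(φ 1 * q.1)) : ℂ) :=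
    hofReal (u := fun t => Real.exp (-(φ 1 * t))) (contDiff_const.mul contDiff_id).neg.exp
  have hwc : ∀ n, ContDiff ℝ (⊤ : ℕ∞) fun q : ℝ × ℝ => w n q.1 q.2 := fun n =>
    hexpc.mul ((hofReal (hθ n)).mul (hg.comp contDiff_snd))
  have hfc : ∀ n, ContDiff ℝ (⊤ : ℕ∞) fun q : ℝ × ℝ => f n q.1 q.2 := fun n =>
    hexpc.mul (((hofReal (contDiff_infty_iff_deriv.1 (hθ n)).2).mul (hg.comp contDiff_snd)).add
      ((hofReal (hθ n)).mul (hG.comp contDiff_snd)))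
  have hout : ∀ n t, t ∉ Ioo (L n) (L n + (n + 1)) → ∀ r, w n t r = 0 ∧ f n t r = 0 := by
    intro n t ht r
    simp [w, f, hθ0 n t ht]
  have hlate : ∀ n t, L n + (n + 1) ≤ t → t ∉ Ioo (L n) (L n + (n + 1)) :=
    fun n t h1 h2 => h1.not_gt h2.2
  have hfar : ∀ n t r, 2 ≤ r → w n t r = 0 ∧ f n t r = 0 := by
    intro n t r hr
    simp [w, f, hg0 r hr, hG0 r hr]
  have hWi := fun n => integrable_weighted_sq hφc ha₁c (hwc n).continuous
    (fun t r h => (hout n t (hlate n t h) r).1) (fun t r h => (hfar n t r h).1)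
  have hFi := fun n => integrable_weighted_sq hφc ha₂c (hfc n).continuous
    (fun t r h => (hout n t (hlate n t h) r).2) (fun t r h => (hfar n t r h).2)
  obtain ⟨W, hW⟩ : ∃ W : ℕ → ℝ → ℝ, ∀ n t,
      W n t = ∫ r in Ioi (1 : ℝ), (Real.exp (t * φ r) * a₁ r * ‖w n t r‖) ^ 2 :=
    ⟨_, fun _ _ => rfl⟩
  obtain ⟨F, hF⟩ : ∃ F : ℕ → ℝ → ℝ, ∀ n t,
      F n t = ∫ r in Ioi (1 : ℝ), (Real.exp (t * φ r) * a₂ r * ‖f n t r‖) ^ 2 :=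
    ⟨_, fun _ _ => rfl⟩
  have hWint : ∀ n, IntegrableOn (W n) (Ioi 0) := fun n => by
    rw [funext (hW n)]; exact (hWi n).integral_prod_left
  have hFint : ∀ n, IntegrableOn (F n) (Ioi 0) := fun n => by
    rw [funext (hF n)]; exact (hFi n).integral_prod_left
  have hW0 : ∀ n t, 0 ≤ W n t := fun n t => by
    rw [hW]; exact integral_nonneg fun r => sq_nonneg _
  have hF0 : ∀ n t, 0 ≤ F n t := fun n t => by
    rw [hF]; exact integral_nonneg fun r => sq_nonneg _
  have hN : ∀ n : ℕ, (0 : ℝ) < n + 1 := fun n => by positivity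
  have hWlow : ∀ n, ∀ t ∈ Ioo (L n + (n + 1) / 4) (L n + 3 * (n + 1) / 4), m (L n) / 2 ≤ W n t := by
    intro n t ht
    have ht0 : 0 ≤ t := by linarith [ht.1, hL0 n, hN n]
    have e : W n t = m t := by
      simp only [hW, hm, w, sq_exp_mul_norm, hθp n t ht, ψ, p]
      simp
    rw [e]
    refine (hLm n).trans ?_
    rw [hm, hm]
    exact laplace_integral_anti hψc hψ0 hp hp0 ht0 (by linarith [ht.2, hN n])
  have hFlow : ∀ n, ∀ t ∈ Ioo (L n + (n + 1) / 4) (L n + 3 * (n + 1) / 4),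
      b (L n + (n + 1)) ≤ F n t := by
    intro n t ht
    have ht0 : 0 ≤ t := by linarith [ht.1, hL0 n, hN n]
    have e : F n t = b t := by
      simp only [hF, hb, f, sq_exp_mul_norm, hθp n t ht, ψ, q]
      simp
    rw [e, hb, hb]
    exact laplace_integral_anti hψc hψ0 hq hq0 ht0 (by linarith [ht.2, hN n])
  have hFup : ∀ n, ∀ t ∈ Ioo (L n) (L n + (n + 1)),
      F n t ≤ (2 * D ^ 2 * A ^ 2 + 2) / ((n : ℝ) + 1) ^ 2 * m (L n) := by
    intro n t ht
    have ht0 : 0 ≤ t := (hL0 n).trans ht.1.le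
    have ip := integrableOn_exp_neg_mul hψc hψ0 hp ht0
    have iq := integrableOn_exp_neg_mul hψc hψ0 hq ht0
    have h1 : F n t ≤ ∫ r in Ioi 1,
        (2 * (D / ((n : ℝ) + 1)) ^ 2 * A ^ 2 * (Real.exp (-(t * ψ r)) * p r)
          + 2 * (Real.exp (-(t * ψ r)) * q r)) := by
      rw [hF]
      refine integral_mono_of_nonneg (ae_of_all _ fun r => sq_nonneg _)
        ((ip.const_mul _).add (iq.const_mul _)) ?_
      filter_upwards [ae_restrict_mem measurableSet_Ioi] with r hr
      simp only [f, sq_exp_mul_norm]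
      have h2 := norm_add_sq_le_two_mul (((deriv (θ n) t : ℝ) : ℂ) * g r) (θ n t * G r)
      have h3 : (deriv (θ n) t) ^ 2 ≤ (D / ((n : ℝ) + 1)) ^ 2 := by
        rw [← sq_abs (deriv (θ n) t)]
        gcongr
        exact hθD n t
      have h4 : (θ n t) ^ 2 ≤ 1 := (sq_le_one_iff_abs_le_one _).2 (hθ1 n t)
      simp only [norm_mul, Complex.norm_real, Real.norm_eq_abs, mul_pow, sq_abs] at h2
      have h5 : (a₂ r * ‖((deriv (θ n) t : ℝ) : ℂ) * g r + θ n t * G r‖) ^ 2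
          ≤ 2 * (D / ((n : ℝ) + 1)) ^ 2 * A ^ 2 * p r + 2 * q r := by
        calc _ = (a₂ r) ^ 2 * ‖((deriv (θ n) t : ℝ) : ℂ) * g r + θ n t * G r‖ ^ 2 := by ring
          _ ≤ (a₂ r) ^ 2 * (2 * ((deriv (θ n) t) ^ 2 * ‖g r‖ ^ 2)
              + 2 * ((θ n t) ^ 2 * ‖G r‖ ^ 2)) := by gcongr
          _ = 2 * (deriv (θ n) t) ^ 2 * (a₂ r * ‖g r‖) ^ 2 + 2 * (θ n t) ^ 2 * q r := by
            simp only [q]; ring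
          _ ≤ 2 * (D / ((n : ℝ) + 1)) ^ 2 * (A ^ 2 * p r) + 2 * 1 * q r := by
            have := hsp r hr
            have := hq0 r hr
            gcongr
          _ = _ := by ring
      have := mul_le_mul_of_nonneg_left h5 (Real.exp_nonneg (-(t * ψ r)))
      calc _ ≤ _ := this
        _ = _ := by ring
    rw [integral_add (ip.const_mul _) (iq.const_mul _), integral_const_mul, integral_const_mul,
      ← hm, ← hb] at h1
    have h6 : m t ≤ m (L n) := by
      rw [hm, hm]
      exact laplace_integral_anti hψc hψ0 hp hp0 (hL0 n) ht.1.le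
    have h7 := hLb n t ht.1.le
    calc F n t ≤ _ := h1
      _ ≤ 2 * (D / ((n : ℝ) + 1)) ^ 2 * A ^ 2 * m t + 2 * ((1 / ((n : ℝ) + 1)) ^ 2 * m t) := by
        gcongr
      _ = (2 * D ^ 2 * A ^ 2 + 2) / ((n : ℝ) + 1) ^ 2 * m t := by
        have := (hN n).ne'
        field_simp
      _ ≤ _ := by gcongr
  have hFpos : ∀ n, 0 < ∫ t in Ioi 0, F n t := by
    intro n
    refine lt_of_lt_of_le ?_ (mul_sub_le_setIntegral_Ioi (hFint n) (hF0 n)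
      (by linarith [hL0 n, hN n]) (by linarith [hN n]) (hFlow n))
    have := hN n
    have hbpos : 0 < b (L n + (n + 1)) := by
      rw [hb]; exact hexp hqq hq hq0 _ (add_nonneg (hL0 n) this.le)
    refine mul_pos ?_ hbpos
    linarith
  have hWge : ∀ n : ℕ, ((n : ℝ) + 1) * m (L n) / 4 ≤ ∫ t in Ioi 0, W n t := by
    intro n
    refine le_trans (le_of_eq ?_) (mul_sub_le_setIntegral_Ioi (hWint n) (hW0 n)
      (by linarith [hL0 n, hN n]) (by linarith [hN n]) (hWlow n))
    ring
  have hFle : ∀ n : ℕ, ∫ t in Ioi 0, F n t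
      ≤ (2 * D ^ 2 * A ^ 2 + 2) / ((n : ℝ) + 1) * m (L n) := by
    intro n
    refine (setIntegral_Ioi_le_mul_sub (hF0 n) (hL0 n) (by linarith [hN n])
      (fun t ht => by simp [hF, hout n t ht]) (hFup n)).trans (le_of_eq ?_)
    have := (hN n).ne'
    field_simp
    ring
  refine ⟨w, f, fun n => ⟨hwc n, hfc n, ?_, ?_, ?_, ⟨2, fun t _ r hr => (hfar n t r hr).1⟩,
    hWi n, hFi n, ?_⟩, fun M => ?_⟩
  · intro t _ r _
    simp only [w, f, hGdef]
    exact deriv_add_taylorCouetteOp_separated ν B k (φ 1) ((hθ n).differentiable (by simp)) g t r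
  · exact fun r _ => (hout n 0 (fun h => (hL0 n).not_gt h.1) r).1
  · intro t _
    simp [w, hg1]
  · simp only [← hF]
    exact Real.sqrt_pos.2 (hFpos n)
  · refine Eventually.frequently ?_
    simp only [← hF, ← hW]
    have hlim : Tendsto (fun n : ℕ => (n : ℝ) + 1) atTop atTop :=
      tendsto_natCast_atTop_atTop.atTop_add tendsto_const_nhds
    filter_upwards [hlim.eventually_gt_atTop (4 * M ^ 2 * (2 * D ^ 2 * A ^ 2 + 2))] with n hn
    rw [← Real.sqrt_div' _ (hFpos n).le]
    refine Real.lt_sqrt_of_sq_lt ?_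
    rw [lt_div_iff₀ (hFpos n)]
    have hmpos : 0 < m (L n) := by rw [hm]; exact hexp hpp hp hp0 _ (hL0 n)
    have hn1 : (1 : ℝ) ≤ n + 1 := by linarith [(Nat.cast_nonneg n : (0 : ℝ) ≤ n)]
    have h1 : M ^ 2 * ((2 * D ^ 2 * A ^ 2 + 2) / ((n : ℝ) + 1)) < ((n : ℝ) + 1) / 4 := by
      rw [← mul_div_assoc, div_lt_iff₀ (hN n)]
      nlinarith
    calc M ^ 2 * ∫ t in Ioi 0, F n t
        ≤ M ^ 2 * ((2 * D ^ 2 * A ^ 2 + 2) / ((n : ℝ) + 1) * m (L n)) := by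
          gcongr
          exact hFle n
      _ = M ^ 2 * ((2 * D ^ 2 * A ^ 2 + 2) / ((n : ℝ) + 1)) * m (L n) := by ring
      _ < ((n : ℝ) + 1) / 4 * m (L n) := by gcongr
      _ = ((n : ℝ) + 1) * m (L n) / 4 := by ring
      _ ≤ _ := hWge n
end

section
/- There exist constants ε > 0 and C > 0 such that the following holds. Let k be a nonzero integer, ν > 0, B ∈ ℝ with ν ≤ ε|kB|, λ ∈ ℝ, and let w, F₁, F₂ be smooth complex-valued functions on [1,∞) with compact support and w(1) = 0. Suppose (𝒯_k − i k B λ) w = F₁ + ∂_r F₂ on (1,∞). Set μ_k = max{ν k², ν^{1/3}|kB|^{2/3}}. Then ν^{1/2} ‖w'‖_{L²_r} + μ_k^{1/2} ‖w/r‖_{L²_r} ≤ C ( μ_k^{-1/2} ‖r F₁‖_{L²_r} + ν^{-1/2} ‖F₂‖_{L²_r} ). -/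
open MeasureTheory Set

/-- Cauchy–Schwarz for continuous functions on a compact interval. -/
theorem intervalIntegral_mul_le_sqrt_mul_sqrt {a b : ℝ} (hab : a ≤ b) {f g : ℝ → ℝ}
    (hf : ContinuousOn f (Icc a b)) (hg : ContinuousOn g (Icc a b)) :
    ∫ r in a..b, f r * g r ≤ √(∫ r in a..b, f r ^ 2) * √(∫ r in a..b, g r ^ 2) := by
  have hint : ∀ {φ : ℝ → ℝ}, ContinuousOn φ (Icc a b) → IntervalIntegrable φ volume a b :=
    fun h => h.intervalIntegrable_of_Icc hab
  have hquad : ∀ t : ℝ, 0 ≤ (∫ r in a..b, f r ^ 2) * (t * t) + (2 * ∫ r in a..b, f r * g r) * t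
      + ∫ r in a..b, g r ^ 2 := by
    intro t
    have h0 : 0 ≤ ∫ r in a..b, (f r * t + g r) ^ 2 :=
      intervalIntegral.integral_nonneg hab fun r _ => sq_nonneg _
    have h1 : ∫ r in a..b, (f r * t + g r) ^ 2
        = ∫ r in a..b, (t * t * f r ^ 2 + (2 * t) * (f r * g r) + g r ^ 2) := by
      congr 1; ext r; ring
    rw [h1, intervalIntegral.integral_add, intervalIntegral.integral_add,
      intervalIntegral.integral_const_mul, intervalIntegral.integral_const_mul] at h0
    · linarith
    all_goals exact hint (by fun_prop)
  have hd := discrim_le_zero hquad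
  rw [discrim] at hd
  rw [← Real.sqrt_mul (intervalIntegral.integral_nonneg hab fun r _ => sq_nonneg _)]
  apply Real.le_sqrt_of_sq_le
  linarith

/-- A pointwise quadratic inequality, valid up to the derivative of a function vanishing at both
endpoints, passes to the `L²` norms. -/
theorem quadratic_le_of_pointwise {a b : ℝ} (hab : a ≤ b) {p q u v G G' : ℝ → ℝ}
    (hp : ContinuousOn p (Icc a b)) (hq : ContinuousOn q (Icc a b))
    (hu : ContinuousOn u (Icc a b)) (hv : ContinuousOn v (Icc a b))
    (hG : ContinuousOn G (Icc a b)) (hG' : ContinuousOn G' (Icc a b))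
    (hderiv : ∀ r ∈ Ioo a b, HasDerivAt G (G' r) r) (hGa : G a = 0) (hGb : G b = 0)
    {c₁ c₂ d₁ d₂ d₃ d₄ : ℝ} (hd₁ : 0 ≤ d₁) (hd₂ : 0 ≤ d₂) (hd₃ : 0 ≤ d₃) (hd₄ : 0 ≤ d₄)
    (h : ∀ r ∈ Ioo a b, c₁ * p r ^ 2 + c₂ * q r ^ 2 ≤
      G' r + (d₁ * (p r * q r) + d₂ * (u r * q r) + d₃ * (v r * q r) + d₄ * (v r * p r))) :
    c₁ * √(∫ r in a..b, p r ^ 2) ^ 2 + c₂ * √(∫ r in a..b, q r ^ 2) ^ 2 ≤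
      d₁ * (√(∫ r in a..b, p r ^ 2) * √(∫ r in a..b, q r ^ 2))
      + d₂ * (√(∫ r in a..b, u r ^ 2) * √(∫ r in a..b, q r ^ 2))
      + d₃ * (√(∫ r in a..b, v r ^ 2) * √(∫ r in a..b, q r ^ 2))
      + d₄ * (√(∫ r in a..b, v r ^ 2) * √(∫ r in a..b, p r ^ 2)) := by
  have hint : ∀ {φ : ℝ → ℝ}, ContinuousOn φ (Icc a b) → IntervalIntegrable φ volume a b :=
    fun h => h.intervalIntegrable_of_Icc hab
  have hG0 : ∫ r in a..b, G' r = 0 := by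
    rw [intervalIntegral.integral_eq_sub_of_hasDerivAt_of_le hab hG hderiv (hint hG'), hGa, hGb,
      sub_zero]
  have hmono : ∫ r in a..b, (c₁ * p r ^ 2 + c₂ * q r ^ 2) ≤ ∫ r in a..b,
      (G' r + (d₁ * (p r * q r) + d₂ * (u r * q r) + d₃ * (v r * q r) + d₄ * (v r * p r))) :=
    intervalIntegral.integral_mono_on_of_le_Ioo hab (hint (by fun_prop)) (hint (by fun_prop)) h
  have hl : ∫ r in a..b, (c₁ * p r ^ 2 + c₂ * q r ^ 2)
      = c₁ * (∫ r in a..b, p r ^ 2) + c₂ * ∫ r in a..b, q r ^ 2 := by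
    rw [intervalIntegral.integral_add, intervalIntegral.integral_const_mul,
      intervalIntegral.integral_const_mul]
    all_goals exact hint (by fun_prop)
  have hr : ∫ r in a..b,
      (G' r + (d₁ * (p r * q r) + d₂ * (u r * q r) + d₃ * (v r * q r) + d₄ * (v r * p r)))
      = d₁ * (∫ r in a..b, p r * q r) + d₂ * (∫ r in a..b, u r * q r)
        + d₃ * (∫ r in a..b, v r * q r) + d₄ * ∫ r in a..b, v r * p r := by
    rw [intervalIntegral.integral_add, hG0, zero_add, intervalIntegral.integral_add,
      intervalIntegral.integral_add, intervalIntegral.integral_add]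
    · simp only [intervalIntegral.integral_const_mul]
    all_goals exact hint (by fun_prop)
  have hsq : ∀ φ : ℝ → ℝ, √(∫ r in a..b, φ r ^ 2) ^ 2 = ∫ r in a..b, φ r ^ 2 := fun φ =>
    Real.sq_sqrt (intervalIntegral.integral_nonneg hab fun r _ => sq_nonneg _)
  rw [hsq p, hsq q]
  rw [hl, hr] at hmono
  refine hmono.trans ?_
  gcongr
  exacts [intervalIntegral_mul_le_sqrt_mul_sqrt hab hp hq,
    intervalIntegral_mul_le_sqrt_mul_sqrt hab hu hq,
    intervalIntegral_mul_le_sqrt_mul_sqrt hab hv hq,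
    intervalIntegral_mul_le_sqrt_mul_sqrt hab hv hp]

/-- Closing the two energy inequalities. -/
theorem add_le_of_energy_inequalities {A E P Q : ℝ} (hA : 0 ≤ A) (hE : 0 ≤ E) (hP : 0 ≤ P)
    (hQ : 0 ≤ Q) (h₁ : A ^ 2 ≤ P * E + Q * A)
    (h₂ : E ^ 2 ≤ 2 * (P * E + Q * A) + 16 * (5 * (A * E) + P * E + Q * A + 4 * (Q * E))) :
    A + E ≤ 20000 * (P + Q) := by
  have hPA := mul_nonneg hP hA
  have hPE := mul_nonneg hP hE
  have hQA := mul_nonneg hQ hA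
  have hQE := mul_nonneg hQ hE
  rcases (add_nonneg hA hE).eq_or_lt with h | h
  · rw [← h]; positivity
  · refine le_of_mul_le_mul_right ?_ h
    nlinarith [sq_nonneg (E - 80 * A), sq_nonneg (A - E)]

/-- The multiplier is bounded by `1 / 2`. -/
theorem abs_multiplier_le {δ y : ℝ} (hδ : 0 < δ) : |δ * y / (δ ^ 2 + y ^ 2)| ≤ 1 / 2 := by
  have h : 0 < δ ^ 2 + y ^ 2 := by positivity
  rw [abs_le, le_div_iff₀ h, div_le_iff₀ h]
  constructor <;> nlinarith [sq_nonneg (δ - y), sq_nonneg (δ + y)]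

/-- The derivative of the multiplier is of size `δ⁻¹`. -/
theorem abs_multiplier_deriv_le {δ y : ℝ} (hδ : 0 < δ) (hδ' : δ ≤ 1 / 2) :
    |-2 * (1 - y) * δ * (δ ^ 2 - y ^ 2) / (δ ^ 2 + y ^ 2) ^ 2| ≤ 4 / δ := by
  obtain ⟨x, rfl⟩ : ∃ x, y = δ * x := ⟨y / δ, by field_simp⟩
  have h : 0 < 1 + x ^ 2 := by positivity
  have he : -2 * (1 - δ * x) * δ * (δ ^ 2 - (δ * x) ^ 2) / (δ ^ 2 + (δ * x) ^ 2) ^ 2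
      = (-2 * (1 - δ * x) * (1 - x ^ 2) / (1 + x ^ 2) ^ 2) / δ := by
    have : δ ^ 2 + (δ * x) ^ 2 = δ ^ 2 * (1 + x ^ 2) := by ring
    rw [this]; field_simp
  rw [he, abs_div, abs_of_pos hδ]
  gcongr
  rw [abs_div, abs_of_pos (pow_pos h 2), div_le_iff₀ (by positivity), abs_mul, abs_mul]
  have h1 : |1 - δ * x| ≤ 2 * (1 + x ^ 2) := by
    rw [abs_le]
    constructor <;> nlinarith [sq_nonneg (x - δ), sq_nonneg (x + δ)]
  have h2 : |1 - x ^ 2| ≤ 1 + x ^ 2 := by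
    rw [abs_le]
    constructor <;> nlinarith [sq_nonneg x]
  have := mul_le_mul h1 h2 (abs_nonneg _) (by positivity)
  norm_num
  nlinarith

/-- Coercivity of the multiplier, combined with the gain from its derivative near the critical
layer `y = 0`. -/
theorem multiplier_coercive {δ y : ℝ} (hδ : 0 < δ) (hδ' : δ ≤ 1 / 2) :
    δ / 8 ≤ y * (δ * y / (δ ^ 2 + y ^ 2))
      - 1 / 4 * δ ^ 2 * (-2 * (1 - y) * δ * (δ ^ 2 - y ^ 2) / (δ ^ 2 + y ^ 2) ^ 2) := by
  obtain ⟨x, rfl⟩ : ∃ x, y = δ * x := ⟨y / δ, by field_simp⟩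
  have h : 0 < 1 + x ^ 2 := by positivity
  have he : δ * x * (δ * (δ * x) / (δ ^ 2 + (δ * x) ^ 2)) - 1 / 4 * δ ^ 2 *
      (-2 * (1 - δ * x) * δ * (δ ^ 2 - (δ * x) ^ 2) / (δ ^ 2 + (δ * x) ^ 2) ^ 2)
      = δ * ((x ^ 2 * (1 + x ^ 2) + 1 / 2 * (1 - δ * x) * (1 - x ^ 2)) / (1 + x ^ 2) ^ 2) := by
    have : δ ^ 2 + (δ * x) ^ 2 = δ ^ 2 * (1 + x ^ 2) := by ring
    rw [this]; field_simp; ring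
  rw [he, div_eq_mul_one_div]
  refine mul_le_mul_of_nonneg_left ?_ hδ.le
  rw [le_div_iff₀ (by positivity)]
  have h3 : |δ * (x - x ^ 3)| ≤ 1 / 2 * (1 + x ^ 2) ^ 2 / 2 := by
    rw [abs_mul, abs_of_pos hδ]
    have : |x - x ^ 3| ≤ (1 + x ^ 2) ^ 2 / 2 := by
      rw [abs_le]
      constructor <;> nlinarith [sq_nonneg (x ^ 2 - 1), sq_nonneg (x ^ 2 + x), sq_nonneg (x ^ 2 - x),
        sq_nonneg (x - 1), sq_nonneg (x + 1), sq_nonneg x]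
    nlinarith [abs_nonneg (x - x ^ 3)]
  nlinarith [(abs_le.mp h3).2, sq_nonneg (x ^ 2), sq_nonneg x]

theorem hasDerivAt_multiplier {δ lam : ℝ} (hδ : 0 < δ) (r : ℝ) :
    HasDerivAt (fun r => δ * (1 - lam * r ^ 2) / (δ ^ 2 + (1 - lam * r ^ 2) ^ 2))
      (δ * (-2 * lam * r) * (δ ^ 2 - (1 - lam * r ^ 2) ^ 2)
        / (δ ^ 2 + (1 - lam * r ^ 2) ^ 2) ^ 2) r := by
  have hy : HasDerivAt (fun r : ℝ => 1 - lam * r ^ 2) (-2 * lam * r) r :=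
    (((hasDerivAt_pow 2 r).const_mul lam).const_sub 1).congr_deriv (by norm_num; ring)
  have hpos : δ ^ 2 + (1 - lam * r ^ 2) ^ 2 ≠ 0 := by positivity
  refine ((hy.const_mul δ).fun_div ((hy.fun_pow 2).const_add (δ ^ 2)) hpos).congr_deriv ?_
  norm_num
  ring

/-- The flux `(ν w' + F₂) w̄`. -/
noncomputable def energyFlux (ν : ℝ) (w F₂ : ℝ → ℂ) (r : ℝ) : ℂ :=
  ((ν : ℂ) * deriv w r + F₂ r) * starRingEnd ℂ (w r)

/-- The derivative of `energyFlux`. -/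
noncomputable def energyFluxDeriv (ν : ℝ) (w F₂ : ℝ → ℂ) (r : ℝ) : ℂ :=
  ((ν : ℂ) * deriv (deriv w) r + deriv F₂ r) * starRingEnd ℂ (w r)
    + ((ν : ℂ) * deriv w r + F₂ r) * starRingEnd ℂ (deriv w r)

theorem contDiff_deriv_of_smooth {w : ℝ → ℂ} (hw : ContDiff ℝ (⊤ : ℕ∞) w) :
    ContDiff ℝ (⊤ : ℕ∞) (deriv w) :=
  ((contDiff_succ_iff_deriv (n := ((⊤ : ℕ∞) : WithTop ℕ∞))).1 (by simpa using hw)).2.2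

theorem hasDerivAt_of_smooth {w : ℝ → ℂ} (hw : ContDiff ℝ (⊤ : ℕ∞) w) (r : ℝ) :
    HasDerivAt w (deriv w r) r :=
  (hw.differentiable (by simp) r).hasDerivAt

theorem hasDerivAt_conj {w : ℝ → ℂ} {w' : ℂ} {r : ℝ} (h : HasDerivAt w w' r) :
    HasDerivAt (fun r => starRingEnd ℂ (w r)) (starRingEnd ℂ w') r :=
  h.star

theorem hasDerivAt_re {w : ℝ → ℂ} {w' : ℂ} {r : ℝ} (h : HasDerivAt w w' r) :
    HasDerivAt (fun r => (w r).re) w'.re r :=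
  Complex.reCLM.hasFDerivAt.comp_hasDerivAt r h

theorem hasDerivAt_im {w : ℝ → ℂ} {w' : ℂ} {r : ℝ} (h : HasDerivAt w w' r) :
    HasDerivAt (fun r => (w r).im) w'.im r :=
  Complex.imCLM.hasFDerivAt.comp_hasDerivAt r h

section Energy

variable {ν B lam : ℝ} {k : ℤ} {w F₁ F₂ : ℝ → ℂ}

theorem hasDerivAt_energyFlux (hw : ContDiff ℝ (⊤ : ℕ∞) w) (hF₂ : ContDiff ℝ (⊤ : ℕ∞) F₂)
    (r : ℝ) : HasDerivAt (energyFlux ν w F₂) (energyFluxDeriv ν w F₂ r) r :=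
  (((hasDerivAt_of_smooth (contDiff_deriv_of_smooth hw) r).const_mul (ν : ℂ)).add
    (hasDerivAt_of_smooth hF₂ r)).mul (hasDerivAt_conj (hasDerivAt_of_smooth hw r))

theorem continuous_energyFlux (hw : ContDiff ℝ (⊤ : ℕ∞) w) (hF₂ : ContDiff ℝ (⊤ : ℕ∞) F₂) :
    Continuous (energyFlux ν w F₂) :=
  continuous_iff_continuousAt.2 fun r => (hasDerivAt_energyFlux hw hF₂ r).continuousAt

theorem continuous_energyFluxDeriv (hw : ContDiff ℝ (⊤ : ℕ∞) w)
    (hF₂ : ContDiff ℝ (⊤ : ℕ∞) F₂) : Continuous (energyFluxDeriv ν w F₂) := by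
  have h0 := hw.continuous
  have h1 := (contDiff_deriv_of_smooth hw).continuous
  have h2 := (contDiff_deriv_of_smooth (contDiff_deriv_of_smooth hw)).continuous
  have h3 := hF₂.continuous
  have h4 := (contDiff_deriv_of_smooth hF₂).continuous
  have h5 : Continuous (starRingEnd ℂ) := Complex.continuous_conj
  unfold energyFluxDeriv
  fun_prop

theorem energyFluxDeriv_re {r : ℝ}
    (h : TaylorCouetteOp ν B k w r - Complex.I * (k : ℂ) * (B : ℂ) * (lam : ℂ) * w r
      = F₁ r + deriv F₂ r) :
    ν * ‖deriv w r‖ ^ 2 + ν * ((k : ℝ) ^ 2 - 1 / 4) * (‖w r‖ / r) ^ 2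
      = (energyFluxDeriv ν w F₂ r).re + (F₁ r * starRingEnd ℂ (w r)).re
        - (F₂ r * starRingEnd ℂ (deriv w r)).re := by
  have e : (ν : ℂ) * deriv (deriv w) r + deriv F₂ r
      = ((ν * ((k : ℝ) ^ 2 - 1 / 4) / r ^ 2 : ℝ) : ℂ) * w r
        + (((k : ℝ) * B * (1 / r ^ 2 - lam) : ℝ) : ℂ) * (Complex.I * w r) - F₁ r := by
    rw [TaylorCouetteOp] at h
    push_cast
    linear_combination -h
  rw [energyFluxDeriv, e, div_pow, ← Complex.normSq_eq_norm_sq, ← Complex.normSq_eq_norm_sq,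
    Complex.normSq_apply, Complex.normSq_apply]
  simp only [Complex.add_re, Complex.sub_re, Complex.mul_re, Complex.add_im, Complex.sub_im,
    Complex.mul_im, Complex.conj_re, Complex.conj_im, Complex.ofReal_re, Complex.ofReal_im,
    Complex.I_re, Complex.I_im]
  ring

theorem energyFluxDeriv_im {r : ℝ}
    (h : TaylorCouetteOp ν B k w r - Complex.I * (k : ℂ) * (B : ℂ) * (lam : ℂ) * w r
      = F₁ r + deriv F₂ r) :
    (energyFluxDeriv ν w F₂ r).im = (k : ℝ) * B * (1 / r ^ 2 - lam) * ‖w r‖ ^ 2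
      - (F₁ r * starRingEnd ℂ (w r)).im + (F₂ r * starRingEnd ℂ (deriv w r)).im := by
  have e : (ν : ℂ) * deriv (deriv w) r + deriv F₂ r
      = ((ν * ((k : ℝ) ^ 2 - 1 / 4) / r ^ 2 : ℝ) : ℂ) * w r
        + (((k : ℝ) * B * (1 / r ^ 2 - lam) : ℝ) : ℂ) * (Complex.I * w r) - F₁ r := by
    rw [TaylorCouetteOp] at h
    push_cast
    linear_combination -h
  rw [energyFluxDeriv, e, ← Complex.normSq_eq_norm_sq, Complex.normSq_apply]
  simp only [Complex.add_re, Complex.sub_re, Complex.mul_re, Complex.add_im, Complex.sub_im,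
    Complex.mul_im, Complex.conj_re, Complex.conj_im, Complex.ofReal_re, Complex.ofReal_im,
    Complex.I_re, Complex.I_im]
  ring

/-- The pointwise bound behind `critical_layer_estimate`. -/
theorem critical_layer_pointwise {r δ β ν b lam σ X X' p q f v a₁ a₂ a₃ a₄ a₅ : ℝ} (hr0 : 0 < r)
    (hδ : 0 < δ) (hδ' : δ ≤ 1 / 2) (hβ : 0 ≤ β) (hν : 0 ≤ ν) (hνδ : β * δ ^ 3 = ν)
    (hσ : σ * b = β) (hσ1 : |σ| = 1) (b0 : |X| ≤ 1 / 2) (b1 : |r * X'| ≤ 4 / δ)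
    (b2 : δ / 8 ≤ (1 - lam * r ^ 2) * X - 1 / 4 * δ ^ 2 * (r * X'))
    (hp0 : 0 ≤ p) (hq0 : 0 ≤ q) (hf0 : 0 ≤ f) (hv0 : 0 ≤ v)
    (n1 : |a₁| ≤ p * (r * q)) (n2 : |a₂| ≤ v * (r * q)) (n3 : |a₃| ≤ f * (r * q))
    (n4 : |a₄| ≤ v * p) (n5 : |a₅| ≤ p * (r * q)) :
    β * δ / 16 * q ^ 2 ≤
      σ * (X' * (ν * a₁ + a₂) + X * (b * (1 / r ^ 2 - lam) * (r * q) ^ 2 - a₃ + a₄))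
        - β * δ ^ 2 / 4 *
          (((X' * (r ^ 2 * q ^ 2) + X * (2 * a₅)) * r - X * (r ^ 2 * q ^ 2) * 1) / r ^ 2)
        + (5 * ν / δ * (p * q) + r * f * q + 4 / δ * (v * q) + v * p) := by
  have hu0 : 0 ≤ r * f := by positivity
  have hX' : |X'| ≤ 4 / δ / r := by
    rw [abs_mul, abs_of_pos hr0] at b1
    rwa [le_div_iff₀ hr0, mul_comm]
  have hσm : ∀ x, -|x| ≤ σ * x := fun x => by
    have := neg_abs_le (σ * x)
    rwa [abs_mul, hσ1, one_mul] at this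
  have t1 : |X' * a₁| ≤ 4 / δ * (p * q) := by
    rw [abs_mul]
    calc |X'| * |a₁| ≤ 4 / δ / r * (p * (r * q)) := by gcongr
      _ = _ := by field_simp
  have t2 : |X' * a₂| ≤ 4 / δ * (v * q) := by
    rw [abs_mul]
    calc |X'| * |a₂| ≤ 4 / δ / r * (v * (r * q)) := by gcongr
      _ = _ := by field_simp
  have t3 : |X * -a₃| ≤ r * f * q := by
    rw [abs_mul, abs_neg]
    calc |X| * |a₃| ≤ 1 / 2 * (f * (r * q)) := by gcongr
      _ ≤ r * f * q := by nlinarith [mul_nonneg hu0 hq0]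
  have t4 : |X * a₄| ≤ v * p := by
    rw [abs_mul]
    calc |X| * |a₄| ≤ 1 / 2 * (v * p) := by gcongr
      _ ≤ v * p := by nlinarith [mul_nonneg hv0 hp0]
  have t5 : X * a₅ / r ≤ 1 / 2 * (p * q) := by
    rw [div_le_iff₀ hr0]
    calc X * a₅ ≤ |X| * |a₅| := (le_abs_self _).trans (abs_mul _ _).le
      _ ≤ 1 / 2 * (p * (r * q)) := by gcongr
      _ = _ := by ring
  have hX := (abs_le.mp b0).1
  have hβδ : β * δ ^ 2 = ν / δ := by rw [← hνδ]; field_simp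
  have id1 : σ * (X' * (ν * a₁ + a₂) + X * (b * (1 / r ^ 2 - lam) * (r * q) ^ 2
      - a₃ + a₄)) = ν * (σ * (X' * a₁)) + σ * (X' * a₂) + σ * (X * -a₃) + σ * (X * a₄)
      + β * ((1 - lam * r ^ 2) * X * q ^ 2) := by
    rw [← hσ]; field_simp; ring
  have id2 : ((X' * (r ^ 2 * q ^ 2) + X * (2 * a₅)) * r - X * (r ^ 2 * q ^ 2) * 1) / r ^ 2
      = r * X' * q ^ 2 + 2 * (X * a₅ / r) - X * q ^ 2 := by
    field_simp
  rw [id1, id2]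
  have s1 := mul_le_mul_of_nonneg_left ((neg_le_neg t1).trans (hσm _)) hν
  have s2 := (neg_le_neg t2).trans (hσm _)
  have s3 := (neg_le_neg t3).trans (hσm _)
  have s4 := (neg_le_neg t4).trans (hσm _)
  have s5 := mul_le_mul_of_nonneg_left t5 (by positivity : 0 ≤ β * δ ^ 2 / 2)
  have s6 := mul_le_mul_of_nonneg_left b2 (by positivity : 0 ≤ β * q ^ 2)
  have s7 := mul_le_mul_of_nonneg_left hX (by positivity : 0 ≤ β * δ ^ 2 / 4 * q ^ 2)
  have s8 := mul_le_mul_of_nonneg_left hδ' (by positivity : 0 ≤ β * δ * q ^ 2)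
  have s9 : 5 * ν / δ * (p * q) = ν * (4 / δ * (p * q)) + β * δ ^ 2 * (p * q) := by
    rw [hβδ]; ring
  have s10 : 0 ≤ β * δ ^ 2 * (p * q) := by positivity
  rw [s9]
  linarith

theorem abs_re_mul_conj_le (a b : ℂ) : |(a * starRingEnd ℂ b).re| ≤ ‖a‖ * ‖b‖ := by
  simpa using Complex.abs_re_le_norm (a * starRingEnd ℂ b)

theorem abs_im_mul_conj_le (a b : ℂ) : |(a * starRingEnd ℂ b).im| ≤ ‖a‖ * ‖b‖ := by
  simpa using Complex.abs_im_le_norm (a * starRingEnd ℂ b)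

/-- Testing the equation against `w`. -/
theorem dissipation_estimate (hν : 0 < ν) (hk : k ≠ 0) {R : ℝ} (hR : 1 ≤ R)
    (hw : ContDiff ℝ (⊤ : ℕ∞) w) (hF₁ : Continuous F₁) (hF₂ : ContDiff ℝ (⊤ : ℕ∞) F₂)
    (hw1 : w 1 = 0) (hwR : w R = 0)
    (h : ∀ r ∈ Ioo 1 R,
      TaylorCouetteOp ν B k w r - Complex.I * (k : ℂ) * (B : ℂ) * (lam : ℂ) * w r
        = F₁ r + deriv F₂ r) :
    ν * √(∫ r in (1 : ℝ)..R, ‖deriv w r‖ ^ 2) ^ 2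
        + 3 / 4 * (ν * (k : ℝ) ^ 2) * √(∫ r in (1 : ℝ)..R, (‖w r‖ / r) ^ 2) ^ 2
      ≤ √(∫ r in (1 : ℝ)..R, (r * ‖F₁ r‖) ^ 2) * √(∫ r in (1 : ℝ)..R, (‖w r‖ / r) ^ 2)
        + √(∫ r in (1 : ℝ)..R, ‖F₂ r‖ ^ 2) * √(∫ r in (1 : ℝ)..R, ‖deriv w r‖ ^ 2) := by
  have hk1 : (1 : ℝ) ≤ (k : ℝ) ^ 2 := by
    exact_mod_cast Int.one_le_abs (pow_ne_zero 2 hk) |>.trans (by simp)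
  have hc0 := hw.continuous
  have hc1 := (contDiff_deriv_of_smooth hw).continuous
  have hc2 := hF₂.continuous
  have key := quadratic_le_of_pointwise hR (p := fun r => ‖deriv w r‖) (q := fun r => ‖w r‖ / r)
    (u := fun r => r * ‖F₁ r‖) (v := fun r => ‖F₂ r‖)
    (G := fun r => (energyFlux ν w F₂ r).re) (G' := fun r => (energyFluxDeriv ν w F₂ r).re)
    (c₁ := ν) (c₂ := 3 / 4 * (ν * (k : ℝ) ^ 2)) (d₁ := 0) (d₂ := 1) (d₃ := 0) (d₄ := 1)
    (by fun_prop)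
    (ContinuousOn.div (by fun_prop) (by fun_prop) fun r hr => by linarith [hr.1])
    (by fun_prop) (by fun_prop)
    (Complex.continuous_re.comp (continuous_energyFlux hw hF₂)).continuousOn
    (Complex.continuous_re.comp (continuous_energyFluxDeriv hw hF₂)).continuousOn
    (fun r _ => hasDerivAt_re (hasDerivAt_energyFlux hw hF₂ r))
    (by simp [energyFlux, hw1]) (by simp [energyFlux, hwR])
    le_rfl zero_le_one le_rfl zero_le_one ?_
  · linarith
  · intro r hr
    have hr0 : 0 < r := by linarith [hr.1]
    have e := energyFluxDeriv_re (h r hr)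
    have e1 := (abs_le.mp (abs_re_mul_conj_le (F₁ r) (w r))).2
    have e2 := (abs_le.mp (abs_re_mul_conj_le (F₂ r) (deriv w r))).1
    have e3 : r * ‖F₁ r‖ * (‖w r‖ / r) = ‖F₁ r‖ * ‖w r‖ := by field_simp
    have e4 := mul_nonneg (mul_nonneg hν.le (sub_nonneg.2 hk1)) (sq_nonneg (‖w r‖ / r))
    rw [e3]
    nlinarith

/-- Testing the equation against `χ w`, where `χ` is a mollified sign of `r⁻² - lam` at the
scale `δ` of the critical layer. -/
theorem critical_layer_estimate (hν : 0 < ν) {δ : ℝ} (hδ : 0 < δ) (hδ' : δ ≤ 1 / 2)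
    (hνδ : |(k : ℝ) * B| * δ ^ 3 = ν) {R : ℝ} (hR : 1 ≤ R)
    (hw : ContDiff ℝ (⊤ : ℕ∞) w) (hF₁ : Continuous F₁) (hF₂ : ContDiff ℝ (⊤ : ℕ∞) F₂)
    (hw1 : w 1 = 0) (hwR : w R = 0)
    (h : ∀ r ∈ Ioo 1 R,
      TaylorCouetteOp ν B k w r - Complex.I * (k : ℂ) * (B : ℂ) * (lam : ℂ) * w r
        = F₁ r + deriv F₂ r) :
    |(k : ℝ) * B| * δ / 16 * √(∫ r in (1 : ℝ)..R, (‖w r‖ / r) ^ 2) ^ 2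
      ≤ 5 * ν / δ * (√(∫ r in (1 : ℝ)..R, ‖deriv w r‖ ^ 2)
          * √(∫ r in (1 : ℝ)..R, (‖w r‖ / r) ^ 2))
        + √(∫ r in (1 : ℝ)..R, (r * ‖F₁ r‖) ^ 2) * √(∫ r in (1 : ℝ)..R, (‖w r‖ / r) ^ 2)
        + 4 / δ * (√(∫ r in (1 : ℝ)..R, ‖F₂ r‖ ^ 2) * √(∫ r in (1 : ℝ)..R, (‖w r‖ / r) ^ 2))
        + √(∫ r in (1 : ℝ)..R, ‖F₂ r‖ ^ 2) * √(∫ r in (1 : ℝ)..R, ‖deriv w r‖ ^ 2) := by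
  obtain ⟨σ, hσ, hσ1⟩ : ∃ σ : ℝ, σ * ((k : ℝ) * B) = |(k : ℝ) * B| ∧ |σ| = 1 := by
    rcases abs_choice ((k : ℝ) * B) with hs | hs
    · exact ⟨1, by rw [hs, one_mul], by simp⟩
    · exact ⟨-1, by rw [hs, neg_one_mul], by simp⟩
  set β := |(k : ℝ) * B| with hβdef
  have hβ : 0 ≤ β := abs_nonneg _
  let χ : ℝ → ℝ := fun r => δ * (1 - lam * r ^ 2) / (δ ^ 2 + (1 - lam * r ^ 2) ^ 2)
  let χ' : ℝ → ℝ := fun r => δ * (-2 * lam * r) * (δ ^ 2 - (1 - lam * r ^ 2) ^ 2)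
        / (δ ^ 2 + (1 - lam * r ^ 2) ^ 2) ^ 2
  have hχ : ∀ r, HasDerivAt χ (χ' r) r := hasDerivAt_multiplier hδ
  have hχc : Continuous χ := continuous_iff_continuousAt.2 fun r => (hχ r).continuousAt
  have hχ'c : Continuous χ' :=
    Continuous.div (by fun_prop) (by fun_prop) fun r => by positivity
  have hc0 := hw.continuous
  have hc1 := (contDiff_deriv_of_smooth hw).continuous
  have hc2 := hF₂.continuous
  have hconj : Continuous (starRingEnd ℂ) := Complex.continuous_conj
  have hf := Complex.continuous_im.comp (continuous_energyFlux (ν := ν) hw hF₂)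
  have hf' := Complex.continuous_im.comp (continuous_energyFluxDeriv (ν := ν) hw hF₂)
  have hre := Complex.continuous_re
  let S : ℝ → ℝ := fun r => (w r * starRingEnd ℂ (w r)).re
  let S' : ℝ → ℝ := fun r => 2 * (deriv w r * starRingEnd ℂ (w r)).re
  have hS : ∀ r, HasDerivAt S (S' r) r := fun r => by
    have hwr := hasDerivAt_of_smooth hw r
    refine (hasDerivAt_re (hwr.mul (hasDerivAt_conj hwr))).congr_deriv ?_
    change _ = 2 * (deriv w r * starRingEnd ℂ (w r)).re
    simp only [Complex.add_re, Complex.mul_re, Complex.conj_re, Complex.conj_im]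
    ring
  have hSc : Continuous S := continuous_iff_continuousAt.2 fun r => (hS r).continuousAt
  have hS'c : Continuous S' := by fun_prop
  have key := quadratic_le_of_pointwise hR (p := fun r => ‖deriv w r‖) (q := fun r => ‖w r‖ / r)
    (u := fun r => r * ‖F₁ r‖) (v := fun r => ‖F₂ r‖)
    (G := fun r => σ * (χ r * (energyFlux ν w F₂ r).im)
      - β * δ ^ 2 / 4 * (χ r * S r / r))
    (G' := fun r => σ * (χ' r * (energyFlux ν w F₂ r).im + χ r * (energyFluxDeriv ν w F₂ r).im)
      - β * δ ^ 2 / 4 * (((χ' r * S r + χ r * S' r) * r - χ r * S r * 1) / r ^ 2))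
    (c₁ := 0) (c₂ := β * δ / 16) (d₁ := 5 * ν / δ) (d₂ := 1) (d₃ := 4 / δ) (d₄ := 1)
    (by fun_prop)
    (ContinuousOn.div (by fun_prop) (by fun_prop) fun r hr => by linarith [hr.1])
    (by fun_prop) (by fun_prop)
    (((hχc.mul hf).const_mul σ).continuousOn.sub (continuousOn_const.mul
      (ContinuousOn.div (by fun_prop) (by fun_prop) fun r hr => by linarith [hr.1])))
    ((((hχ'c.mul hf).add (hχc.mul hf')).const_mul σ).continuousOn.sub (continuousOn_const.mul
      (ContinuousOn.div (by fun_prop) (by fun_prop) fun r hr => by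
        have := hr.1
        positivity)))
    (fun r hr => (((hχ r).mul (hasDerivAt_im (hasDerivAt_energyFlux hw hF₂ r))).const_mul σ).sub
      ((((hχ r).mul (hS r)).div (hasDerivAt_id r) (by
        have := hr.1
        simp only [id]; linarith)).const_mul _))
    (by simp [energyFlux, S, hw1]) (by simp [energyFlux, S, hwR])
    (by positivity) zero_le_one (by positivity) zero_le_one ?_
  · linarith
  · intro r hr
    have hr0 : 0 < r := by linarith [hr.1]
    have hrχ' : r * χ' r = -2 * (1 - (1 - lam * r ^ 2)) * δ * (δ ^ 2 - (1 - lam * r ^ 2) ^ 2)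
        / (δ ^ 2 + (1 - lam * r ^ 2) ^ 2) ^ 2 := by
      simp only [χ']; ring
    have b0 : |χ r| ≤ 1 / 2 := abs_multiplier_le hδ
    have b1 : |r * χ' r| ≤ 4 / δ := hrχ' ▸ abs_multiplier_deriv_le hδ hδ'
    have b2 : δ / 8 ≤ (1 - lam * r ^ 2) * χ r - 1 / 4 * δ ^ 2 * (r * χ' r) :=
      hrχ' ▸ multiplier_coercive hδ hδ'
    have him := energyFluxDeriv_im (h r hr)
    have hfl : (energyFlux ν w F₂ r).im = ν * (deriv w r * starRingEnd ℂ (w r)).im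
        + (F₂ r * starRingEnd ℂ (w r)).im := by
      rw [energyFlux, add_mul, mul_assoc, Complex.add_im, Complex.im_ofReal_mul]
    have hSr : S r = r ^ 2 * (‖w r‖ / r) ^ 2 := by
      simp only [S, Complex.mul_conj, Complex.ofReal_re, Complex.normSq_eq_norm_sq]
      field_simp
    obtain ⟨q, hq⟩ : ∃ q, ‖w r‖ / r = q := ⟨_, rfl⟩
    have hwq : ‖w r‖ = r * q := by rw [← hq]; field_simp
    have n1 := abs_im_mul_conj_le (deriv w r) (w r)
    have n2 := abs_im_mul_conj_le (F₂ r) (w r)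
    have n3 := abs_im_mul_conj_le (F₁ r) (w r)
    have n4 := abs_im_mul_conj_le (F₂ r) (deriv w r)
    have n5 := abs_re_mul_conj_le (deriv w r) (w r)
    have hq0 : 0 ≤ ‖w r‖ / r := by positivity
    have hp0 := norm_nonneg (deriv w r)
    have hv0 := norm_nonneg (F₂ r)
    have hu0 : 0 ≤ r * ‖F₁ r‖ := by positivity
    have hS'r : S' r = 2 * (deriv w r * starRingEnd ℂ (w r)).re := rfl
    rw [hq] at hq0 hSr ⊢
    rw [him, hfl, hSr, hS'r, hwq]
    rw [hwq] at n1 n2 n3 n5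
    rw [zero_mul, zero_add, one_mul, one_mul]
    exact critical_layer_pointwise hr0 hδ hδ' hβ hν.le hνδ hσ hσ1 b0 b1 b2 hp0 hq0
      (norm_nonneg _) hv0 n1 n2 n3 n4 n5

end Energy

theorem eventually_atTop_eq_zero {f : ℝ → ℂ} (hf : HasCompactSupport f) :
    ∀ᶠ r in Filter.atTop, f r = 0 := by
  have h := hasCompactSupport_iff_eventuallyEq.1 hf
  rw [Filter.coclosedCompact_eq_cocompact] at h
  exact h.filter_mono atTop_le_cocompact

theorem integral_Ioi_eq_intervalIntegral {f : ℝ → ℝ} {a b : ℝ} (hab : a ≤ b)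
    (hf : ∀ r, b ≤ r → f r = 0) : ∫ r in Ioi a, f r = ∫ r in a..b, f r := by
  rw [intervalIntegral.integral_of_le hab]
  refine (setIntegral_eq_of_subset_of_forall_sdiff_eq_zero measurableSet_Ioi
    (fun r hr => hr.1) fun r hr => hf r ?_)
  by_contra hrb
  exact hr.2 ⟨hr.1, (not_le.1 hrb).le⟩

/-- The critical layer width `δ = (ν / β)^{1/3}`. -/
theorem exists_criticalLayerWidth {ν β : ℝ} (hν : 0 < ν) (h : ν ≤ 1 / 8 * β) :
    ∃ δ : ℝ, 0 < δ ∧ δ ≤ 1 / 2 ∧ β * δ ^ 3 = ν ∧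
      ν ^ ((1 : ℝ) / 3) * β ^ ((2 : ℝ) / 3) = β * δ := by
  have hβ : 0 < β := by linarith
  have h3 : ((ν / β) ^ ((1 : ℝ) / 3)) ^ 3 = ν / β := by
    rw [← Real.rpow_natCast, ← Real.rpow_mul (by positivity)]
    norm_num
  refine ⟨(ν / β) ^ ((1 : ℝ) / 3), by positivity, ?_, ?_, ?_⟩
  · refine le_of_pow_le_pow_left₀ (n := 3) (by norm_num) (by norm_num) ?_
    rw [h3, div_le_iff₀ hβ]
    linarith
  · rw [h3]; field_simp
  · rw [Real.div_rpow hν.le hβ.le, mul_div_left_comm]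
    congr 1
    rw [eq_div_iff (by positivity), ← Real.rpow_add hβ]
    norm_num

/-- Rescaling the two estimates and closing the argument. -/
theorem resolvent_of_estimates {ν β δ κ a b f h : ℝ} (hν : 0 < ν) (hδ : 0 < δ)
    (hνδ : β * δ ^ 3 = ν) (hβ : 0 < β) (ha : 0 ≤ a) (hb : 0 ≤ b) (hf : 0 ≤ f) (hh : 0 ≤ h)
    (hκ : 0 ≤ κ)
    (h₁ : ν * a ^ 2 + 3 / 4 * κ * b ^ 2 ≤ f * b + h * a)
    (h₂ : β * δ / 16 * b ^ 2 ≤ 5 * ν / δ * (a * b) + f * b + 4 / δ * (h * b) + h * a) :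
    √ν * a + √(max κ (β * δ)) * b ≤ 20000 * ((√(max κ (β * δ)))⁻¹ * f + (√ν)⁻¹ * h) := by
  set μ := max κ (β * δ) with hμ
  have hβδ : 0 < β * δ := by positivity
  have hμ0 : 0 < μ := lt_max_of_lt_right hβδ
  have hμsum : μ ≤ κ + β * δ := max_le (by linarith) (by linarith)
  have hsν : 0 < √ν := Real.sqrt_pos.2 hν
  have hsμ : 0 < √μ := Real.sqrt_pos.2 hμ0
  have eν : √ν ^ 2 = ν := Real.sq_sqrt hν.le
  have eμ : √μ ^ 2 = μ := Real.sq_sqrt hμ0.le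
  have hlayer : √ν / δ ≤ √μ := by
    refine Real.le_sqrt_of_sq_le ?_
    rw [div_pow, eν]
    refine le_trans (le_of_eq ?_) (le_max_right _ _)
    rw [← hνδ]; field_simp
  have e1 : (√μ)⁻¹ * f * (√μ * b) = f * b := by field_simp
  have e2 : (√ν)⁻¹ * h * (√ν * a) = h * a := by field_simp
  have hκb : 0 ≤ κ * b ^ 2 := by positivity
  have i1 : ν / δ * (a * b) ≤ √ν * a * (√μ * b) := by
    calc ν / δ * (a * b) = √ν * a * (√ν / δ * b) := by
          nth_rewrite 1 [← eν]; ring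
      _ ≤ _ := by gcongr
  have i2 : 1 / δ * (h * b) ≤ (√ν)⁻¹ * h * (√μ * b) := by
    calc 1 / δ * (h * b) = (√ν)⁻¹ * h * (√ν / δ * b) := by field_simp
      _ ≤ _ := by gcongr
  have i3 : 5 * ν / δ * (a * b) = 5 * (ν / δ * (a * b)) := by ring
  have i4 : 4 / δ * (h * b) = 4 * (1 / δ * (h * b)) := by ring
  apply add_le_of_energy_inequalities (by positivity) (by positivity) (by positivity)
    (by positivity)
  · rw [e1, e2, mul_pow, eν]
    linarith
  · rw [e1, e2, mul_pow, eμ]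
    have := mul_le_mul_of_nonneg_right hμsum (sq_nonneg b)
    have := mul_nonneg hν.le (sq_nonneg a)
    have : 0 ≤ f * b + h * a := by positivity
    linarith

/-- resolvent estimate with a forcing in divergence form:
if `(𝒯_k − ikBλ) w = F₁ + ∂_r F₂` then
`ν^{1/2}‖w'‖ + μ_k^{1/2}‖w/r‖ ≤ C (μ_k^{-1/2}‖rF₁‖ + ν^{-1/2}‖F₂‖)`. -/
theorem stmt_5 :
    ∃ ε C : ℝ, 0 < ε ∧ 0 < C ∧
      ∀ (k : ℤ) (ν B lam : ℝ) (w F₁ F₂ : ℝ → ℂ),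
        k ≠ 0 → 0 < ν → ν ≤ ε * |(k : ℝ) * B| →
        ContDiff ℝ (⊤ : ℕ∞) w → HasCompactSupport w → w 1 = 0 →
        ContDiff ℝ (⊤ : ℕ∞) F₁ → HasCompactSupport F₁ →
        ContDiff ℝ (⊤ : ℕ∞) F₂ → HasCompactSupport F₂ →
        (∀ r ∈ Ioi (1 : ℝ),
          TaylorCouetteOp ν B k w r - Complex.I * (k : ℂ) * (B : ℂ) * (lam : ℂ) * w r
            = F₁ r + deriv F₂ r) →
        Real.sqrt ν * Real.sqrt (∫ r in Ioi (1 : ℝ), ‖deriv w r‖ ^ 2)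
          + Real.sqrt (max (ν * (k : ℝ) ^ 2)
                (ν ^ ((1 : ℝ) / 3) * |(k : ℝ) * B| ^ ((2 : ℝ) / 3)))
              * Real.sqrt (∫ r in Ioi (1 : ℝ), (‖w r‖ / r) ^ 2)
        ≤ C * ((Real.sqrt (max (ν * (k : ℝ) ^ 2)
                  (ν ^ ((1 : ℝ) / 3) * |(k : ℝ) * B| ^ ((2 : ℝ) / 3))))⁻¹
                * Real.sqrt (∫ r in Ioi (1 : ℝ), (r * ‖F₁ r‖) ^ 2)
              + (Real.sqrt ν)⁻¹ * Real.sqrt (∫ r in Ioi (1 : ℝ), ‖F₂ r‖ ^ 2)) := by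
  refine ⟨1 / 8, 20000, by norm_num, by norm_num, ?_⟩
  intro k ν B lam w F₁ F₂ hk hν hε hw hwc hw1 hF₁ hF₁c hF₂ hF₂c heq
  obtain ⟨δ, hδ, hδ', hνδ, hlayer⟩ := exists_criticalLayerWidth hν hε
  have hβ : 0 < |(k : ℝ) * B| := by linarith
  obtain ⟨R, hR⟩ := Filter.eventually_atTop.1 ((eventually_atTop_eq_zero hwc).and
    ((eventually_atTop_eq_zero hwc.deriv).and ((eventually_atTop_eq_zero hF₁c).and
      ((eventually_atTop_eq_zero hF₂c).and (Filter.eventually_ge_atTop 1)))))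
  have hR1 : 1 ≤ R := (hR R le_rfl).2.2.2.2
  have heqR : ∀ r ∈ Ioo 1 R, TaylorCouetteOp ν B k w r
      - Complex.I * (k : ℂ) * (B : ℂ) * (lam : ℂ) * w r = F₁ r + deriv F₂ r :=
    fun r hr => heq r hr.1
  rw [hlayer,
    integral_Ioi_eq_intervalIntegral hR1 fun r hr => by simp [(hR r hr).2.1],
    integral_Ioi_eq_intervalIntegral hR1 fun r hr => by simp [(hR r hr).1],
    integral_Ioi_eq_intervalIntegral hR1 fun r hr => by simp [(hR r hr).2.2.1],
    integral_Ioi_eq_intervalIntegral hR1 fun r hr => by simp [(hR r hr).2.2.2.1]]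
  exact resolvent_of_estimates hν hδ hνδ hβ (Real.sqrt_nonneg _) (Real.sqrt_nonneg _)
    (Real.sqrt_nonneg _) (Real.sqrt_nonneg _) (by positivity)
    (dissipation_estimate hν hk hR1 hw hF₁.continuous hF₂ hw1 (hR R le_rfl).1 heqR)
    (critical_layer_estimate hν hδ hδ' hνδ hR1 hw hF₁.continuous hF₂ hw1 (hR R le_rfl).1 heqR)
end

section
/- There exists a universal constant C > 0 such that for every ν > 0 and B ∈ ℝ with |B| > ν, there exist λ₀ ∈ ℝ and a nonzero function w₀ ∈ H²((1,∞)) ∩ H¹₀((1,∞)) (one may take w₀ smooth, compactly supported in (1,∞)) such that ‖ r · ((𝒯₁ − i B λ₀) w₀) ‖_{L²_r} ≤ C ν^{1/3} |B|^{2/3} ‖ w₀/r ‖_{L²_r}, where 𝒯₁ is the operator 𝒯_k with k = 1. In particular, one may take λ₀ = r₀^{-2} with r₀ = (|B|/ν)^{1/6}. -/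
open MeasureTheory Set

/-- A smooth profile supported in `[0, 1]`, equal to `1` on `[1/4, 3/4]`. -/
theorem exists_unit_interval_profile :
    ∃ (g : ℝ → ℂ) (M : ℝ), 0 ≤ M ∧ ContDiff ℝ (⊤ : ℕ∞) g ∧ tsupport g ⊆ Icc 0 1 ∧
      (∀ x, ‖g x‖ ≤ 1) ∧ (∀ x, ‖deriv (deriv g) x‖ ≤ M) ∧
      ∀ x ∈ Icc (1 / 4 : ℝ) (3 / 4), g x = 1 := by
  let φ : ContDiffBump (1 / 2 : ℝ) := ⟨1 / 4, 1 / 2, by norm_num, by norm_num⟩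
  have hsupp : tsupport (fun x => (φ x : ℂ)) ⊆ Icc 0 1 := by
    have h : tsupport φ = Icc 0 1 := by
      rw [φ.tsupport_eq, Real.closedBall_eq_Icc]
      norm_num [φ]
    rw [← h]
    exact closure_mono fun x hx h0 => hx (by simp [h0])
  have hcd : ContDiff ℝ (⊤ : ℕ∞) (fun x => (φ x : ℂ)) :=
    Complex.ofRealCLM.contDiff.comp φ.contDiff
  have hcpt : HasCompactSupport (fun x => (φ x : ℂ)) :=
    isCompact_Icc.of_isClosed_subset (isClosed_tsupport _) hsupp
  have hcont : Continuous (deriv (deriv (fun x => (φ x : ℂ)))) :=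
    (contDiff_infty_iff_deriv.1 (contDiff_infty_iff_deriv.1 hcd).2).2.continuous
  obtain ⟨M, hM⟩ := hcpt.deriv.deriv.exists_bound_of_continuous hcont
  refine ⟨_, M, (norm_nonneg _).trans (hM 0), hcd, hsupp, fun x => ?_, hM, fun x hx => ?_⟩
  · rw [Complex.norm_real, Real.norm_of_nonneg φ.nonneg]
    exact φ.le_one
  · have : φ x = 1 := φ.one_of_mem_closedBall (by
      rw [Real.closedBall_eq_Icc]
      norm_num [φ]
      constructor <;> linarith [hx.1, hx.2])
    simp [this]

theorem deriv_comp_mul_sub {g : ℝ → ℂ} (hg : Differentiable ℝ g) (a b : ℝ) :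
    deriv (fun r => g (a * (r - b))) = fun r => (a : ℂ) * deriv g (a * (r - b)) := by
  funext r
  have h : HasDerivAt (fun r : ℝ => a * (r - b)) a r := by
    simpa using ((hasDerivAt_id r).sub_const b).const_mul a
  simpa [Function.comp_def] using ((hg _).hasDerivAt.scomp r h).deriv

theorem deriv_deriv_comp_mul_sub {g : ℝ → ℂ} (hg : ContDiff ℝ (⊤ : ℕ∞) g) (a b r : ℝ) :
    deriv (deriv (fun r => g (a * (r - b)))) r = (a : ℂ) ^ 2 * deriv (deriv g) (a * (r - b)) := by
  have hg1 : Differentiable ℝ g := hg.differentiable (by simp)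
  have hg2 : Differentiable ℝ (deriv g) :=
    (contDiff_infty_iff_deriv.1 hg).2.differentiable (by simp)
  rw [deriv_comp_mul_sub hg1, deriv_const_mul_field, deriv_comp_mul_sub hg2]
  ring

theorem mul_norm_taylorCouetteOp_le {ν B R M r : ℝ} {w : ℝ → ℂ} (hν : 0 < ν) (hR : 1 ≤ R)
    (hB : |B| = ν * R ^ 6) (hr : r ∈ Icc R (R + 1 / R)) (hw : ‖w r‖ ≤ 1)
    (hw2 : ‖deriv (deriv w) r‖ ≤ R ^ 2 * M) :
    r * ‖TaylorCouetteOp ν B 1 w r - Complex.I * (B : ℂ) * ((1 / R ^ 2 : ℝ) : ℂ) * w r‖ ≤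
      ν * R ^ 3 * (2 * M + 8) := by
  have hR0 : 0 < R := by linarith
  obtain ⟨hr1, hr2⟩ := hr
  have hr0 : 0 < r := by linarith
  have hR1 : 1 / R ≤ R := ((div_le_one hR0).2 hR).trans hR
  have hrR : r ≤ 2 * R := by linarith
  have hdiff : |1 / r ^ 2 - 1 / R ^ 2| ≤ 3 / R ^ 4 := by
    have h1 : 1 / r ^ 2 ≤ 1 / R ^ 2 := by gcongr
    rw [abs_of_nonpos (by linarith), neg_sub,
      div_sub_div _ _ (by positivity) (by positivity), div_le_div_iff₀ (by positivity) (by positivity)]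
    have h2 : (r - R) * R ≤ 1 := by
      have := mul_le_mul_of_nonneg_right (show r - R ≤ 1 / R by linarith) hR0.le
      rwa [one_div, inv_mul_cancel₀ hR0.ne'] at this
    have h3 : 1 * r ^ 2 - R ^ 2 * 1 ≤ 3 := by nlinarith
    have h4 : R ^ 4 ≤ R ^ 2 * r ^ 2 := by
      have : R ^ 2 ≤ r ^ 2 := by gcongr
      nlinarith [sq_nonneg R]
    nlinarith [sq_nonneg R, pow_pos hR0 4]
  have hinv : 1 / r ^ 2 ≤ 1 := by
    rw [div_le_one (by positivity)]
    nlinarith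
  have key : TaylorCouetteOp ν B 1 w r - Complex.I * (B : ℂ) * ((1 / R ^ 2 : ℝ) : ℂ) * w r =
      -(ν : ℂ) * deriv (deriv w) r + ((ν * (3 / 4) * (1 / r ^ 2) : ℝ) : ℂ) * w r +
        Complex.I * ((B * (1 / r ^ 2 - 1 / R ^ 2) : ℝ) : ℂ) * w r := by
    simp only [TaylorCouetteOp]
    push_cast
    ring
  have hn1 : ‖-(ν : ℂ) * deriv (deriv w) r‖ ≤ ν * (R ^ 2 * M) := by
    rw [norm_mul, norm_neg, Complex.norm_real, Real.norm_of_nonneg hν.le]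
    gcongr
  have hn2 : ‖((ν * (3 / 4) * (1 / r ^ 2) : ℝ) : ℂ) * w r‖ ≤ ν * R ^ 2 := by
    rw [norm_mul, Complex.norm_real, Real.norm_of_nonneg (by positivity)]
    calc _ ≤ ν * (3 / 4) * 1 * 1 := by gcongr
      _ ≤ ν * R ^ 2 := by nlinarith [one_le_pow₀ hR (n := 2)]
  have hn3 : ‖Complex.I * ((B * (1 / r ^ 2 - 1 / R ^ 2) : ℝ) : ℂ) * w r‖ ≤ 3 * ν * R ^ 2 := by
    rw [norm_mul, norm_mul, Complex.norm_I, one_mul, Complex.norm_real, Real.norm_eq_abs, abs_mul,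
      hB]
    calc _ ≤ ν * R ^ 6 * (3 / R ^ 4) * 1 := by gcongr
      _ = 3 * ν * R ^ 2 := by field_simp
  rw [key]
  calc _ ≤ (2 * R) * (ν * (R ^ 2 * M) + ν * R ^ 2 + 3 * ν * R ^ 2) := by
        gcongr
        exact (norm_add₃_le).trans (by gcongr)
    _ = ν * R ^ 3 * (2 * M + 8) := by ring

theorem setIntegral_Ioi_sq_le {f : ℝ → ℝ} {a b K : ℝ} (hab : a ≤ b)
    (hf : ∀ r ∈ Icc a b, |f r| ≤ K) (hf0 : ∀ r ∉ Icc a b, f r = 0) :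
    ∫ r in Ioi (1 : ℝ), f r ^ 2 ≤ K ^ 2 * (b - a) := by
  have hle : ∀ r, f r ^ 2 ≤ (Icc a b).indicator (fun _ => K ^ 2) r := fun r => by
    by_cases hr : r ∈ Icc a b
    · rw [indicator_of_mem hr, ← sq_abs]
      exact pow_le_pow_left₀ (abs_nonneg _) (hf r hr) 2
    · simp [hr, hf0 r hr]
  have hint : Integrable ((Icc a b).indicator fun _ => K ^ 2) :=
    (integrable_indicator_iff measurableSet_Icc).2 (by simp)
  calc _ ≤ ∫ r in Ioi (1 : ℝ), (Icc a b).indicator (fun _ => K ^ 2) r :=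
        integral_mono_of_nonneg (.of_forall fun _ => sq_nonneg _) hint.integrableOn
          (.of_forall hle)
    _ ≤ ∫ r, (Icc a b).indicator (fun _ => K ^ 2) r :=
        setIntegral_le_integral hint
          (.of_forall fun r => indicator_nonneg (fun _ _ => sq_nonneg K) r)
    _ = K ^ 2 * (b - a) := by
        simp [integral_indicator, hab, mul_comm]

theorem le_setIntegral_Ioi_sq_norm_div {w : ℝ → ℂ} (hw : Continuous w)
    (hc : HasCompactSupport w) {a b c : ℝ} (ha : 1 < a) (hab : a ≤ b) (hbc : b ≤ c)
    (h1 : ∀ r ∈ Icc a b, w r = 1) :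
    (1 / c) ^ 2 * (b - a) ≤ ∫ r in Ioi (1 : ℝ), (‖w r‖ / r) ^ 2 := by
  have hint : IntegrableOn (fun r => (‖w r‖ / r) ^ 2) (Ioi 1) := by
    have hi : Integrable (fun r => ‖w r‖ ^ 2) :=
      (by fun_prop : Continuous fun r => ‖w r‖ ^ 2).integrable_of_hasCompactSupport
        (hc.norm.comp_left (g := fun x : ℝ => x ^ 2) (by simp))
    refine hi.integrableOn.mono'
      ((hw.measurable.norm.div measurable_id).pow_const 2).aestronglyMeasurable ?_
    refine (ae_restrict_iff' measurableSet_Ioi).2 (.of_forall fun r hr => ?_)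
    rw [mem_Ioi] at hr
    rw [Real.norm_of_nonneg (sq_nonneg _)]
    gcongr
    exact div_le_self (norm_nonneg _) hr.le
  have hsub : Icc a b ⊆ Ioi 1 := fun r hr => ha.trans_le hr.1
  calc (1 / c) ^ 2 * (b - a) = ∫ _ in Icc a b, (1 / c) ^ 2 := by simp [hab, mul_comm]
    _ ≤ ∫ r in Icc a b, (‖w r‖ / r) ^ 2 := by
        refine setIntegral_mono_on (by simp) (hint.mono_set hsub) measurableSet_Icc fun r hr => ?_
        have : 0 < r := by linarith [hr.1]
        rw [h1 r hr, norm_one]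
        have : r ≤ c := hr.2.trans hbc
        have : 0 < c := by linarith
        gcongr
    _ ≤ _ := setIntegral_mono_set hint (.of_forall fun _ => sq_nonneg _)
        hsub.eventuallyLE

/-- sharpness of the pseudospectral bound `ν^{1/3}|B|^{2/3}` for `k = 1`:
there exist `λ₀ = r₀⁻² = (ν/|B|)^{1/3}` and a nonzero smooth `w₀` compactly supported
in `(1,∞)` with `‖r (𝒯₁ − iBλ₀) w₀‖ ≤ C ν^{1/3}|B|^{2/3} ‖w₀/r‖`. -/
theorem stmt_6 :
    ∃ C : ℝ, 0 < C ∧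
      ∀ ν B : ℝ, 0 < ν → ν < |B| →
        ∃ (lam : ℝ) (w₀ : ℝ → ℂ),
          lam = (ν / |B|) ^ ((1 : ℝ) / 3) ∧
          ContDiff ℝ (⊤ : ℕ∞) w₀ ∧ HasCompactSupport w₀ ∧
          tsupport w₀ ⊆ Ioi (1 : ℝ) ∧ w₀ ≠ 0 ∧
          Real.sqrt (∫ r in Ioi (1 : ℝ),
              (r * ‖TaylorCouetteOp ν B 1 w₀ r
                  - Complex.I * (B : ℂ) * (lam : ℂ) * w₀ r‖) ^ 2)
            ≤ C * ν ^ ((1 : ℝ) / 3) * |B| ^ ((2 : ℝ) / 3)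
                * Real.sqrt (∫ r in Ioi (1 : ℝ), (‖w₀ r‖ / r) ^ 2) := by
  obtain ⟨g, M, hM, hg, hsupp, hg1, hg2, hgone⟩ := exists_unit_interval_profile
  refine ⟨3 * (2 * M + 8), by positivity, fun ν B hν hB => ?_⟩
  have hB0 : 0 < |B| := hν.trans hB
  obtain ⟨R, hR, hBR⟩ : ∃ R : ℝ, 1 < R ∧ |B| = ν * R ^ 6 := by
    refine ⟨(|B| / ν) ^ ((1 : ℝ) / 6), Real.one_lt_rpow ((one_lt_div hν).2 hB) (by norm_num), ?_⟩
    rw [← Real.rpow_natCast, ← Real.rpow_mul (by positivity)]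
    norm_num
    field_simp
  have hR0 : 0 < R := by linarith
  have hlam : (ν / |B|) ^ ((1 : ℝ) / 3) = 1 / R ^ 2 := by
    have h : ν / |B| = (1 / R ^ 2) ^ (3 : ℕ) := by
      rw [hBR]
      field_simp
    rw [h, ← Real.rpow_natCast, ← Real.rpow_mul (by positivity)]
    norm_num
  have hscale : ν ^ ((1 : ℝ) / 3) * |B| ^ ((2 : ℝ) / 3) = ν * R ^ 4 := by
    have h : R ^ 6 = (R ^ 4) ^ ((3 : ℝ) / 2) := by
      rw [← Real.rpow_natCast, ← Real.rpow_natCast, ← Real.rpow_mul hR0.le]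
      norm_num
    rw [hBR, Real.mul_rpow hν.le (by positivity), h, ← Real.rpow_mul (by positivity), ← mul_assoc,
      ← Real.rpow_add hν]
    norm_num
  set w : ℝ → ℂ := fun r => g (R * (r - R)) with hw
  have hmem : ∀ r, R * (r - R) ∈ Icc (0 : ℝ) 1 → r ∈ Icc R (R + 1 / R) := fun r hr => by
    have h1 := hr.1
    have h2 := hr.2
    rw [mul_comm, ← le_div_iff₀ hR0] at h2
    exact ⟨by nlinarith, by linarith⟩
  have hwcd : ContDiff ℝ (⊤ : ℕ∞) w := hg.comp (by fun_prop)
  have hwsupp : tsupport w ⊆ Icc R (R + 1 / R) :=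
    closure_minimal (fun r hr => hmem r (hsupp (subset_tsupport g hr))) isClosed_Icc
  have hwcpt : HasCompactSupport w :=
    isCompact_Icc.of_isClosed_subset (isClosed_tsupport w) hwsupp
  have hwone : ∀ r ∈ Icc (R + 1 / 4 / R) (R + 3 / 4 / R), w r = 1 := fun r hr => by
    have h1 : 1 / 4 / R ≤ r - R := by linarith [hr.1]
    have h2 : r - R ≤ 3 / 4 / R := by linarith [hr.2]
    rw [div_le_iff₀ hR0] at h1
    rw [le_div_iff₀ hR0] at h2
    exact hgone _ ⟨by linarith, by linarith⟩
  have hab : R + 1 / 4 / R ≤ R + 3 / 4 / R := by gcongr; norm_num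
  refine ⟨_, w, rfl, hwcd, hwcpt, fun r hr => hR.trans_le (hwsupp hr).1, fun h => ?_, ?_⟩
  · simpa [h] using hwone _ (left_mem_Icc.2 hab)
  have hupper := setIntegral_Ioi_sq_le (f := fun r => r * ‖TaylorCouetteOp ν B 1 w r
      - Complex.I * (B : ℂ) * ((1 / R ^ 2 : ℝ) : ℂ) * w r‖) (a := R) (b := R + 1 / R)
    (K := ν * R ^ 3 * (2 * M + 8)) (by simp [hR0.le])
    (fun r hr => by
      have hr0 : 0 < r := hR0.trans_le hr.1
      rw [abs_of_nonneg (by positivity)]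
      refine mul_norm_taylorCouetteOp_le hν hR.le hBR hr (hg1 _) ?_
      rw [hw, deriv_deriv_comp_mul_sub hg, norm_mul, norm_pow, Complex.norm_real,
        Real.norm_of_nonneg hR0.le]
      gcongr
      exact hg2 _)
    (fun r hr => by
      have h0 : w r = 0 := image_eq_zero_of_notMem_tsupport fun h => hr (hwsupp h)
      have h2 : deriv (deriv w) r = 0 := image_eq_zero_of_notMem_tsupport fun h =>
        hr (hwsupp (tsupport_deriv_subset (f := w) (tsupport_deriv_subset (f := deriv w) h)))
      simp [TaylorCouetteOp, h0, h2])
  have hlower := le_setIntegral_Ioi_sq_norm_div hwcd.continuous hwcpt (c := 2 * R)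
    (by have : 0 < 1 / 4 / R := by positivity
        linarith) hab
    (by have : 3 / 4 / R ≤ R := by
          rw [div_le_iff₀ hR0]
          nlinarith
        linarith) hwone
  rw [hlam, mul_assoc (3 * (2 * M + 8)), hscale]
  refine Real.sqrt_le_iff.2 ⟨by positivity, hupper.trans ?_⟩
  rw [mul_pow _ (Real.sqrt _), Real.sq_sqrt (integral_nonneg fun _ => sq_nonneg _)]
  refine le_trans ?_ (mul_le_mul_of_nonneg_left hlower (sq_nonneg _))
  have e1 : (ν * R ^ 3 * (2 * M + 8)) ^ 2 * (R + 1 / R - R) = (ν * (2 * M + 8)) ^ 2 * R ^ 5 := by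
    field_simp
    ring
  have e2 : (3 * (2 * M + 8) * (ν * R ^ 4)) ^ 2 *
      ((1 / (2 * R)) ^ 2 * (R + 3 / 4 / R - (R + 1 / 4 / R))) =
        9 / 8 * ((ν * (2 * M + 8)) ^ 2 * R ^ 5) := by
    field_simp
    ring
  rw [e1, e2]
  have : 0 ≤ (ν * (2 * M + 8)) ^ 2 * R ^ 5 := by positivity
  linarith
end

section
/- Let Θ ≥ 10⁹ be a fixed constant. There exist constants ε > 0 and C > 0 such that the following holds. Let k be a nonzero integer, ν > 0, B ∈ ℝ with ν ≤ ε|kB|, T > 0, and let w solve ∂_t w − ν( ∂_r² w − (k² + Θ²) r^{-2} w ) + ν (2kBt/r³)² w = 0 on (0,T)×(1,∞) with w(0,·) = w₀ ∈ L²_r and w(t,1) = 0. Then ν^{5/6} |kB|^{5/3} ‖ (t²/r⁵) w ‖_{L²((0,T);L²_r)} ≤ C ‖w₀‖_{L²_r}. -/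
open MeasureTheory Set

/-- The `10`-th power of the positive part is differentiable. -/
lemma hasDerivAt_max_zero_pow_ten (y : ℝ) :
    HasDerivAt (fun y : ℝ => max y 0 ^ 10) (10 * max y 0 ^ 9) y := by
  rcases lt_trichotomy y 0 with h | h | h
  · have : (fun y : ℝ => max y 0 ^ 10) =ᶠ[nhds y] fun _ => 0 := by
      filter_upwards [Iio_mem_nhds h] with z hz
      simp [max_eq_right (le_of_lt (mem_Iio.1 hz))]
    rw [max_eq_right h.le]
    simpa using (hasDerivAt_const y (0 : ℝ)).congr_of_eventuallyEq this
  · subst h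
    have h1 : HasDerivAt (fun y : ℝ => y ^ 2) 0 0 := by simpa using hasDerivAt_pow 2 (0 : ℝ)
    rw [hasDerivAt_iff_isLittleO] at h1 ⊢
    simp only [max_self, ne_eq, OfNat.ofNat_ne_zero, not_false_eq_true, zero_pow, sub_zero,
      mul_zero, smul_zero] at h1 ⊢
    refine Asymptotics.IsBigO.trans_isLittleO ?_ h1
    refine Asymptotics.IsBigO.of_bound 1 ?_
    filter_upwards [Icc_mem_nhds (show (-1 : ℝ) < 0 by norm_num) one_pos] with z hz
    have h0 : 0 ≤ max z 0 := le_max_right _ _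
    have hz1 : max z 0 ≤ 1 := max_le hz.2 zero_le_one
    have hz2 : max z 0 ≤ |z| := max_le (le_abs_self z) (abs_nonneg z)
    rw [Real.norm_of_nonneg (by positivity), Real.norm_of_nonneg (by positivity), one_mul]
    calc max z 0 ^ 10 ≤ max z 0 ^ 2 := pow_le_pow_of_le_one h0 hz1 (by norm_num)
      _ ≤ |z| ^ 2 := by gcongr
      _ = z ^ 2 := sq_abs z
  · have : (fun y : ℝ => max y 0 ^ 10) =ᶠ[nhds y] fun y => y ^ 10 := by
      filter_upwards [Ioi_mem_nhds h] with z hz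
      simp [max_eq_left (le_of_lt (mem_Ioi.1 hz))]
    rw [max_eq_left h.le]
    simpa using (hasDerivAt_pow 10 y).congr_of_eventuallyEq this

lemma contDiff_max_zero_pow_ten : ContDiff ℝ 1 (fun y : ℝ => max y 0 ^ 10) := by
  rw [contDiff_one_iff_deriv]
  refine ⟨fun y => (hasDerivAt_max_zero_pow_ten y).differentiableAt, ?_⟩
  rw [funext fun y => (hasDerivAt_max_zero_pow_ten y).deriv]
  fun_prop

/-- Divergence theorem as an inequality on a rectangle, for a `C¹` field whose second component
vanishes on the sides `r = 1` and `r = R`. -/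
lemma integral_sub_le_of_divergence_le {F G H : ℝ × ℝ → ℝ} {s T R : ℝ} (hs : s < T) (hR : 1 < R)
    (hF : ContDiffOn ℝ 1 F (Icc (s, 1) (T, R))) (hG : ContDiffOn ℝ 1 G (Icc (s, 1) (T, R)))
    (hG1 : ∀ t ∈ Icc s T, G (t, 1) = 0) (hGR : ∀ t ∈ Icc s T, G (t, R) = 0)
    (hH : IntegrableOn H (Icc (s, 1) (T, R)))
    (hle : ∀ t ∈ Ioo s T, ∀ r ∈ Ioo 1 R,
      deriv (fun t => F (t, r)) t + deriv (fun r => G (t, r)) r ≤ H (t, r)) :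
    (∫ r in (1 : ℝ)..R, F (T, r)) - (∫ r in (1 : ℝ)..R, F (s, r))
      ≤ ∫ q in Icc (s, 1) (T, R), H q := by
  have hprod : Icc (s, (1 : ℝ)) (T, R) = Icc s T ×ˢ Icc 1 R := (Icc_prod_Icc _ _ _ _).symm
  have hU : UniqueDiffOn ℝ (Icc (s, (1 : ℝ)) (T, R)) := by
    rw [hprod]; exact (uniqueDiffOn_Icc hs).prod (uniqueDiffOn_Icc hR)
  have hnhds : ∀ x ∈ Ioo s T ×ˢ Ioo 1 R, Icc (s, (1 : ℝ)) (T, R) ∈ nhds x := by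
    rintro ⟨t, r⟩ ⟨ht, hr⟩
    rw [hprod]
    exact prod_mem_nhds (Icc_mem_nhds ht.1 ht.2) (Icc_mem_nhds hr.1 hr.2)
  have hderiv : ∀ {E : ℝ × ℝ → ℝ}, ContDiffOn ℝ 1 E (Icc (s, 1) (T, R)) →
      ∀ x ∈ Ioo s T ×ˢ Ioo 1 R,
        HasFDerivAt E (fderivWithin ℝ E (Icc (s, 1) (T, R)) x) x := fun hE x hx =>
    ((hE.differentiableOn one_ne_zero) x (mem_of_mem_nhds (hnhds x hx))).hasFDerivWithinAt.hasFDerivAt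
      (hnhds x hx)
  have hcont : ∀ {E : ℝ × ℝ → ℝ}, ContDiffOn ℝ 1 E (Icc (s, 1) (T, R)) →
      ∀ v, ContinuousOn (fun x => fderivWithin ℝ E (Icc (s, 1) (T, R)) x v)
        (Icc (s, 1) (T, R)) := fun hE v =>
    (hE.continuousOn_fderivWithin hU le_rfl).clm_apply continuousOn_const
  have hintegrable : IntegrableOn (fun x => fderivWithin ℝ F (Icc (s, 1) (T, R)) x (1, 0) +
      fderivWithin ℝ G (Icc (s, 1) (T, R)) x (0, 1)) (Icc (s, 1) (T, R)) :=
    ((hcont hF _).add (hcont hG _)).integrableOn_compact isCompact_Icc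
  have key := integral_divergence_prod_Icc_of_hasFDerivAt_of_le F G
    (fderivWithin ℝ F (Icc (s, 1) (T, R))) (fderivWithin ℝ G (Icc (s, 1) (T, R)))
    (s, 1) (T, R) ⟨hs.le, hR.le⟩ hF.continuousOn hG.continuousOn
    (hderiv hF) (hderiv hG) hintegrable
  have hz1 : ∫ t in s..T, G (t, 1) = 0 := by
    rw [intervalIntegral.integral_congr (g := fun _ => (0 : ℝ))]
    · simp
    · intro t ht; rw [uIcc_of_le hs.le] at ht; exact hG1 t ht
  have hzR : ∫ t in s..T, G (t, R) = 0 := by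
    rw [intervalIntegral.integral_congr (g := fun _ => (0 : ℝ))]
    · simp
    · intro t ht; rw [uIcc_of_le hs.le] at ht; exact hGR t ht
  simp only [hz1, hzR] at key
  have hmono : ∫ x in Icc (s, 1) (T, R), (fderivWithin ℝ F (Icc (s, 1) (T, R)) x (1, 0) +
      fderivWithin ℝ G (Icc (s, 1) (T, R)) x (0, 1)) ≤ ∫ q in Icc (s, 1) (T, R), H q := by
    have hae : (Icc (s, (1 : ℝ)) (T, R) : Set (ℝ × ℝ)) =ᵐ[volume] Ioo s T ×ˢ Ioo 1 R := by
      rw [hprod]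
      exact Measure.set_prod_ae_eq Ioo_ae_eq_Icc.symm Ioo_ae_eq_Icc.symm
    rw [setIntegral_congr_set hae, setIntegral_congr_set hae]
    have hsub : Ioo s T ×ˢ Ioo 1 R ⊆ Icc (s, (1 : ℝ)) (T, R) := fun x hx =>
      mem_of_mem_nhds (hnhds x hx)
    refine setIntegral_mono_on (hintegrable.mono_set hsub) (hH.mono_set hsub)
      (measurableSet_Ioo.prod measurableSet_Ioo) ?_
    rintro ⟨t, r⟩ hx
    have h1 := (hderiv hF _ hx).comp_hasDerivAt t
      ((hasDerivAt_id t).prodMk (hasDerivAt_const t r))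
    have h2 := (hderiv hG _ hx).comp_hasDerivAt r
      ((hasDerivAt_const r t).prodMk (hasDerivAt_id r))
    have := hle t hx.1 r hx.2
    rw [← h1.deriv, ← h2.deriv]
    exact this
  linarith

/-- The pointwise inequality behind the weighted energy estimate. -/
lemma weighted_energy_pointwise {ν a L Y R σ f ρ u p : ℝ} (hν : 0 < ν) (ha : 18 ≤ a) (hL : 0 ≤ L)
    (hf : 1 ≤ f) :
    (-(100 * ν * Y ^ 9 / (R * σ)) * f + Y ^ 10 * L) * u ^ 2
        - 2 * ν * a * Y ^ 10 * f * ρ ^ 2 * u ^ 2 - 2 * L * Y ^ 10 * f * u ^ 2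
        + 2 * ν * Y ^ 9 * (10 * f / R + 2 * Y * (3 * (f - 1)) * ρ) * u * p
        - 2 * ν * Y ^ 10 * f * p ^ 2
      ≤ -(L * Y ^ 10 * f * u ^ 2)
        + 100 * ν * f * u ^ 2 * (Y ^ 8 / R ^ 2 - Y ^ 9 / (R * σ)) := by
  have h1 : 0 ≤ L * Y ^ 10 * u ^ 2 * (f - 1) :=
    mul_nonneg (by positivity) (by linarith)
  have h2 : 0 ≤ 2 * ν * Y ^ 10 * f * ρ ^ 2 * u ^ 2 * (a - 18) :=
    mul_nonneg (by positivity) (by linarith)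
  have h3 : 2 * Y * (10 / R) * u * p * f ≤ Y ^ 2 * f * p ^ 2 + 100 * f / R ^ 2 * u ^ 2 := by
    have : 0 ≤ f * (Y * p - 10 / R * u) ^ 2 := by positivity
    have h : (10 / R) ^ 2 = 100 / R ^ 2 := by rw [div_pow]; norm_num
    calc _ = Y ^ 2 * f * p ^ 2 + f * (10 / R) ^ 2 * u ^ 2 - f * (Y * p - 10 / R * u) ^ 2 := by ring
      _ ≤ Y ^ 2 * f * p ^ 2 + f * (10 / R) ^ 2 * u ^ 2 := by linarith
      _ = _ := by rw [h]; ring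
  have h4 : 12 * Y ^ 2 * (f - 1) * ρ * u * p ≤ Y ^ 2 * f * p ^ 2 + 36 * Y ^ 2 * f * ρ ^ 2 * u ^ 2 := by
    have e1 : 0 ≤ Y ^ 2 * (f - 1) * (p - 6 * ρ * u) ^ 2 :=
      mul_nonneg (mul_nonneg (by positivity) (by linarith)) (by positivity)
    have e2 : 0 ≤ Y ^ 2 * p ^ 2 + 36 * Y ^ 2 * ρ ^ 2 * u ^ 2 := by positivity
    nlinarith
  have h5 := mul_le_mul_of_nonneg_left (add_le_add h3 h4) (show 0 ≤ ν * Y ^ 8 by positivity)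
  have e : (10 * f / R) = 10 / R * f := by ring
  have e' : 100 * f / R ^ 2 = 100 / R ^ 2 * f := by ring
  rw [e'] at h5
  rw [e, sub_eq_add_neg (Y ^ 8 / R ^ 2)]
  have e3 : Y ^ 8 / R ^ 2 = Y ^ 8 * (1 / R ^ 2) := by ring
  have e4 : 100 / R ^ 2 = 100 * (1 / R ^ 2) := by ring
  have e5 : 100 * ν * Y ^ 9 / (R * σ) = 100 * ν * (Y ^ 9 / (R * σ)) := by ring
  rw [e3, e5]; rw [e4] at h5
  linarith

/-- The error created by the moving cutoff is concentrated where `Y < σ / R`. -/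
lemma cutoff_error_le {Y R σ : ℝ} (hY : 0 ≤ Y) (hR : 0 < R) (hσ : 0 < σ) :
    Y ^ 8 / R ^ 2 - Y ^ 9 / (R * σ) ≤ if Y < σ / R then σ ^ 8 / R ^ 10 else 0 := by
  split_ifs with h
  · have h1 : Y ^ 8 ≤ (σ / R) ^ 8 := pow_le_pow_left₀ hY h.le 8
    have h2 : Y ^ 8 / R ^ 2 ≤ (σ / R) ^ 8 / R ^ 2 := by gcongr
    have h3 : (σ / R) ^ 8 / R ^ 2 = σ ^ 8 / R ^ 10 := by field_simp
    have h4 : 0 ≤ Y ^ 9 / (R * σ) := by positivity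
    linarith
  · push Not at h
    have h1 : σ ≤ Y * R := (div_le_iff₀ hR).1 h
    have : Y ^ 8 / R ^ 2 ≤ Y ^ 9 / (R * σ) := by
      rw [div_le_div_iff₀ (by positivity) (by positivity)]
      have := mul_le_mul_of_nonneg_left h1 (show 0 ≤ Y ^ 8 * R by positivity)
      nlinarith
    linarith

/-- The spatial cutoff, whose front moves inward with parabolic speed. -/
noncomputable def movingCutoff (ν R t r : ℝ) : ℝ := max (1 - (r + 20 * ν * √t) / R) 0

/-- The growing weight that exploits the damping. -/
noncomputable def dampingWeight (m t r : ℝ) : ℝ := 1 + m ^ 3 * t ^ 3 / (3 * r ^ 6)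

lemma movingCutoff_nonneg (ν R t r : ℝ) : 0 ≤ movingCutoff ν R t r := le_max_right _ _

lemma one_le_dampingWeight {m t : ℝ} (hm : 0 ≤ m) (ht : 0 ≤ t) (r : ℝ) :
    1 ≤ dampingWeight m t r := by
  unfold dampingWeight
  have : 0 ≤ m ^ 3 * t ^ 3 / (3 * r ^ 6) := by positivity
  linarith

lemma hasDerivAt_movingCutoff_pow_time {ν R t : ℝ} (ht : 0 < t) (r : ℝ) :
    HasDerivAt (fun t => movingCutoff ν R t r ^ 10)
      (-(100 * ν * movingCutoff ν R t r ^ 9 / (R * √t))) t := by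
  have h1 : HasDerivAt (fun t => 1 - (r + 20 * ν * √t) / R)
      (-((20 * ν * (1 / (2 * √t))) / R)) t :=
    ((((Real.hasDerivAt_sqrt ht.ne').const_mul (20 * ν)).const_add r).div_const R).const_sub 1
  have h2 := (hasDerivAt_max_zero_pow_ten (1 - (r + 20 * ν * √t) / R)).comp t h1
  refine h2.congr_deriv ?_
  unfold movingCutoff
  rw [mul_comm R, ← div_div]
  ring

lemma hasDerivAt_movingCutoff_pow_space (ν R t r : ℝ) :
    HasDerivAt (fun r => movingCutoff ν R t r ^ 10)
      (-(10 / R * movingCutoff ν R t r ^ 9)) r := by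
  have h1 : HasDerivAt (fun r => 1 - (r + 20 * ν * √t) / R) (-(1 / R)) r :=
    (((hasDerivAt_id r).add_const _).div_const R).const_sub 1
  have h2 := (hasDerivAt_max_zero_pow_ten (1 - (r + 20 * ν * √t) / R)).comp r h1
  refine h2.congr_deriv ?_
  unfold movingCutoff
  ring

lemma hasDerivAt_dampingWeight_time (m t r : ℝ) :
    HasDerivAt (fun t => dampingWeight m t r) (m ^ 3 * t ^ 2 / r ^ 6) t := by
  have h := ((((hasDerivAt_pow 3 t).const_mul (m ^ 3)).div_const (3 * r ^ 6)).const_add 1)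
  refine h.congr_deriv ?_
  rw [← div_div]
  push_cast
  ring

lemma hasDerivAt_dampingWeight_space (m t : ℝ) {r : ℝ} (hr : 0 < r) :
    HasDerivAt (fun r => dampingWeight m t r) (-(6 * (dampingWeight m t r - 1) / r)) r := by
  have h := ((((hasDerivAt_pow 6 r).const_mul 3).fun_inv (by positivity)).const_mul
    (m ^ 3 * t ^ 3)).const_add 1
  refine h.congr_deriv ?_
  unfold dampingWeight
  field_simp
  push_cast
  ring

lemma dampingWeight_lower_bound {m t r : ℝ} (hm : 0 ≤ m) (ht : 0 ≤ t) (hr : 0 < r) :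
    m ^ 5 / 3 * (t ^ 4 / r ^ 10) ≤ m ^ 3 * t ^ 2 / r ^ 6 * dampingWeight m t r := by
  have hx : 0 ≤ m * t / r ^ 2 := by positivity
  have key : ∀ x : ℝ, 0 ≤ x → x ^ 4 ≤ 3 * x ^ 2 + x ^ 5 := by
    intro x hx
    have : 0 ≤ x ^ 3 - x ^ 2 + 3 := by
      rcases le_total x 1 with h | h
      · nlinarith [pow_nonneg hx 3]
      · nlinarith [mul_nonneg (sq_nonneg x) (sub_nonneg.2 h)]
    nlinarith [mul_nonneg (sq_nonneg x) this]
  have := mul_le_mul_of_nonneg_left (key _ hx) (show 0 ≤ m / (3 * r ^ 2) by positivity)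
  calc _ = m / (3 * r ^ 2) * (m * t / r ^ 2) ^ 4 := by field_simp
    _ ≤ _ := this
    _ = _ := by unfold dampingWeight; field_simp

/-- Weighted energy estimate on a bounded rectangle for a real solution of the damped equation. -/
lemma damped_energy_estimate {ν a m T : ℝ} {u : ℝ × ℝ → ℝ} (hν : 0 < ν) (ha : 18 ≤ a)
    (hm : 0 ≤ m) (hu : ContDiffOn ℝ 2 u (Icc 0 T ×ˢ Ici 1))
    (heq : ∀ t ∈ Ioo 0 T, ∀ r ∈ Ioi (1 : ℝ),
      deriv (fun s => u (s, r)) t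
        = ν * (deriv (deriv (fun r => u (t, r))) r - a / r ^ 2 * u (t, r))
          - m ^ 3 * t ^ 2 / r ^ 6 * u (t, r))
    (hb : ∀ t ∈ Icc 0 T, u (t, 1) = 0) {s R : ℝ} (hs : 0 < s) (hsT : s < T) (hR : 1 < R) :
    m ^ 5 / 3 * ∫ q in Icc (s, 1) (T, R),
        movingCutoff ν R q.1 q.2 ^ 10 * (q.1 ^ 4 / q.2 ^ 10 * u q ^ 2)
      ≤ (∫ r in (1 : ℝ)..R, movingCutoff ν R s r ^ 10 * dampingWeight m s r * u (s, r) ^ 2)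
        + 100 * ν * (1 + m ^ 3 * T ^ 3 / 3) * ∫ q in Icc (s, 1) (T, R),
          {q : ℝ × ℝ | R - (20 * ν + 1) * √T < q.2}.indicator
            (fun q => q.1 ^ 4 / q.2 ^ 10 * u q ^ 2) q := by
  have hT : 0 < T := hs.trans hsT
  have hR0 : 0 < R := one_pos.trans hR
  have hprod : Icc (s, (1 : ℝ)) (T, R) = Icc s T ×ˢ Icc 1 R := (Icc_prod_Icc _ _ _ _).symm
  have hsub : Icc (s, (1 : ℝ)) (T, R) ⊆ Icc 0 T ×ˢ Ici 1 := by
    rw [hprod]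
    exact prod_mono (Icc_subset_Icc hs.le le_rfl) Icc_subset_Ici_self
  have hU : UniqueDiffOn ℝ (Icc 0 T ×ˢ Ici (1 : ℝ)) :=
    (uniqueDiffOn_Icc hT).prod (uniqueDiffOn_Ici 1)
  set p : ℝ × ℝ → ℝ := fun q => fderivWithin ℝ u (Icc 0 T ×ˢ Ici 1) q (0, 1) with hp
  have hpC : ContDiffOn ℝ 1 p (Icc 0 T ×ˢ Ici 1) :=
    (hu.fderivWithin hU (by norm_num)).clm_apply contDiffOn_const
  have hnhds : ∀ t ∈ Ioo 0 T, ∀ r ∈ Ioi (1 : ℝ), Icc 0 T ×ˢ Ici (1 : ℝ) ∈ nhds (t, r) :=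
    fun t ht r hr => prod_mem_nhds (Icc_mem_nhds ht.1 ht.2) (Ici_mem_nhds hr)
  have hur : ∀ t ∈ Ioo 0 T, ∀ r ∈ Ioi (1 : ℝ), HasDerivAt (fun r => u (t, r)) (p (t, r)) r := by
    intro t ht r hr
    have h := ((hu.differentiableOn two_ne_zero) (t, r)
      (mem_of_mem_nhds (hnhds t ht r hr))).hasFDerivWithinAt.hasFDerivAt (hnhds t ht r hr)
    exact h.comp_hasDerivAt r ((hasDerivAt_const r t).prodMk (hasDerivAt_id r))
  have hut : ∀ t ∈ Ioo 0 T, ∀ r ∈ Ioi (1 : ℝ),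
      HasDerivAt (fun t => u (t, r)) (deriv (fun t => u (t, r)) t) t := by
    intro t ht r hr
    have h := ((hu.contDiffAt (hnhds t ht r hr)).differentiableAt two_ne_zero).hasFDerivAt
    exact (h.comp_hasDerivAt t
      ((hasDerivAt_id t).prodMk (hasDerivAt_const t r))).differentiableAt.hasDerivAt
  have hpr : ∀ t ∈ Ioo 0 T, ∀ r ∈ Ioi (1 : ℝ),
      HasDerivAt (fun r => p (t, r)) (deriv (deriv (fun r => u (t, r))) r) r := by
    intro t ht r hr
    have h := ((hpC.contDiffAt (hnhds t ht r hr)).differentiableAt one_ne_zero).hasFDerivAt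
    have h1 := (h.comp_hasDerivAt r
      ((hasDerivAt_const r t).prodMk (hasDerivAt_id r))).differentiableAt.hasDerivAt
    have h2 : deriv (fun r => u (t, r)) =ᶠ[nhds r] fun r => p (t, r) := by
      filter_upwards [Ioi_mem_nhds hr] with z hz using (hur t ht z hz).deriv
    rw [h2.deriv_eq]
    exact h1
  have hpos : ∀ q ∈ Icc (s, (1 : ℝ)) (T, R), 0 < q.1 ∧ 0 < q.2 := by
    rw [hprod]
    exact fun q hq => ⟨hs.trans_le hq.1.1, one_pos.trans_le hq.2.1⟩
  have hsq : ContDiffOn ℝ 1 (fun q : ℝ × ℝ => √q.1) (Icc (s, (1 : ℝ)) (T, R)) :=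
    contDiffOn_fst.sqrt fun q hq => (hpos q hq).1.ne'
  have hΦ : ContDiffOn ℝ 1
      (fun q : ℝ × ℝ => movingCutoff ν R q.1 q.2 ^ 10 * dampingWeight m q.1 q.2)
      (Icc (s, (1 : ℝ)) (T, R)) := by
    refine ContDiffOn.mul ?_ ?_
    · exact contDiff_max_zero_pow_ten.comp_contDiffOn
        (contDiffOn_const.sub ((contDiffOn_snd.add (contDiffOn_const.mul hsq)).div_const R))
    · refine contDiffOn_const.add (ContDiffOn.div (by fun_prop) (by fun_prop) ?_)
      intro q hq
      have := (hpos q hq).2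
      positivity
  have hu1 : ContDiffOn ℝ 1 u (Icc (s, (1 : ℝ)) (T, R)) := (hu.mono hsub).of_le (by norm_num)
  have hp1 := hpC.mono hsub
  have hF : ContDiffOn ℝ 1 (fun q : ℝ × ℝ =>
      movingCutoff ν R q.1 q.2 ^ 10 * dampingWeight m q.1 q.2 * u q ^ 2)
      (Icc (s, (1 : ℝ)) (T, R)) := hΦ.mul (hu1.pow 2)
  have hG : ContDiffOn ℝ 1 (fun q : ℝ × ℝ =>
      movingCutoff ν R q.1 q.2 ^ 10 * dampingWeight m q.1 q.2 * (-(2 * ν) * (u q * p q)))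
      (Icc (s, (1 : ℝ)) (T, R)) := hΦ.mul (contDiffOn_const.mul (hu1.mul hp1))
  have hg : ContinuousOn (fun q : ℝ × ℝ => q.1 ^ 4 / q.2 ^ 10 * u q ^ 2)
      (Icc (s, (1 : ℝ)) (T, R)) := by
    refine ContinuousOn.mul (ContinuousOn.div (by fun_prop) (by fun_prop) ?_) (hu1.continuousOn.pow 2)
    intro q hq
    have := (hpos q hq).2
    positivity
  have hD : IntegrableOn (fun q : ℝ × ℝ =>
      movingCutoff ν R q.1 q.2 ^ 10 * (q.1 ^ 4 / q.2 ^ 10 * u q ^ 2))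
      (Icc (s, (1 : ℝ)) (T, R)) := by
    refine ContinuousOn.integrableOn_compact isCompact_Icc (ContinuousOn.mul ?_ hg)
    unfold movingCutoff
    fun_prop
  have hE : IntegrableOn ({q : ℝ × ℝ | R - (20 * ν + 1) * √T < q.2}.indicator
      (fun q => q.1 ^ 4 / q.2 ^ 10 * u q ^ 2)) (Icc (s, (1 : ℝ)) (T, R)) :=
    (hg.integrableOn_compact isCompact_Icc).indicator
      (measurableSet_lt measurable_const measurable_snd)
  have hH : IntegrableOn (fun q : ℝ × ℝ =>
      100 * ν * (1 + m ^ 3 * T ^ 3 / 3) * {q : ℝ × ℝ | R - (20 * ν + 1) * √T < q.2}.indicator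
            (fun q => q.1 ^ 4 / q.2 ^ 10 * u q ^ 2) q
        - m ^ 5 / 3 * (movingCutoff ν R q.1 q.2 ^ 10 * (q.1 ^ 4 / q.2 ^ 10 * u q ^ 2)))
      (Icc (s, (1 : ℝ)) (T, R)) := (hE.const_mul _).sub (hD.const_mul _)
  have key := integral_sub_le_of_divergence_le
      hsT hR hF hG ?_ ?_ hH ?_
  · rw [integral_sub (hE.const_mul _) (hD.const_mul _), integral_const_mul,
      integral_const_mul] at key
    have hnn : 0 ≤ ∫ r in (1 : ℝ)..R,
        movingCutoff ν R T r ^ 10 * dampingWeight m T r * u (T, r) ^ 2 :=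
      intervalIntegral.integral_nonneg hR.le fun r _ =>
        mul_nonneg (mul_nonneg (pow_nonneg (movingCutoff_nonneg _ _ _ _) _)
          (zero_le_one.trans (one_le_dampingWeight hm hT.le r))) (sq_nonneg _)
    linarith
  · intro t ht
    simp [hb t ⟨hs.le.trans ht.1, ht.2⟩]
  · intro t ht
    have : movingCutoff ν R t R = 0 := by
      refine max_eq_right ?_
      rw [add_div, div_self hR0.ne']
      have : 0 ≤ 20 * ν * √t / R := by positivity
      linarith
    simp [this]
  · intro t ht r hr
    have htT : t ∈ Ioo 0 T := ⟨hs.trans ht.1, ht.2⟩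
    have ht0 := htT.1
    have hr1 : r ∈ Ioi (1 : ℝ) := hr.1
    have hr0 : 0 < r := one_pos.trans hr.1
    have hσ : 0 < √t := Real.sqrt_pos.2 ht0
    have dF := (((hasDerivAt_movingCutoff_pow_time (ν := ν) (R := R) ht0 r).mul
      (hasDerivAt_dampingWeight_time m t r)).mul ((hut t htT r hr1).pow 2)).deriv
    have dG := (((hasDerivAt_movingCutoff_pow_space ν R t r).mul
      (hasDerivAt_dampingWeight_space m t hr0)).mul
        (((hur t htT r hr1).mul (hpr t htT r hr1)).const_mul (-(2 * ν)))).deriv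
    have h1 := weighted_energy_pointwise (L := m ^ 3 * t ^ 2 / r ^ 6)
      (Y := movingCutoff ν R t r) (R := R) (σ := √t) (f := dampingWeight m t r) (ρ := 1 / r)
      (u := u (t, r)) (p := p (t, r)) hν ha (by positivity) (one_le_dampingWeight hm ht0.le r)
    have h2 := cutoff_error_le (movingCutoff_nonneg ν R t r) hR0 hσ
    have h3 := mul_le_mul_of_nonneg_right (dampingWeight_lower_bound hm ht0.le hr0)
      (show 0 ≤ movingCutoff ν R t r ^ 10 * u (t, r) ^ 2 from
        mul_nonneg (pow_nonneg (movingCutoff_nonneg _ _ _ _) _) (sq_nonneg _))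
    have h4 : dampingWeight m t r ≤ 1 + m ^ 3 * T ^ 3 / 3 := by
      unfold dampingWeight
      have : t ^ 3 ≤ T ^ 3 := by gcongr; exact ht.2.le
      have h6 : (1 : ℝ) ≤ r ^ 6 := one_le_pow₀ hr.1.le
      gcongr
      linarith
    have h5 : 100 * ν * dampingWeight m t r * u (t, r) ^ 2 *
        (movingCutoff ν R t r ^ 8 / R ^ 2 - movingCutoff ν R t r ^ 9 / (R * √t)) ≤
        100 * ν * (1 + m ^ 3 * T ^ 3 / 3) *
          {q : ℝ × ℝ | R - (20 * ν + 1) * √T < q.2}.indicator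
            (fun q => q.1 ^ 4 / q.2 ^ 10 * u q ^ 2) (t, r) := by
      have hf0 := zero_le_one.trans (one_le_dampingWeight hm ht0.le r)
      have hind : 0 ≤ {q : ℝ × ℝ | R - (20 * ν + 1) * √T < q.2}.indicator
            (fun q => q.1 ^ 4 / q.2 ^ 10 * u q ^ 2) (t, r) := by
        refine indicator_nonneg (fun q _ => ?_) _
        have : 0 ≤ q.2 ^ 10 := Even.pow_nonneg (by decide) _
        positivity
      have hA : u (t, r) ^ 2 *
          (movingCutoff ν R t r ^ 8 / R ^ 2 - movingCutoff ν R t r ^ 9 / (R * √t)) ≤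
          {q : ℝ × ℝ | R - (20 * ν + 1) * √T < q.2}.indicator
            (fun q => q.1 ^ 4 / q.2 ^ 10 * u q ^ 2) (t, r) := by
        refine (mul_le_mul_of_nonneg_left h2 (sq_nonneg _)).trans ?_
        split_ifs with hY
        · have hmem : (t, r) ∈ {q : ℝ × ℝ | R - (20 * ν + 1) * √T < q.2} := by
            have hY' : 1 - (r + 20 * ν * √t) / R < √t / R := (le_max_left _ _).trans_lt hY
            have hmul := mul_lt_mul_of_pos_right hY' hR0
            rw [sub_mul, div_mul_cancel₀ _ hR0.ne', div_mul_cancel₀ _ hR0.ne'] at hmul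
            have hle : √t ≤ √T := Real.sqrt_le_sqrt ht.2.le
            have := mul_le_mul_of_nonneg_left hle (show 0 ≤ 20 * ν + 1 by positivity)
            rw [mem_ofPred_eq]
            linarith
          rw [indicator_of_mem hmem]
          have h8 : √t ^ 8 = t ^ 4 := by
            rw [show (8 : ℕ) = 2 * 4 from rfl, pow_mul, Real.sq_sqrt ht0.le]
          rw [h8, mul_comm]
          have : r ^ 10 ≤ R ^ 10 := by gcongr; exact hr.2.le
          have h10 : 0 < r ^ 10 := by positivity
          gcongr
        · rw [mul_zero]; exact hind
      calc _ = 100 * ν * dampingWeight m t r * (u (t, r) ^ 2 *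
          (movingCutoff ν R t r ^ 8 / R ^ 2 - movingCutoff ν R t r ^ 9 / (R * √t))) := by ring
        _ ≤ 100 * ν * dampingWeight m t r * _ :=
          mul_le_mul_of_nonneg_left hA (by positivity)
        _ ≤ _ := mul_le_mul_of_nonneg_right (by gcongr) hind
    refine (add_le_add dF.le dG.le).trans ?_
    simp only [Pi.mul_apply, Pi.pow_apply]
    rw [heq t htT r hr1]
    have h6 : m ^ 5 / 3 * (movingCutoff ν R t r ^ 10 * (t ^ 4 / r ^ 10 * u (t, r) ^ 2)) ≤
        m ^ 3 * t ^ 2 / r ^ 6 * movingCutoff ν R t r ^ 10 * dampingWeight m t r *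
          u (t, r) ^ 2 := by
      calc _ = m ^ 5 / 3 * (t ^ 4 / r ^ 10) * (movingCutoff ν R t r ^ 10 * u (t, r) ^ 2) := by
            ring
        _ ≤ _ := h3
        _ = _ := by ring
    refine le_trans (le_of_eq ?_)
      ((h1.trans (add_le_add (neg_le_neg h6) h5)).trans (le_of_eq ?_))
    · push_cast
      field_simp
      ring
    · ring

lemma tendsto_intervalIntegral_time_zero {F : ℝ × ℝ → ℝ} {T R : ℝ} (hT : 0 < T) (hR : 1 ≤ R)
    (hF : ContinuousOn F (Icc 0 T ×ˢ Icc 1 R)) :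
    Filter.Tendsto (fun s => ∫ r in (1 : ℝ)..R, F (s, r)) (nhdsWithin 0 (Ioi 0))
      (nhds (∫ r in (1 : ℝ)..R, F (0, r))) := by
  obtain ⟨M, hM⟩ := (isCompact_Icc.prod isCompact_Icc).exists_bound_of_continuousOn hF
  have hev : ∀ᶠ s in nhdsWithin (0 : ℝ) (Ioi 0), s ∈ Icc 0 T := by
    filter_upwards [Ioo_mem_nhdsGT hT] with s hs using Ioo_subset_Icc_self hs
  have hIoc : uIoc 1 R ⊆ Icc 1 R := by rw [uIoc_of_le hR]; exact Ioc_subset_Icc_self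
  refine intervalIntegral.tendsto_integral_filter_of_dominated_convergence (fun _ => M) ?_ ?_
    (by simp) ?_
  · filter_upwards [hev] with s hs
    refine ContinuousOn.aestronglyMeasurable ?_ measurableSet_uIoc
    exact hF.comp (by fun_prop) fun r hr => ⟨hs, hIoc hr⟩
  · filter_upwards [hev] with s hs
    exact Filter.Eventually.of_forall fun r hr => hM _ ⟨hs, hIoc hr⟩
  · refine Filter.Eventually.of_forall fun r hr => ?_
    have h0 : ((0 : ℝ), r) ∈ Icc 0 T ×ˢ Icc 1 R := ⟨⟨le_rfl, hT.le⟩, hIoc hr⟩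
    refine Filter.Tendsto.comp (hF _ h0) (tendsto_nhdsWithin_iff.2 ⟨?_, ?_⟩)
    · exact ((continuous_id.prodMk continuous_const).tendsto' (0 : ℝ) _ rfl).mono_left
        nhdsWithin_le_nhds
    · filter_upwards [hev] with s hs using ⟨hs, hIoc hr⟩

/-- Space-time bound for a real solution, assuming only that the left-hand side is finite. -/
lemma damped_spacetime_bound {ν a m T : ℝ} {u : ℝ × ℝ → ℝ} (hν : 0 < ν) (ha : 18 ≤ a)
    (hm : 0 ≤ m) (hT : 0 < T) (hu : ContDiffOn ℝ 2 u (Icc 0 T ×ˢ Ici 1))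
    (heq : ∀ t ∈ Ioo 0 T, ∀ r ∈ Ioi (1 : ℝ),
      deriv (fun s => u (s, r)) t
        = ν * (deriv (deriv (fun r => u (t, r))) r - a / r ^ 2 * u (t, r))
          - m ^ 3 * t ^ 2 / r ^ 6 * u (t, r))
    (hb : ∀ t ∈ Icc 0 T, u (t, 1) = 0)
    (hg : IntegrableOn (fun q : ℝ × ℝ => q.1 ^ 4 / q.2 ^ 10 * u q ^ 2) (Ioc 0 T ×ˢ Ioi 1))
    (h0 : IntegrableOn (fun r => u (0, r) ^ 2) (Ioi 1)) :
    m ^ 5 / 3 * ∫ q in Ioc 0 T ×ˢ Ioi 1, q.1 ^ 4 / q.2 ^ 10 * u q ^ 2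
      ≤ ∫ r in Ioi 1, u (0, r) ^ 2 := by
  set g : ℝ × ℝ → ℝ := fun q => q.1 ^ 4 / q.2 ^ 10 * u q ^ 2 with hgdef
  set N := ∫ r in Ioi 1, u (0, r) ^ 2 with hN
  set K := (20 * ν + 1) * √T with hK
  have hg0 : ∀ q, 0 ≤ g q := fun q => by
    have : 0 ≤ q.2 ^ 10 := Even.pow_nonneg (by decide) _
    simp only [hgdef]
    positivity
  have hΩ : MeasurableSet (Ioc 0 T ×ˢ Ioi (1 : ℝ)) := measurableSet_Ioc.prod measurableSet_Ioi
  have hs : ∀ n : ℕ, ∃ s, 0 < s ∧ s < T ∧ s < 1 / ((n : ℝ) + 1) ∧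
      (∫ r in (1 : ℝ)..(n + 2 : ℝ), movingCutoff ν (n + 2) s r ^ 10 * dampingWeight m s r *
        u (s, r) ^ 2) < N + 1 / ((n : ℝ) + 1) := by
    intro n
    have hR : (1 : ℝ) ≤ n + 2 := by linarith [(Nat.cast_nonneg n : (0 : ℝ) ≤ n)]
    have hn : 0 < 1 / ((n : ℝ) + 1) := by positivity
    have hF : ContinuousOn (fun q : ℝ × ℝ => movingCutoff ν (n + 2) q.1 q.2 ^ 10 *
        dampingWeight m q.1 q.2 * u q ^ 2) (Icc 0 T ×ˢ Icc 1 (n + 2 : ℝ)) := by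
      refine ContinuousOn.mul (ContinuousOn.mul ?_ ?_) ((hu.continuousOn.mono
        (prod_mono subset_rfl Icc_subset_Ici_self)).pow 2)
      · unfold movingCutoff
        fun_prop
      · unfold dampingWeight
        refine continuousOn_const.add (ContinuousOn.div (by fun_prop) (by fun_prop) ?_)
        intro q hq
        have : 0 < q.2 := one_pos.trans_le hq.2.1
        positivity
    have hlim := tendsto_intervalIntegral_time_zero hT hR hF
    have hle : ∫ r in (1 : ℝ)..(n + 2 : ℝ), movingCutoff ν (n + 2) 0 r ^ 10 *
        dampingWeight m 0 r * u (0, r) ^ 2 ≤ N := by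
      rw [intervalIntegral.integral_of_le hR, hN]
      refine (integral_mono_of_nonneg ?_ (h0.mono_set Ioc_subset_Ioi_self) ?_).trans
        (setIntegral_mono_set h0 (Filter.Eventually.of_forall fun r => sq_nonneg _)
          Ioc_subset_Ioi_self.eventuallyLE)
      · refine Filter.Eventually.of_forall fun r => ?_
        exact mul_nonneg (mul_nonneg (pow_nonneg (movingCutoff_nonneg _ _ _ _) _)
          (zero_le_one.trans (one_le_dampingWeight hm le_rfl r))) (sq_nonneg _)
      · filter_upwards [ae_restrict_mem measurableSet_Ioc] with r hr
        have h1 : dampingWeight m 0 r = 1 := by simp [dampingWeight]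
        have h2 : movingCutoff ν (n + 2) 0 r ≤ 1 := by
          refine max_le ?_ zero_le_one
          have : 0 ≤ r := zero_le_one.trans hr.1.le
          simp only [Real.sqrt_zero, mul_zero, add_zero, tsub_le_iff_right, le_add_iff_nonneg_right]
          positivity
        have h3 := pow_le_one₀ (n := 10) (movingCutoff_nonneg ν (n + 2) 0 r) h2
        rw [h1, mul_one]
        exact mul_le_of_le_one_left (sq_nonneg _) h3
    have hev := hlim.eventually (gt_mem_nhds (hle.trans_lt (lt_add_of_pos_right N hn)))
    obtain ⟨s, h1, h2, h3⟩ := (hev.and ((show ∀ᶠ s in nhdsWithin (0 : ℝ) (Ioi 0), s ∈ Ioo 0 T from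
      Ioo_mem_nhdsGT hT).and (show ∀ᶠ s in nhdsWithin (0 : ℝ) (Ioi 0), s ∈ Ioo 0 (1 / ((n : ℝ) + 1))
        from Ioo_mem_nhdsGT hn))).exists
    exact ⟨s, h2.1, h2.2, h3.2, h1⟩
  choose s hs0 hsT hsn hsE using hs
  set P : ℕ → Set (ℝ × ℝ) := fun n => Ioc (s n) T ×ˢ Ioc 1 ((n : ℝ) + 2) with hP
  have hPm : ∀ n, MeasurableSet (P n) := fun n => measurableSet_Ioc.prod measurableSet_Ioc
  have hPΩ : ∀ n, P n ⊆ Ioc 0 T ×ˢ Ioi 1 := fun n =>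
    prod_mono (Ioc_subset_Ioc_left (hs0 n).le) Ioc_subset_Ioi_self
  have hPae : ∀ n : ℕ, (Icc (s n, (1 : ℝ)) (T, (n : ℝ) + 2) : Set (ℝ × ℝ)) =ᵐ[volume] P n := by
    intro n
    rw [← Icc_prod_Icc]
    exact Measure.set_prod_ae_eq Ioc_ae_eq_Icc.symm Ioc_ae_eq_Icc.symm
  set S : ℕ → Set (ℝ × ℝ) := fun n => {q | (n : ℝ) + 2 - K < q.2} with hS
  have hSm : ∀ n, MeasurableSet (S n) := fun n => measurableSet_lt measurable_const measurable_snd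
  have hmain : ∀ n : ℕ, m ^ 5 / 3 * ∫ q in Ioc 0 T ×ˢ Ioi 1,
        (P n).indicator (fun q => movingCutoff ν (n + 2) q.1 q.2 ^ 10 * g q) q
      ≤ N + 1 / ((n : ℝ) + 1) + 100 * ν * (1 + m ^ 3 * T ^ 3 / 3) *
        ∫ q in Ioc 0 T ×ˢ Ioi 1, (S n).indicator g q := by
    intro n
    have hR : (1 : ℝ) < n + 2 := by linarith [(Nat.cast_nonneg n : (0 : ℝ) ≤ n)]
    have key := damped_energy_estimate hν ha hm hu heq hb (hs0 n) (hsT n) hR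
    rw [setIntegral_congr_set (hPae n), setIntegral_congr_set (hPae n)] at key
    rw [setIntegral_indicator (hPm n), inter_eq_self_of_subset_right (hPΩ n)]
    refine key.trans (add_le_add (hsE n).le (mul_le_mul_of_nonneg_left ?_ (by positivity)))
    exact setIntegral_mono_set (hg.indicator (hSm n))
      (Filter.Eventually.of_forall fun q => indicator_nonneg (fun q _ => hg0 q) q)
      (hPΩ n).eventuallyLE
  have hlimA : Filter.Tendsto (fun n : ℕ => ∫ q in Ioc 0 T ×ˢ Ioi 1,
        (P n).indicator (fun q => movingCutoff ν (n + 2) q.1 q.2 ^ 10 * g q) q) Filter.atTop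
      (nhds (∫ q in Ioc 0 T ×ˢ Ioi 1, g q)) := by
    refine tendsto_integral_of_dominated_convergence g ?_ hg ?_ ?_
    · intro n
      refine AEStronglyMeasurable.indicator (AEStronglyMeasurable.mul ?_ hg.1) (hPm n)
      refine Continuous.aestronglyMeasurable ?_
      unfold movingCutoff
      fun_prop
    · intro n
      filter_upwards [ae_restrict_mem hΩ] with q hq
      refine (norm_indicator_le_norm_self _ _).trans ?_
      have hc : movingCutoff ν (n + 2) q.1 q.2 ≤ 1 := by
        refine max_le ?_ zero_le_one
        have : 0 ≤ q.2 := zero_le_one.trans (le_of_lt hq.2)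
        have : 0 ≤ (q.2 + 20 * ν * √q.1) / ((n : ℝ) + 2) := by positivity
        linarith
      rw [Real.norm_of_nonneg (mul_nonneg (pow_nonneg (movingCutoff_nonneg _ _ _ _) _) (hg0 q))]
      exact mul_le_of_le_one_left (hg0 q) (pow_le_one₀ (movingCutoff_nonneg _ _ _ _) hc)
    · filter_upwards [ae_restrict_mem hΩ] with q hq
      have hmem : ∀ᶠ n : ℕ in Filter.atTop, q ∈ P n := by
        have h1 : ∀ᶠ n : ℕ in Filter.atTop, 1 / ((n : ℝ) + 1) < q.1 :=
          tendsto_one_div_add_atTop_nhds_zero_nat.eventually (gt_mem_nhds hq.1.1)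
        have h2 : ∀ᶠ n : ℕ in Filter.atTop, q.2 ≤ n :=
          tendsto_natCast_atTop_atTop.eventually (Filter.eventually_ge_atTop q.2)
        filter_upwards [h1, h2] with n hn1 hn2
        exact ⟨⟨(hsn n).trans hn1, hq.1.2⟩, hq.2, by linarith⟩
      have hinf : Filter.Tendsto (fun n : ℕ => (n : ℝ) + 2) Filter.atTop Filter.atTop :=
        Filter.tendsto_atTop_add_const_right _ _ tendsto_natCast_atTop_atTop
      have hcut : Filter.Tendsto (fun n : ℕ => movingCutoff ν (n + 2) q.1 q.2) Filter.atTop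
          (nhds 1) := by
        have h1 := ((tendsto_const_nhds (x := q.2 + 20 * ν * √q.1)).div_atTop hinf).const_sub 1
        simpa [movingCutoff] using h1.max (tendsto_const_nhds (x := (0 : ℝ)))
      have hlim : Filter.Tendsto (fun n : ℕ => movingCutoff ν (n + 2) q.1 q.2 ^ 10 * g q)
          Filter.atTop (nhds (g q)) := by
        simpa using (hcut.pow 10).mul_const (g q)
      refine hlim.congr' ?_
      filter_upwards [hmem] with n hn
      rw [indicator_of_mem hn]
  have hlimB : Filter.Tendsto (fun n : ℕ => ∫ q in Ioc 0 T ×ˢ Ioi 1, (S n).indicator g q)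
      Filter.atTop (nhds 0) := by
    have := tendsto_integral_of_dominated_convergence (μ := volume.restrict (Ioc 0 T ×ˢ Ioi 1))
      (F := fun n => (S n).indicator g) (f := fun _ => (0 : ℝ)) g
      (fun n => hg.1.indicator (hSm n)) hg
      (fun n => Filter.Eventually.of_forall fun q =>
        (norm_indicator_le_norm_self _ _).trans (Real.norm_of_nonneg (hg0 q)).le) ?_
    · simpa using this
    · refine Filter.Eventually.of_forall fun q => ?_
      refine tendsto_const_nhds.congr' ?_
      have h2 : ∀ᶠ n : ℕ in Filter.atTop, q.2 + K ≤ n :=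
        tendsto_natCast_atTop_atTop.eventually (Filter.eventually_ge_atTop _)
      filter_upwards [h2] with n hn
      rw [indicator_of_notMem]
      simp only [hS, mem_ofPred_eq, not_lt]
      linarith
  have hfin := le_of_tendsto_of_tendsto' (hlimA.const_mul (m ^ 5 / 3))
    ((tendsto_one_div_add_atTop_nhds_zero_nat.const_add N).add
      (hlimB.const_mul (100 * ν * (1 + m ^ 3 * T ^ 3 / 3)))) hmain
  simpa using hfin

/-- Real-linear functionals of a complex solution solve the real equation. -/
lemma damped_equation_clm {ν a T : ℝ} {w : ℝ → ℝ → ℂ} {V : ℝ → ℝ → ℝ} (ℓ : ℂ →L[ℝ] ℝ)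
    (hw : ContDiffOn ℝ 2 (fun q : ℝ × ℝ => w q.1 q.2) (Icc 0 T ×ˢ Ici 1))
    (heq : ∀ t ∈ Ioo (0 : ℝ) T, ∀ r ∈ Ioi (1 : ℝ),
      deriv (fun s => w s r) t
        - (ν : ℂ) * (deriv (deriv (w t)) r - ((a / r ^ 2 : ℝ) : ℂ) * w t r)
        + ((V t r : ℝ) : ℂ) * w t r = 0) :
    ∀ t ∈ Ioo 0 T, ∀ r ∈ Ioi (1 : ℝ),
      deriv (fun s => ℓ (w s r)) t
        = ν * (deriv (deriv (fun r => ℓ (w t r))) r - a / r ^ 2 * ℓ (w t r))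
          - V t r * ℓ (w t r) := by
  intro t ht r hr
  have hC : ∀ z ∈ Ioi (1 : ℝ), ContDiffAt ℝ 2 (fun q : ℝ × ℝ => w q.1 q.2) (t, z) :=
    fun z hz => hw.contDiffAt (prod_mem_nhds (Icc_mem_nhds ht.1 ht.2) (Ici_mem_nhds hz))
  have hspace : ∀ z ∈ Ioi (1 : ℝ), ContDiffAt ℝ 2 (w t) z := fun z hz =>
    (hC z hz).comp z (contDiffAt_const.prodMk contDiffAt_id)
  have htime : DifferentiableAt ℝ (fun s => w s r) t :=
    ((hC r hr).comp t (contDiffAt_id.prodMk contDiffAt_const)).differentiableAt two_ne_zero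
  have e1 : deriv (fun s => ℓ (w s r)) t = ℓ (deriv (fun s => w s r) t) :=
    (ℓ.hasFDerivAt.comp_hasDerivAt t htime.hasDerivAt).deriv
  have e2 : deriv (fun r => ℓ (w t r)) =ᶠ[nhds r] fun z => ℓ (deriv (w t) z) := by
    filter_upwards [Ioi_mem_nhds hr] with z hz
    exact (ℓ.hasFDerivAt.comp_hasDerivAt z
      ((hspace z hz).differentiableAt two_ne_zero).hasDerivAt).deriv
  have hd : DifferentiableAt ℝ (deriv (w t)) r := by
    have h := (hspace r hr).fderiv_right (m := 1) (by norm_num)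
    exact (h.clm_apply contDiffAt_const).differentiableAt one_ne_zero
  have e3 : deriv (deriv (fun r => ℓ (w t r))) r = ℓ (deriv (deriv (w t)) r) := by
    rw [e2.deriv_eq]
    exact (ℓ.hasFDerivAt.comp_hasDerivAt r hd.hasDerivAt).deriv
  have h := congrArg ℓ (heq t ht r hr)
  simp only [← Complex.real_smul, map_add, map_sub, map_smul, smul_eq_mul, map_zero] at h
  rw [e1, e3]
  linarith

lemma integrableOn_weighted_sq {T : ℝ} {u : ℝ × ℝ → ℝ} {G : ℝ → ℝ → ℝ}
    (hu : ContinuousOn u (Icc 0 T ×ˢ Ici 1))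
    (hslice : ∀ t ∈ Ioc 0 T, IntegrableOn (G t) (Ioi 1))
    (hle : ∀ t r, t ^ 4 / r ^ 10 * u (t, r) ^ 2 ≤ G t r)
    (hG : IntegrableOn (fun t => ∫ r in Ioi 1, G t r) (Ioc 0 T)) :
    IntegrableOn (fun q : ℝ × ℝ => q.1 ^ 4 / q.2 ^ 10 * u q ^ 2) (Ioc 0 T ×ˢ Ioi 1) := by
  have hg0 : ∀ t r, 0 ≤ t ^ 4 / r ^ 10 * u (t, r) ^ 2 := fun t r => by
    have : 0 ≤ r ^ 10 := Even.pow_nonneg (by decide) _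
    positivity
  have hcont : ContinuousOn (fun q : ℝ × ℝ => q.1 ^ 4 / q.2 ^ 10 * u q ^ 2)
      (Ioc 0 T ×ˢ Ioi 1) := by
    refine ContinuousOn.mul (ContinuousOn.div (by fun_prop) (by fun_prop) ?_)
      ((hu.mono (prod_mono Ioc_subset_Icc_self Ioi_subset_Ici_self)).pow 2)
    intro q hq
    have : 0 < q.2 := one_pos.trans hq.2
    positivity
  have hmeas := hcont.aestronglyMeasurable (μ := volume)
    (measurableSet_Ioc.prod measurableSet_Ioi)
  rw [Measure.volume_eq_prod, ← Measure.prod_restrict] at hmeas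
  rw [IntegrableOn, Measure.volume_eq_prod, ← Measure.prod_restrict]
  have hsl : ∀ t ∈ Ioc 0 T, IntegrableOn (fun r => t ^ 4 / r ^ 10 * u (t, r) ^ 2) (Ioi 1) := by
    intro t ht
    refine (hslice t ht).mono' ?_ ?_
    · exact (hcont.comp (by fun_prop : ContinuousOn (fun r : ℝ => (t, r)) (Ioi 1))
        fun r hr => ⟨ht, hr⟩).aestronglyMeasurable measurableSet_Ioi
    · exact Filter.Eventually.of_forall fun r =>
        (Real.norm_of_nonneg (hg0 t r)).le.trans (hle t r)
  refine (integrable_prod_iff hmeas).2 ⟨?_, ?_⟩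
  · filter_upwards [ae_restrict_mem measurableSet_Ioc] with t ht using hsl t ht
  · refine hG.mono' hmeas.norm.integral_prod_right' ?_
    filter_upwards [ae_restrict_mem measurableSet_Ioc] with t ht
    rw [Real.norm_of_nonneg (integral_nonneg fun r => norm_nonneg _)]
    refine integral_mono (hsl t ht).norm (hslice t ht) fun r => ?_
    exact (Real.norm_of_nonneg (hg0 t r)).le.trans (hle t r)


lemma integrable_clm_sq {v : ℝ → ℂ} (ℓ : ℂ →L[ℝ] ℝ) (hℓ : ∀ z, |ℓ z| ≤ ‖z‖)
    (hv : ContinuousOn v (Ioi 1)) (hi : Integrable (fun r => ‖v r‖ ^ 2) (volume.restrict (Ioi 1))) :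
    IntegrableOn (fun r => ℓ (v r) ^ 2) (Ioi 1) := by
  refine hi.mono' (ContinuousOn.aestronglyMeasurable (by fun_prop) measurableSet_Ioi) ?_
  refine Filter.Eventually.of_forall fun r => ?_
  rw [Real.norm_of_nonneg (sq_nonneg _), ← sq_abs]
  exact pow_le_pow_left₀ (abs_nonneg _) (hℓ _) 2

/-- Lemma 2.8: for the damped equation
`∂_t w − ν(∂_r²w − (k²+Θ²)r⁻²w) + ν(2kBt/r³)² w = 0` with `Θ ≥ 10⁹`:
`ν^{5/6}|kB|^{5/3} ‖(t²/r⁵)w‖_{L²((0,T);L²_r)} ≤ C‖w₀‖_{L²_r}`. -/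
theorem stmt_11 :
    ∃ ε C : ℝ, 0 < ε ∧ 0 < C ∧
      ∀ (Θ : ℝ) (k : ℤ) (ν B T : ℝ) (w : ℝ → ℝ → ℂ) (w₀ : ℝ → ℂ),
        (10 : ℝ) ^ 9 ≤ Θ → k ≠ 0 → 0 < ν → ν ≤ ε * |(k : ℝ) * B| → 0 < T →
        ContDiffOn ℝ (⊤ : ℕ∞) (fun q : ℝ × ℝ => w q.1 q.2) (Icc 0 T ×ˢ Ici 1) →
        (∀ t ∈ Ioo (0 : ℝ) T, ∀ r ∈ Ioi (1 : ℝ),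
            deriv (fun s => w s r) t
              - (ν : ℂ) * (deriv (deriv (w t)) r
                  - ((((k : ℝ) ^ 2 + Θ ^ 2) / r ^ 2 : ℝ) : ℂ) * w t r)
              + ((ν * (2 * (k : ℝ) * B * t / r ^ 3) ^ 2 : ℝ) : ℂ) * w t r = 0) →
        (∀ r ∈ Ici (1 : ℝ), w 0 r = w₀ r) →
        (∀ t ∈ Icc (0 : ℝ) T, w t 1 = 0) →
        (∀ t ∈ Icc (0 : ℝ) T,
            Integrable (fun r => ‖w t r‖ ^ 2) (volume.restrict (Ioi 1)) ∧
            Integrable (fun r => ‖deriv (w t) r‖ ^ 2) (volume.restrict (Ioi 1)) ∧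
            Filter.Tendsto (w t) Filter.atTop (nhds 0)) →
        Integrable (fun r => ‖w₀ r‖ ^ 2) (volume.restrict (Ioi 1)) →
        ν ^ ((5 : ℝ) / 6) * |(k : ℝ) * B| ^ ((5 : ℝ) / 3)
            * Real.sqrt (∫ t in Ioc (0 : ℝ) T, ∫ r in Ioi (1 : ℝ),
                (t ^ 2 / r ^ 5 * ‖w t r‖) ^ 2)
          ≤ C * Real.sqrt (∫ r in Ioi (1 : ℝ), ‖w₀ r‖ ^ 2) := by
  refine ⟨1, 2, one_pos, two_pos, ?_⟩
  intro Θ k ν B T w w₀ hΘ _ hν _ hT hw heq h0 hb hL2 hw0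
  set m : ℝ := (ν * (2 * (k : ℝ) * B) ^ 2) ^ ((1 : ℝ) / 3) with hm
  set J : ℝ → ℝ := fun t => ∫ r in Ioi (1 : ℝ), (t ^ 2 / r ^ 5 * ‖w t r‖) ^ 2 with hJ
  have hm0 : 0 ≤ m := by positivity
  have hm3 : m ^ 3 = ν * (2 * (k : ℝ) * B) ^ 2 := by
    rw [hm, ← Real.rpow_natCast, ← Real.rpow_mul (by positivity)]
    norm_num
  by_cases hJi : IntegrableOn J (Ioc 0 T)
  swap
  · rw [integral_undef hJi, Real.sqrt_zero, mul_zero]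
    positivity
  have ha : 18 ≤ (k : ℝ) ^ 2 + Θ ^ 2 := by nlinarith [sq_nonneg (k : ℝ)]
  have hw2 : ContDiffOn ℝ 2 (fun q : ℝ × ℝ => w q.1 q.2) (Icc 0 T ×ˢ Ici 1) :=
    hw.of_le (WithTop.coe_le_coe.2 (le_top : (2 : ℕ∞) ≤ ⊤))
  have hwt : ∀ t ∈ Icc 0 T, ContinuousOn (w t) (Ioi 1) := fun t ht =>
    hw2.continuousOn.comp (by fun_prop : ContinuousOn (fun r : ℝ => (t, r)) (Ioi 1))
      fun r hr => ⟨ht, Ioi_subset_Ici_self hr⟩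
  have h0T : (0 : ℝ) ∈ Icc 0 T := ⟨le_rfl, hT.le⟩
  have hslice : ∀ t ∈ Ioc 0 T,
      IntegrableOn (fun r => (t ^ 2 / r ^ 5 * ‖w t r‖) ^ 2) (Ioi 1) := by
    intro t ht
    have htI := Ioc_subset_Icc_self ht
    refine ((hL2 t htI).1.const_mul (t ^ 4)).mono' ?_ ?_
    · refine ContinuousOn.aestronglyMeasurable ?_ measurableSet_Ioi
      refine ContinuousOn.pow (ContinuousOn.mul (ContinuousOn.div (by fun_prop) (by fun_prop) ?_)
        (hwt t htI).norm) 2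
      intro r hr
      exact (pow_pos (one_pos.trans hr) 5).ne'
    · filter_upwards [ae_restrict_mem measurableSet_Ioi] with r hr
      have h1 : t ^ 2 / r ^ 5 ≤ t ^ 2 := div_le_self (sq_nonneg t) (one_le_pow₀ (le_of_lt hr))
      have h2 : 0 ≤ t ^ 2 / r ^ 5 :=
        div_nonneg (sq_nonneg t) (pow_nonneg (zero_le_one.trans (le_of_lt hr)) 5)
      rw [Real.norm_of_nonneg (sq_nonneg _), mul_pow]
      refine mul_le_mul_of_nonneg_right ((pow_le_pow_left₀ h2 h1 2).trans_eq ?_) (sq_nonneg _)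
      ring
  have hbound : ∀ ℓ : ℂ →L[ℝ] ℝ, (∀ z, |ℓ z| ≤ ‖z‖) →
      IntegrableOn (fun q : ℝ × ℝ => q.1 ^ 4 / q.2 ^ 10 * ℓ (w q.1 q.2) ^ 2)
        (Ioc 0 T ×ˢ Ioi 1) ∧
      m ^ 5 / 3 * ∫ q in Ioc 0 T ×ˢ Ioi 1, q.1 ^ 4 / q.2 ^ 10 * ℓ (w q.1 q.2) ^ 2
        ≤ ∫ r in Ioi 1, ℓ (w 0 r) ^ 2 := by
    intro ℓ hℓ
    have hu : ContDiffOn ℝ 2 (fun q : ℝ × ℝ => ℓ (w q.1 q.2)) (Icc 0 T ×ˢ Ici 1) :=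
      ℓ.contDiff.comp_contDiffOn hw2
    have hintegrable := integrableOn_weighted_sq hu.continuousOn hslice (fun t r => by
      rw [mul_pow, div_pow, ← pow_mul, ← pow_mul, ← sq_abs (ℓ _)]
      have h10 : 0 ≤ r ^ 10 := Even.pow_nonneg (by decide) _
      have := hℓ (w t r)
      gcongr) hJi
    refine ⟨hintegrable, damped_spacetime_bound hν ha hm0 hT hu ?_ ?_ hintegrable ?_⟩
    · intro t ht r hr
      have h := damped_equation_clm ℓ hw2 heq t ht r hr
      rw [h, hm3]
      field_simp
    · intro t ht
      simp [hb t ht]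
    · exact integrable_clm_sq ℓ hℓ (hwt 0 h0T) (hL2 0 h0T).1
  obtain ⟨ire, hre⟩ := hbound Complex.reCLM Complex.abs_re_le_norm
  obtain ⟨iim, him⟩ := hbound Complex.imCLM Complex.abs_im_le_norm
  have hnorm : ∀ z : ℂ, ‖z‖ ^ 2 = Complex.reCLM z ^ 2 + Complex.imCLM z ^ 2 := fun z => by
    rw [Complex.sq_norm, Complex.normSq_apply, Complex.reCLM_apply, Complex.imCLM_apply]
    ring
  set X := ∫ t in Ioc (0 : ℝ) T, J t with hX
  set N := ∫ r in Ioi (1 : ℝ), ‖w₀ r‖ ^ 2 with hN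
  have hN0 : 0 ≤ N := integral_nonneg fun r => sq_nonneg _
  have hX0 : 0 ≤ X := integral_nonneg fun t => integral_nonneg fun r => sq_nonneg _
  have hNsum : N = (∫ r in Ioi 1, Complex.reCLM (w 0 r) ^ 2) +
      ∫ r in Ioi 1, Complex.imCLM (w 0 r) ^ 2 := by
    rw [← integral_add
      (integrable_clm_sq _ Complex.abs_re_le_norm (hwt 0 h0T) (hL2 0 h0T).1)
      (integrable_clm_sq _ Complex.abs_im_le_norm (hwt 0 h0T) (hL2 0 h0T).1)]
    refine setIntegral_congr_fun measurableSet_Ioi fun r hr => ?_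
    rw [← h0 r (Ioi_subset_Ici_self hr), hnorm]
  have hXsum : X = (∫ q in Ioc 0 T ×ˢ Ioi 1, q.1 ^ 4 / q.2 ^ 10 *
      Complex.reCLM (w q.1 q.2) ^ 2) +
      ∫ q in Ioc 0 T ×ˢ Ioi 1, q.1 ^ 4 / q.2 ^ 10 * Complex.imCLM (w q.1 q.2) ^ 2 := by
    have hsum := ire.add iim
    rw [← integral_add ire iim, Measure.volume_eq_prod]
    rw [Measure.volume_eq_prod] at hsum
    refine Eq.trans ?_ (setIntegral_prod _ hsum).symm
    refine integral_congr_ae (Filter.Eventually.of_forall fun t => ?_)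
    refine integral_congr_ae (Filter.Eventually.of_forall fun r => ?_)
    simp only [Pi.add_apply]
    rw [mul_pow, hnorm]
    ring
  have hmX : m ^ 5 * X ≤ 3 * N := by
    rw [hXsum, hNsum]
    linarith
  set A := ν ^ ((5 : ℝ) / 6) * |(k : ℝ) * B| ^ ((5 : ℝ) / 3) with hA
  have hA0 : 0 ≤ A := by positivity
  have hAm : A ^ 2 ≤ m ^ 5 := by
    have hA2 : A ^ 2 = (ν * ((k : ℝ) * B) ^ 2) ^ ((5 : ℝ) / 3) := by
      rw [Real.mul_rpow hν.le (sq_nonneg _), ← sq_abs ((k : ℝ) * B), hA, mul_pow,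
        ← Real.rpow_natCast, ← Real.rpow_natCast, ← Real.rpow_natCast,
        ← Real.rpow_mul hν.le, ← Real.rpow_mul (abs_nonneg _), ← Real.rpow_mul (abs_nonneg _)]
      norm_num
    have hm5 : m ^ 5 = (ν * (2 * (k : ℝ) * B) ^ 2) ^ ((5 : ℝ) / 3) := by
      rw [hm, ← Real.rpow_natCast, ← Real.rpow_mul (by positivity)]
      norm_num
    rw [hA2, hm5]
    refine Real.rpow_le_rpow (by positivity) ?_ (by norm_num)
    exact mul_le_mul_of_nonneg_left (by nlinarith [sq_nonneg ((k : ℝ) * B)]) hν.le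
  refine abs_le_of_sq_le_sq' ?_ (by positivity) |>.2
  rw [mul_pow A, mul_pow 2, Real.sq_sqrt hX0, Real.sq_sqrt hN0]
  nlinarith [mul_le_mul_of_nonneg_right hAm hX0]
end

section
/- There exist constants ε > 0 and C > 0 such that the following holds. Let k be a nonzero integer, ν > 0 with ν ≤ ε|k|, and λ ∈ ℝ. Let w ∈ H²((0,1)) ∩ H¹₀((0,1)) be complex-valued and set F(y) = −ν( w''(y) − k² w(y) ) + i k (y − λ) w(y) for y ∈ (0,1). Then (ν k²)^{1/3} ‖w‖_{L²(0,1)} ≤ C ‖F‖_{L²(0,1)}. -/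
open MeasureTheory Set

lemma abs_intervalIntegral_le_sqrt_mul_sqrt {f G H : ℝ → ℝ} (hf : Continuous f)
    (hG : Continuous G) (hH : Continuous H) (hG0 : ∀ y, 0 ≤ G y) (hH0 : ∀ y, 0 ≤ H y)
    (h : ∀ y, f y ^ 2 ≤ G y * H y) :
    |∫ y in (0 : ℝ)..1, f y|
      ≤ Real.sqrt (∫ y in (0 : ℝ)..1, G y) * Real.sqrt (∫ y in (0 : ℝ)..1, H y) := by
  have key : ∀ t : ℝ, 0 ≤ (∫ y in (0 : ℝ)..1, G y) * (t * t)
      + (2 * ∫ y in (0 : ℝ)..1, f y) * t + ∫ y in (0 : ℝ)..1, H y := by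
    intro t
    have e : (∫ y in (0 : ℝ)..1, (G y * (t * t) + 2 * f y * t + H y))
        = (∫ y in (0 : ℝ)..1, G y) * (t * t)
          + (2 * ∫ y in (0 : ℝ)..1, f y) * t + ∫ y in (0 : ℝ)..1, H y := by
      rw [intervalIntegral.integral_add, intervalIntegral.integral_add,
        intervalIntegral.integral_mul_const, intervalIntegral.integral_mul_const,
        intervalIntegral.integral_const_mul]
      all_goals exact Continuous.intervalIntegrable (by fun_prop) _ _
    rw [← e]
    refine intervalIntegral.integral_nonneg zero_le_one fun y _ => ?_
    rcases (hG0 y).eq_or_lt with h0 | h0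
    · have h1 := h y
      rw [← h0, zero_mul] at h1
      have h2 : f y = 0 := by nlinarith
      rw [← h0, h2]
      simpa using hH0 y
    · have h1 := h y
      have h2 : 0 ≤ G y * (G y * (t * t) + 2 * f y * t + H y) := by
        nlinarith [sq_nonneg (G y * t + f y)]
      exact nonneg_of_mul_nonneg_right h2 h0
  have hd := discrim_le_zero key
  rw [discrim] at hd
  rw [← Real.sqrt_mul (intervalIntegral.integral_nonneg zero_le_one fun y _ => hG0 y)]
  exact Real.abs_le_sqrt (by nlinarith)

lemma cube_le_of_energy_bounds {a b c f ν K : ℝ} (ha : 0 ≤ a) (hc : 0 ≤ c)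
    (hf : 0 ≤ f) (hν : 0 < ν) (hK : 0 < K) (h1 : ν * b ^ 2 ≤ f * a)
    (h2 : K * c ^ 2 ≤ f * c + ν * (b * a)) (h3 : a ^ 2 ≤ 2 * (c * b)) :
    ν * K ^ 2 * a ^ 3 ≤ 64 * f ^ 3 := by
  rcases ha.eq_or_lt with rfl | ha
  · simp; positivity
  have h4 : a ^ 4 ≤ 4 * (c ^ 2 * b ^ 2) := by
    calc a ^ 4 = (a ^ 2) ^ 2 := by ring
      _ ≤ (2 * (c * b)) ^ 2 := by gcongr
      _ = _ := by ring
  rcases le_total (ν * (b * a)) (f * c) with h | h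
  · have h5 : K * c ≤ 2 * f := by
      rcases hc.eq_or_lt with rfl | hc
      · simp; positivity
      · exact le_of_mul_le_mul_right (by nlinarith) hc
    refine le_of_mul_le_mul_right ?_ ha
    calc ν * K ^ 2 * a ^ 3 * a = ν * K ^ 2 * a ^ 4 := by ring
      _ ≤ ν * K ^ 2 * (4 * (c ^ 2 * b ^ 2)) := by gcongr
      _ = 4 * ((K * c) ^ 2 * (ν * b ^ 2)) := by ring
      _ ≤ 4 * ((2 * f) ^ 2 * (f * a)) := by gcongr
      _ ≤ 64 * f ^ 3 * a := by nlinarith [mul_nonneg (pow_nonneg hf 3) ha.le]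
  · have h5 : K * c ^ 2 ≤ 2 * (ν * (b * a)) := by linarith
    have h6 : K * a ^ 3 ≤ 8 * (ν * b ^ 3) := by
      refine le_of_mul_le_mul_right ?_ ha
      calc K * a ^ 3 * a = K * a ^ 4 := by ring
        _ ≤ K * (4 * (c ^ 2 * b ^ 2)) := by gcongr
        _ = 4 * ((K * c ^ 2) * b ^ 2) := by ring
        _ ≤ 4 * ((2 * (ν * (b * a))) * b ^ 2) := by gcongr
        _ = _ := by ring
    refine le_of_mul_le_mul_right ?_ (pow_pos ha 3)
    calc ν * K ^ 2 * a ^ 3 * a ^ 3 = ν * (K * a ^ 3) ^ 2 := by ring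
      _ ≤ ν * (8 * (ν * b ^ 3)) ^ 2 := by gcongr
      _ = 64 * (ν * b ^ 2) ^ 3 := by ring
      _ ≤ 64 * (f * a) ^ 3 := by gcongr
      _ = _ := by ring

lemma intervalIntegral_eq_zero_of_hasDerivAt {g g' : ℝ → ℝ} (h : ∀ y, HasDerivAt g (g' y) y)
    (hc : Continuous g') (h0 : g 0 = 0) (h1 : g 1 = 0) : ∫ y in (0 : ℝ)..1, g' y = 0 := by
  rw [intervalIntegral.integral_eq_sub_of_hasDerivAt (fun y _ => h y) (hc.intervalIntegrable _ _),
    h0, h1, sub_zero]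

/-- The resolvent estimate in cubed form, with `w = a + i b` and `F = P + i Q`. -/
lemma couette_resolvent_cube {a b a₁ b₁ a₂ b₂ P Q : ℝ → ℝ} {k ν l : ℝ}
    (ha : ∀ y, HasDerivAt a (a₁ y) y) (hb : ∀ y, HasDerivAt b (b₁ y) y)
    (ha₁ : ∀ y, HasDerivAt a₁ (a₂ y) y) (hb₁ : ∀ y, HasDerivAt b₁ (b₂ y) y)
    (ha₂ : Continuous a₂) (hb₂ : Continuous b₂) (hk : k ≠ 0) (hν : 0 < ν)
    (a0 : a 0 = 0) (a1 : a 1 = 0) (b0 : b 0 = 0) (b1 : b 1 = 0)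
    (hP : ∀ y, P y = -ν * (a₂ y - k ^ 2 * a y) - k * (y - l) * b y)
    (hQ : ∀ y, Q y = -ν * (b₂ y - k ^ 2 * b y) + k * (y - l) * a y) :
    ν * |k| ^ 2 * Real.sqrt (∫ y in (0 : ℝ)..1, (a y ^ 2 + b y ^ 2)) ^ 3
      ≤ 64 * Real.sqrt (∫ y in (0 : ℝ)..1, (P y ^ 2 + Q y ^ 2)) ^ 3 := by
  have ca : Continuous a := continuous_iff_continuousAt.2 fun y => (ha y).continuousAt
  have cb : Continuous b := continuous_iff_continuousAt.2 fun y => (hb y).continuousAt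
  have ca₁ : Continuous a₁ := continuous_iff_continuousAt.2 fun y => (ha₁ y).continuousAt
  have cb₁ : Continuous b₁ := continuous_iff_continuousAt.2 fun y => (hb₁ y).continuousAt
  have cP : Continuous P := by rw [funext hP]; fun_prop
  have cQ : Continuous Q := by rw [funext hQ]; fun_prop
  have nn : ∀ f : ℝ → ℝ, (∀ y, 0 ≤ f y) → 0 ≤ ∫ y in (0 : ℝ)..1, f y := fun f hf =>
    intervalIntegral.integral_nonneg zero_le_one fun y _ => hf y
  have nA := nn (fun y => a y ^ 2 + b y ^ 2) (fun y => by positivity)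
  have nB := nn (fun y => a₁ y ^ 2 + b₁ y ^ 2) (fun y => by positivity)
  have nC := nn (fun y => (y - l) ^ 2 * (a y ^ 2 + b y ^ 2)) (fun y => by positivity)
  have E1 : ∫ y in (0 : ℝ)..1,
      (a₁ y ^ 2 + b₁ y ^ 2 + (a₂ y * a y + b₂ y * b y)) = 0 := by
    refine intervalIntegral_eq_zero_of_hasDerivAt (g := fun y => a₁ y * a y + b₁ y * b y)
      (fun y => ?_) (by fun_prop) (by simp [a0, b0]) (by simp [a1, b1])
    exact (((ha₁ y).mul (ha y)).add ((hb₁ y).mul (hb y))).congr_deriv (by ring)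
  have E2 : ∫ y in (0 : ℝ)..1,
      ((b₁ y * a y - a₁ y * b y) + (y - l) * (b₂ y * a y - a₂ y * b y)) = 0 := by
    refine intervalIntegral_eq_zero_of_hasDerivAt
      (g := fun y => (y - l) * (b₁ y * a y - a₁ y * b y))
      (fun y => ?_) (by fun_prop) (by simp [a0, b0]) (by simp [a1, b1])
    exact (((hasDerivAt_id y).sub_const l).mul
      (((hb₁ y).mul (ha y)).sub ((ha₁ y).mul (hb y)))).congr_deriv (by
        simp only [id, Pi.sub_apply, Pi.mul_apply]
        ring)
  have E3 : ∫ y in (0 : ℝ)..1,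
      ((a y ^ 2 + b y ^ 2) + 2 * ((y - l) * (a₁ y * a y + b₁ y * b y))) = 0 := by
    refine intervalIntegral_eq_zero_of_hasDerivAt
      (g := fun y => (y - l) * (a y * a y + b y * b y))
      (fun y => ?_) (by fun_prop) (by simp [a0, b0]) (by simp [a1, b1])
    exact (((hasDerivAt_id y).sub_const l).mul
      (((ha y).mul (ha y)).add ((hb y).mul (hb y)))).congr_deriv (by
        simp only [id, Pi.add_apply, Pi.mul_apply]
        ring)
  have F1 : ∫ y in (0 : ℝ)..1, (P y * a y + Q y * b y)
      = ν * (∫ y in (0 : ℝ)..1, (a₁ y ^ 2 + b₁ y ^ 2))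
        + ν * k ^ 2 * ∫ y in (0 : ℝ)..1, (a y ^ 2 + b y ^ 2) := by
    have e : ∀ y, P y * a y + Q y * b y = ν * (a₁ y ^ 2 + b₁ y ^ 2)
        + ν * k ^ 2 * (a y ^ 2 + b y ^ 2)
        - ν * (a₁ y ^ 2 + b₁ y ^ 2 + (a₂ y * a y + b₂ y * b y)) := fun y => by
      rw [hP, hQ]; ring
    simp_rw [e]
    rw [intervalIntegral.integral_sub, intervalIntegral.integral_add,
      intervalIntegral.integral_const_mul, intervalIntegral.integral_const_mul,
      intervalIntegral.integral_const_mul, E1, mul_zero, sub_zero]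
    all_goals exact Continuous.intervalIntegrable (by fun_prop) _ _
  have F2 : ∫ y in (0 : ℝ)..1, ((y - l) * (Q y * a y - P y * b y))
      = ν * (∫ y in (0 : ℝ)..1, (b₁ y * a y - a₁ y * b y))
        + k * ∫ y in (0 : ℝ)..1, ((y - l) ^ 2 * (a y ^ 2 + b y ^ 2)) := by
    have e : ∀ y, (y - l) * (Q y * a y - P y * b y) = ν * (b₁ y * a y - a₁ y * b y)
        + k * ((y - l) ^ 2 * (a y ^ 2 + b y ^ 2))
        - ν * ((b₁ y * a y - a₁ y * b y) + (y - l) * (b₂ y * a y - a₂ y * b y)) := fun y => by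
      rw [hP, hQ]; ring
    simp_rw [e]
    rw [intervalIntegral.integral_sub, intervalIntegral.integral_add,
      intervalIntegral.integral_const_mul, intervalIntegral.integral_const_mul,
      intervalIntegral.integral_const_mul, E2, mul_zero, sub_zero]
    all_goals exact Continuous.intervalIntegrable (by fun_prop) _ _
  have F3 : ∫ y in (0 : ℝ)..1, (a y ^ 2 + b y ^ 2)
      = -(2 * ∫ y in (0 : ℝ)..1, ((y - l) * (a₁ y * a y + b₁ y * b y))) := by
    rw [intervalIntegral.integral_add, intervalIntegral.integral_const_mul] at E3
    · linarith
    all_goals exact Continuous.intervalIntegrable (by fun_prop) _ _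
  have S1 := abs_intervalIntegral_le_sqrt_mul_sqrt (f := fun y => P y * a y + Q y * b y)
    (G := fun y => P y ^ 2 + Q y ^ 2) (H := fun y => a y ^ 2 + b y ^ 2)
    (by fun_prop) (by fun_prop) (by fun_prop) (fun y => by positivity) (fun y => by positivity)
    (fun y => by nlinarith [sq_nonneg (P y * b y - Q y * a y)])
  have S2 := abs_intervalIntegral_le_sqrt_mul_sqrt
    (f := fun y => (y - l) * (Q y * a y - P y * b y))
    (G := fun y => P y ^ 2 + Q y ^ 2) (H := fun y => (y - l) ^ 2 * (a y ^ 2 + b y ^ 2))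
    (by fun_prop) (by fun_prop) (by fun_prop) (fun y => by positivity) (fun y => by positivity)
    (fun y => by nlinarith [sq_nonneg ((y - l) * (P y * a y + Q y * b y))])
  have S3 := abs_intervalIntegral_le_sqrt_mul_sqrt (f := fun y => b₁ y * a y - a₁ y * b y)
    (G := fun y => a₁ y ^ 2 + b₁ y ^ 2) (H := fun y => a y ^ 2 + b y ^ 2)
    (by fun_prop) (by fun_prop) (by fun_prop) (fun y => by positivity) (fun y => by positivity)
    (fun y => by nlinarith [sq_nonneg (a₁ y * a y + b₁ y * b y)])
  have S4 := abs_intervalIntegral_le_sqrt_mul_sqrt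
    (f := fun y => (y - l) * (a₁ y * a y + b₁ y * b y))
    (G := fun y => (y - l) ^ 2 * (a y ^ 2 + b y ^ 2)) (H := fun y => a₁ y ^ 2 + b₁ y ^ 2)
    (by fun_prop) (by fun_prop) (by fun_prop) (fun y => by positivity) (fun y => by positivity)
    (fun y => by nlinarith [sq_nonneg ((y - l) * (a₁ y * b y - b₁ y * a y))])
  refine cube_le_of_energy_bounds (Real.sqrt_nonneg _) (Real.sqrt_nonneg _)
    (Real.sqrt_nonneg _) hν (abs_pos.2 hk)
    (b := Real.sqrt (∫ y in (0 : ℝ)..1, (a₁ y ^ 2 + b₁ y ^ 2)))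
    (c := Real.sqrt (∫ y in (0 : ℝ)..1, ((y - l) ^ 2 * (a y ^ 2 + b y ^ 2)))) ?_ ?_ ?_
  · rw [Real.sq_sqrt nB]
    rw [F1] at S1
    have := mul_nonneg (mul_nonneg hν.le (sq_nonneg k)) nA
    linarith [le_abs_self (ν * (∫ y in (0 : ℝ)..1, (a₁ y ^ 2 + b₁ y ^ 2))
        + ν * k ^ 2 * ∫ y in (0 : ℝ)..1, (a y ^ 2 + b y ^ 2))]
  · rw [Real.sq_sqrt nC, ← abs_of_nonneg nC, ← abs_mul,
      eq_sub_of_add_eq' F2.symm, abs_of_nonneg nC]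
    refine (abs_sub _ _).trans (add_le_add S2 ?_)
    rw [abs_mul, abs_of_pos hν]
    exact mul_le_mul_of_nonneg_left S3 hν.le
  · rw [Real.sq_sqrt nA, F3]
    refine (neg_le_abs _).trans ?_
    rw [abs_mul, abs_two]
    exact mul_le_mul_of_nonneg_left S4 zero_le_two

/-- resolvent estimate for the linearized Couette operator on `(0,1)`:
`(νk²)^{1/3} ‖w‖_{L²(0,1)} ≤ C ‖F‖_{L²(0,1)}` where
`F = −ν(w'' − k²w) + ik(y−λ)w` and `w(0) = w(1) = 0`.
(Functions in `H²((0,1)) ∩ H¹₀((0,1))` are represented, via the standard density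
argument, by twice continuously differentiable functions vanishing at `0` and `1`.) -/
theorem stmt_17 :
    ∃ ε C : ℝ, 0 < ε ∧ 0 < C ∧
      ∀ (k : ℤ) (ν lam : ℝ) (w : ℝ → ℂ),
        k ≠ 0 → 0 < ν → ν ≤ ε * |(k : ℝ)| →
        ContDiff ℝ 2 w → w 0 = 0 → w 1 = 0 →
        (ν * (k : ℝ) ^ 2) ^ ((1 : ℝ) / 3)
            * Real.sqrt (∫ y in Ioo (0 : ℝ) 1, ‖w y‖ ^ 2)
          ≤ C * Real.sqrt (∫ y in Ioo (0 : ℝ) 1,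
              ‖-(ν : ℂ) * (deriv (deriv w) y - (k : ℂ) ^ 2 * w y)
                  + Complex.I * (k : ℂ) * ((y : ℂ) - (lam : ℂ)) * w y‖ ^ 2) := by
  refine ⟨1, 4, one_pos, by norm_num, fun k ν l w hk hν _ hw w0 w1 => ?_⟩
  have hw' : ContDiff ℝ 1 (deriv w) := hw.deriv'
  have d0 : ∀ y, HasDerivAt w (deriv w y) y := fun y =>
    (hw.differentiable (by norm_num) y).hasDerivAt
  have d1 : ∀ y, HasDerivAt (deriv w) (deriv (deriv w) y) y := fun y =>
    (hw'.differentiable (by norm_num) y).hasDerivAt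
  have c2 : Continuous (deriv (deriv w)) := hw'.continuous_deriv le_rfl
  have key := couette_resolvent_cube (l := l) (k := k) (ν := ν)
    (fun y => Complex.reCLM.hasFDerivAt.comp_hasDerivAt y (d0 y))
    (fun y => Complex.imCLM.hasFDerivAt.comp_hasDerivAt y (d0 y))
    (fun y => Complex.reCLM.hasFDerivAt.comp_hasDerivAt y (d1 y))
    (fun y => Complex.imCLM.hasFDerivAt.comp_hasDerivAt y (d1 y))
    (Complex.reCLM.continuous.comp c2) (Complex.imCLM.continuous.comp c2)
    (by exact_mod_cast hk) hν (by simp [w0]) (by simp [w1]) (by simp [w0]) (by simp [w1])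
    (fun y => rfl) (fun y => rfl)
  have n1 : ∀ z : ℂ, ‖z‖ ^ 2 = z.re ^ 2 + z.im ^ 2 := fun z => by
    rw [Complex.sq_norm, Complex.normSq_apply]; ring
  have hF : ∀ y : ℝ, ‖-(ν : ℂ) * (deriv (deriv w) y - (k : ℂ) ^ 2 * w y)
      + Complex.I * (k : ℂ) * ((y : ℂ) - (l : ℂ)) * w y‖ ^ 2
      = (-ν * ((deriv (deriv w) y).re - (k : ℝ) ^ 2 * (w y).re) - k * (y - l) * (w y).im) ^ 2
        + (-ν * ((deriv (deriv w) y).im - (k : ℝ) ^ 2 * (w y).im)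
          + k * (y - l) * (w y).re) ^ 2 := fun y => by
    rw [n1]
    congr 2
    · simp [pow_two, sub_eq_add_neg]
    · simp [pow_two]
  rw [← integral_Ioc_eq_integral_Ioo, ← integral_Ioc_eq_integral_Ioo,
    ← intervalIntegral.integral_of_le zero_le_one, ← intervalIntegral.integral_of_le zero_le_one]
  simp_rw [hF, n1]
  refine le_of_pow_le_pow_left₀ three_ne_zero (by positivity) ?_
  rw [mul_pow, mul_pow, ← Real.rpow_natCast (_ ^ ((1 : ℝ) / 3)), ← Real.rpow_mul (by positivity)]
  norm_num
  simpa [sq_abs] using key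
end

section
/- There exists a universal constant C > 0 such that for every 0 < ν < 1 and k = 1, there exist λ₀ ∈ ℝ and a nonzero function w₀ ∈ H²((0,1)) ∩ H¹₀((0,1)) such that ‖ −ν( w₀'' − w₀ ) + i (y − λ₀) w₀ ‖_{L²(0,1)} ≤ C ν^{1/3} ‖w₀‖_{L²(0,1)}. In particular one may take λ₀ = 0 and w₀(y) = y³(ν^{1/3} − y)³ for 0 ≤ y ≤ ν^{1/3} and w₀(y) = 0 otherwise. -/
open MeasureTheory Set

/-- The cubic bump `y³(d - y)³` on `[0, d]`, extended by zero. -/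
noncomputable def cubicBump (d y : ℝ) : ℂ :=
  if 0 ≤ y ∧ y ≤ d then ((y ^ 3 * (d - y) ^ 3 : ℝ) : ℂ) else 0

lemma cubicBump_of_mem_Ioo {d y : ℝ} (hy : y ∈ Ioo 0 d) :
    cubicBump d y = ((y ^ 3 * (d - y) ^ 3 : ℝ) : ℂ) :=
  if_pos ⟨hy.1.le, hy.2.le⟩

lemma cubicBump_of_lt {d y : ℝ} (hy : d < y) : cubicBump d y = 0 :=
  if_neg fun h => hy.not_ge h.2

lemma deriv_deriv_cubicBump_of_lt {d y : ℝ} (hy : d < y) :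
    deriv (deriv (cubicBump d)) y = 0 := by
  have h : cubicBump d =ᶠ[nhds y] fun _ => 0 := by
    filter_upwards [Ioi_mem_nhds hy] with x hx using cubicBump_of_lt hx
  rw [h.deriv.deriv_eq]
  simp

lemma deriv_deriv_cubicBump_of_mem_Ioo {d y : ℝ} (hy : y ∈ Ioo 0 d) :
    deriv (deriv (cubicBump d)) y =
      ((6 * (y * (d - y)) * (d ^ 2 - 5 * (y * (d - y))) : ℝ) : ℂ) := by
  have h : cubicBump d =ᶠ[nhds y] fun x => ((x ^ 3 * (d - x) ^ 3 : ℝ) : ℂ) := by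
    filter_upwards [Ioo_mem_nhds hy.1 hy.2] with x hx using cubicBump_of_mem_Ioo hx
  rw [h.deriv.deriv_eq]
  have h₁ : deriv (fun x : ℝ => ((x ^ 3 * (d - x) ^ 3 : ℝ) : ℂ)) =
      fun x => ((3 * x ^ 2 * (d - x) ^ 3 - 3 * x ^ 3 * (d - x) ^ 2 : ℝ) : ℂ) := by
    funext x
    have := ((hasDerivAt_id x).pow 3).mul (((hasDerivAt_id x).const_sub d).pow 3)
    refine HasDerivAt.deriv (HasDerivAt.ofReal_comp (this.congr_deriv ?_))
    simp
    ring
  rw [h₁]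
  have := ((((hasDerivAt_id y).pow 2).const_mul 3).mul (((hasDerivAt_id y).const_sub d).pow 3)).sub
    ((((hasDerivAt_id y).pow 3).const_mul 3).mul (((hasDerivAt_id y).const_sub d).pow 2))
  refine HasDerivAt.deriv (HasDerivAt.ofReal_comp (this.congr_deriv ?_))
  simp
  ring

lemma integral_norm_sq_cubicBump {d : ℝ} (hd : 0 < d) (hd1 : d < 1) :
    ∫ y in Ioo (0 : ℝ) 1, ‖cubicBump d y‖ ^ 2 = d ^ 13 / 12012 := by
  have h : (fun y => ‖cubicBump d y‖ ^ 2) =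
      (Icc 0 d).indicator fun y => (y ^ 3 * (d - y) ^ 3) ^ 2 := by
    funext y
    by_cases hy : y ∈ Icc 0 d
    · rw [indicator_of_mem hy, cubicBump, if_pos (mem_Icc.1 hy), Complex.norm_real,
        Real.norm_eq_abs, sq_abs]
    · rw [indicator_of_notMem hy, cubicBump, if_neg (mt mem_Icc.2 hy)]
      simp
  have hs : Ioo (0 : ℝ) 1 ∩ Icc 0 d = Ioc 0 d := by
    ext y
    constructor
    · rintro ⟨h₁, h₂⟩
      exact ⟨h₁.1, h₂.2⟩
    · rintro ⟨h₁, h₂⟩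
      exact ⟨⟨h₁, h₂.trans_lt hd1⟩, h₁.le, h₂⟩
  rw [h, setIntegral_indicator measurableSet_Icc, hs, ← intervalIntegral.integral_of_le hd.le]
  have hF : ∀ y ∈ uIcc 0 d, HasDerivAt
      (fun y : ℝ => d ^ 6 * y ^ 7 / 7 - 6 * d ^ 5 * y ^ 8 / 8 + 15 * d ^ 4 * y ^ 9 / 9
        - 20 * d ^ 3 * y ^ 10 / 10 + 15 * d ^ 2 * y ^ 11 / 11 - 6 * d * y ^ 12 / 12 + y ^ 13 / 13)
      ((y ^ 3 * (d - y) ^ 3) ^ 2) y := by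
    intro y _
    have hp (n : ℕ) (a b : ℝ) :
        HasDerivAt (fun y : ℝ => a * y ^ n / b) (a * (n * y ^ (n - 1)) / b) y :=
      ((hasDerivAt_pow n y).const_mul a).div_const b
    have := ((((((hp 7 (d ^ 6) 7).sub (hp 8 (6 * d ^ 5) 8)).add (hp 9 (15 * d ^ 4) 9)).sub
      (hp 10 (20 * d ^ 3) 10)).add (hp 11 (15 * d ^ 2) 11)).sub (hp 12 (6 * d) 12)).add
      ((hasDerivAt_pow 13 y).div_const 13)
    refine this.congr_deriv ?_
    norm_num
    ring
  rw [intervalIntegral.integral_eq_sub_of_hasDerivAt hF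
    (Continuous.intervalIntegrable (by fun_prop) _ _)]
  ring

lemma norm_couette_cubicBump_le {d y : ℝ} (hd1 : d < 1) (hy : y ∈ Ioo 0 d) :
    ‖-((d ^ 3 : ℝ) : ℂ) * (deriv (deriv (cubicBump d)) y - cubicBump d y)
      + Complex.I * y * cubicBump d y‖ ≤ 2 * d ^ 7 := by
  have hd : 0 < d := hy.1.trans hy.2
  rw [deriv_deriv_cubicBump_of_mem_Ioo hy, cubicBump_of_mem_Ioo hy, ← mul_pow]
  set t := y * (d - y) with ht
  have ht0 : 0 ≤ t := mul_nonneg hy.1.le (sub_nonneg.2 hy.2.le)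
  have ht1 : t ≤ d ^ 2 / 4 := by nlinarith [sq_nonneg (2 * y - d)]
  have ht3 : t ^ 3 ≤ d ^ 6 / 64 := by
    calc t ^ 3 ≤ (d ^ 2 / 4) ^ 3 := by gcongr
      _ = d ^ 6 / 64 := by ring
  have ht3' : t ^ 3 ≤ d ^ 4 / 64 := by
    have : d ^ 6 ≤ d ^ 4 := pow_le_pow_of_le_one hd.le hd1.le (by norm_num)
    linarith
  have h₂ : |6 * t * (d ^ 2 - 5 * t)| ≤ 3 / 2 * d ^ 4 := by
    rw [abs_mul, abs_of_nonneg (by positivity)]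
    calc 6 * t * |d ^ 2 - 5 * t| ≤ 6 * (d ^ 2 / 4) * d ^ 2 := by
          gcongr
          rw [abs_le]
          constructor <;> nlinarith
      _ = 3 / 2 * d ^ 4 := by ring
  have h₃ : |6 * t * (d ^ 2 - 5 * t) - t ^ 3| ≤ 3 / 2 * d ^ 4 + d ^ 4 / 64 := by
    refine (abs_sub _ _).trans (add_le_add h₂ ?_)
    rwa [abs_of_nonneg (by positivity)]
  have hy0 : 0 ≤ y := hy.1.le
  refine (norm_add_le _ _).trans ?_
  rw [← Complex.ofReal_sub, norm_mul, norm_neg, norm_mul, norm_mul, Complex.norm_I,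
    Complex.norm_real, Complex.norm_real, Complex.norm_real, Complex.norm_real, Real.norm_eq_abs,
    Real.norm_eq_abs, Real.norm_eq_abs, Real.norm_eq_abs, abs_of_pos (pow_pos hd 3),
    abs_of_nonneg hy0, abs_of_nonneg (pow_nonneg ht0 3), one_mul]
  calc d ^ 3 * |6 * t * (d ^ 2 - 5 * t) - t ^ 3| + y * t ^ 3
      ≤ d ^ 3 * (3 / 2 * d ^ 4 + d ^ 4 / 64) + d * (d ^ 6 / 64) := by
        gcongr
        exact hy.2.le
    _ ≤ 2 * d ^ 7 := by nlinarith [pow_pos hd 7]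

lemma integral_norm_sq_couette_cubicBump_le {d : ℝ} (hd : 0 < d) (hd1 : d < 1) :
    ∫ y in Ioo (0 : ℝ) 1,
      ‖-((d ^ 3 : ℝ) : ℂ) * (deriv (deriv (cubicBump d)) y - cubicBump d y)
        + Complex.I * y * cubicBump d y‖ ^ 2 ≤ 4 * d ^ 15 := by
  have hs : Ioo (0 : ℝ) 1 ∩ Ioo 0 d = Ioo 0 d :=
    inter_eq_right.2 (Ioo_subset_Ioo_right hd1.le)
  calc _ ≤ ∫ y in Ioo (0 : ℝ) 1, (Ioo 0 d).indicator (fun _ => (2 * d ^ 7) ^ 2) y := by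
        refine integral_mono_of_nonneg (.of_forall fun y => by positivity)
          ((integrable_const _).indicator measurableSet_Ioo) ?_
        filter_upwards [ae_restrict_mem measurableSet_Ioo,
          ae_restrict_of_ae (Measure.ae_ne volume d)] with y hy hyd
        rcases lt_or_gt_of_ne hyd with h | h
        · rw [indicator_of_mem (show y ∈ Ioo 0 d from ⟨hy.1, h⟩)]
          gcongr
          exact norm_couette_cubicBump_le hd1 ⟨hy.1, h⟩
        · rw [deriv_deriv_cubicBump_of_lt h, cubicBump_of_lt h,
            indicator_of_notMem fun h' => h.not_gt h'.2]
          simp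
    _ = 4 * d ^ 15 := by
        rw [setIntegral_indicator measurableSet_Ioo, hs, setIntegral_const]
        simp only [Measure.real, Real.volume_Ioo, sub_zero, ENNReal.toReal_ofReal hd.le,
          smul_eq_mul]
        ring

/-- sharpness of the bound `(νk²)^{1/3}` for the Couette operator with
`k = 1`: for `0 < ν < 1` there are `λ₀ = 0` and a nonzero `w₀ ∈ H²((0,1)) ∩ H¹₀((0,1))`
(explicitly `w₀(y) = y³(ν^{1/3} − y)³` on `[0, ν^{1/3}]`, `0` elsewhere) with
`‖−ν(w₀'' − w₀) + i(y − λ₀)w₀‖_{L²(0,1)} ≤ C ν^{1/3} ‖w₀‖_{L²(0,1)}`. -/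
theorem stmt_18 :
    ∃ C : ℝ, 0 < C ∧
      ∀ ν : ℝ, 0 < ν → ν < 1 →
        ∃ (lam : ℝ) (w₀ : ℝ → ℂ),
          lam = 0 ∧
          (∀ y : ℝ, w₀ y =
            if 0 ≤ y ∧ y ≤ ν ^ ((1 : ℝ) / 3)
            then ((y ^ 3 * (ν ^ ((1 : ℝ) / 3) - y) ^ 3 : ℝ) : ℂ)
            else 0) ∧
          (∃ y ∈ Ioo (0 : ℝ) 1, w₀ y ≠ 0) ∧
          Real.sqrt (∫ y in Ioo (0 : ℝ) 1,
              ‖-(ν : ℂ) * (deriv (deriv w₀) y - w₀ y)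
                  + Complex.I * ((y : ℂ) - (lam : ℂ)) * w₀ y‖ ^ 2)
            ≤ C * ν ^ ((1 : ℝ) / 3)
                * Real.sqrt (∫ y in Ioo (0 : ℝ) 1, ‖w₀ y‖ ^ 2) := by
  refine ⟨220, by norm_num, fun ν hν hν1 => ?_⟩
  set d := ν ^ ((1 : ℝ) / 3) with hd_def
  have hd : 0 < d := Real.rpow_pos_of_pos hν _
  have hd1 : d < 1 := Real.rpow_lt_one hν.le hν1 (by norm_num)
  have hν3 : ν = d ^ 3 := by
    rw [hd_def, ← Real.rpow_natCast, ← Real.rpow_mul hν.le]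
    norm_num
  refine ⟨0, cubicBump d, rfl, fun y => rfl, ⟨d / 2, ⟨by linarith, by linarith⟩, ?_⟩, ?_⟩
  · rw [cubicBump_of_mem_Ioo ⟨by linarith, by linarith⟩, Complex.ofReal_ne_zero, sub_half]
    positivity
  · rw [integral_norm_sq_cubicBump hd hd1, hν3]
    simp only [Complex.ofReal_zero, sub_zero]
    refine Real.sqrt_le_iff.2 ⟨by positivity,
      (integral_norm_sq_couette_cubicBump_le hd hd1).trans ?_⟩
    rw [mul_pow, Real.sq_sqrt (by positivity)]
    nlinarith [pow_pos hd 15]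
end
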